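/- Let F be a closed connected subset of the plane ℝ². Then the space Homeo⁺(ℝ², F) of orientation-preserving homeomorphisms of ℝ² fixing every point of F, equipped with the topology of uniform convergence on compact subsets, is arcwise connected. Equivalently, every closed connected subset of the fixed point set of an orientation-preserving homeomorphism of the plane is unlinked for it. -/

import Mathlib

open unitInterval

/-- A surface: connected, Hausdorff, second-countable, every point has an open
neighbourhood homeomorphic to `ℝ²`. -/
def IsSurface (S : Type*) [TopologicalSpace S] : Prop :=
  ConnectedSpace S ∧ T2Space S ∧ SecondCountableTopology S ∧
    ∀ x : S, ∃ U : Set S, IsOpen U ∧ x ∈ U ∧ Nonempty (U ≃ₜ (ℝ × ℝ))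

/-- `f` is isotopic to the identity relatively to `F`: there is a continuous path of
homeomorphisms (for the topology of uniform convergence on compact subsets) from the
identity to `f` fixing `F` pointwise at all times. -/
def IsotopicToIdRel (S : Type*) [TopologicalSpace S] (f : S ≃ₜ S) (F : Set S) : Prop :=
  ∃ H : unitInterval → S ≃ₜ S,
    Continuous (fun p : S × unitInterval => H p.2 p.1) ∧
    Continuous (fun p : S × unitInterval => (H p.2).symm p.1) ∧
    H 0 = Homeomorph.refl S ∧ H 1 = f ∧
    ∀ t : unitInterval, ∀ x ∈ F, H t x = x

/-- `f` is strongly homotopic to the identity relatively to `F`. -/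
def StronglyHomotopicToIdRel (S : Type*) [TopologicalSpace S] (f : S → S) (F : Set S) : Prop :=
  ∃ H : S × unitInterval → S, Continuous H ∧
    (∀ x, H (x, 0) = x) ∧ (∀ x, H (x, 1) = f x) ∧
    (∀ x ∉ F, ∀ t, H (x, t) ∉ F) ∧
    (∀ x ∈ F, ∀ t, H (x, t) = x)

/-- A free homotopy between two loops `γ, γ'` (parametrized by the unit circle) whose
image stays inside the subset `A`. -/
def FreelyHomotopicIn {X Y : Type*} [TopologicalSpace X] [TopologicalSpace Y]
    (A : Set Y) (γ γ' : X → Y) : Prop :=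
  ∃ H : X × unitInterval → Y, Continuous H ∧
    (∀ s, H (s, 0) = γ s) ∧ (∀ s, H (s, 1) = γ' s) ∧ ∀ p, H p ∈ A

/-- A homeomorphism of the plane `ℂ = ℝ²` preserves the orientation if it sends every
positively oriented round circle (the circle `u ↦ x + u` around `x`) to a loop which is
freely homotopic, in the complement of the image `f x` of its center, to the positively
oriented circle `u ↦ f x + u` around `f x`. -/
def OrientationPreserving (f : ℂ ≃ₜ ℂ) : Prop :=
  ∀ x : ℂ, FreelyHomotopicIn {f x}ᶜ
    (fun u : Circle => f (x + (u : ℂ))) (fun u : Circle => f x + (u : ℂ))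

section LengthArea

open Set Filter Topology MeasureTheory Metric
open scoped ENNReal

/-- A curve whose norm takes values at most `s` and at least `2 * s` has length at least `s`
inside the disc of radius `2 * s`. -/
lemma ofReal_le_lintegral_of_oscillation {J : Set ℝ} (hJ : IsOpen J) (hJc : J.OrdConnected)
    {g g' : ℝ → ℂ} (hg : ∀ x ∈ J, HasDerivAt g (g' x) x) {s : ℝ} (hs : 0 < s)
    (h1 : ∃ x ∈ J, ‖g x‖ ≤ s) (h2 : ∃ x ∈ J, 2 * s ≤ ‖g x‖) :
    ENNReal.ofReal s ≤ ∫⁻ x in J ∩ {x | ‖g x‖ < 2 * s}, ‖g' x‖ₑ := by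
  have hc : ContinuousOn (fun x => ‖g x‖) J := fun x hx =>
    (hg x hx).continuousAt.norm.continuousWithinAt
  set E := J ∩ (fun x => ‖g x‖) ⁻¹' Ioo s (2 * s) with hE
  have hEo : IsOpen E := hc.isOpen_inter_preimage hJ isOpen_Ioo
  have hd : ∀ x ∈ E, HasDerivWithinAt (fun x => ‖g x‖) (fderiv ℝ (fun z : ℂ => ‖z‖) (g x) (g' x))
      E x := by
    intro x hx
    have hne : g x ≠ 0 := norm_pos_iff.1 (hs.trans hx.2.1)
    have h3 : DifferentiableAt ℝ (fun z : ℂ => ‖z‖) (g x) := differentiableAt_id.norm ℝ hne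
    exact (h3.hasFDerivAt.comp_hasDerivAt x (hg x hx.1)).hasDerivWithinAt
  have himg : Ioo s (2 * s) ⊆ (fun x => ‖g x‖) '' E := by
    obtain ⟨x, hx, hxs⟩ := h1
    obtain ⟨y, hy, hys⟩ := h2
    intro v hv
    obtain ⟨w, hw, hwv⟩ := hJc.isPreconnected.intermediate_value hx hy hc
      ⟨hxs.trans hv.1.le, hv.2.le.trans hys⟩
    exact ⟨w, ⟨hw, by simpa [hwv] using hv⟩, hwv⟩
  calc ENNReal.ofReal s = volume (Ioo s (2 * s)) := by rw [Real.volume_Ioo]; congr 1; ring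
    _ ≤ volume ((fun x => ‖g x‖) '' E) := measure_mono himg
    _ ≤ ∫⁻ x in E, ENNReal.ofReal |(ContinuousLinearMap.toSpanSingleton ℝ
          (fderiv ℝ (fun z : ℂ => ‖z‖) (g x) (g' x))).det| :=
        addHaar_image_le_lintegral_abs_det_fderiv volume hEo.measurableSet
          (fun x hx => (hd x hx).hasFDerivWithinAt)
    _ ≤ ∫⁻ x in E, ‖g' x‖ₑ := by
        refine lintegral_mono fun x => ?_
        rw [ContinuousLinearMap.det_toSpanSingleton, ← Real.norm_eq_abs, ofReal_norm]
        refine enorm_le_iff_norm_le.2 ?_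
        refine (ContinuousLinearMap.le_opNorm _ _).trans ?_
        have := norm_fderiv_le_of_lipschitz ℝ (f := fun z : ℂ => ‖z‖) (x₀ := g x)
          lipschitzWith_one_norm
        simpa using mul_le_mul_of_nonneg_right this (norm_nonneg (g' x))
    _ ≤ _ := lintegral_mono_set (show E ⊆ J ∩ {x | ‖g x‖ < 2 * s} from fun x hx => ⟨hx.1, hx.2.2⟩)

/-- The area formula for an injective holomorphic function. -/
lemma lintegral_enorm_deriv_sq {U : Set ℂ} (hU : IsOpen U) {φ : ℂ → ℂ}
    (hd : DifferentiableOn ℂ φ U) (hi : InjOn φ U) :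
    ∫⁻ z in U, ‖deriv φ z‖ₑ ^ 2 = volume (φ '' U) := by
  rw [← lintegral_abs_det_fderiv_eq_addHaar_image volume hU.measurableSet
    (f' := fun z => (fderiv ℂ φ z).restrictScalars ℝ)
    (fun z hz => ((hd.differentiableAt (hU.mem_nhds hz)).hasFDerivAt.restrictScalars
      ℝ).hasFDerivWithinAt) hi]
  refine setLIntegral_congr_fun hU.measurableSet fun z hz => ?_
  have : ((fderiv ℂ φ z).restrictScalars ℝ).det = ‖deriv φ z‖ ^ 2 := by
    rw [ContinuousLinearMap.det, ← LinearMap.det_toMatrix Complex.basisOneI, Matrix.det_fin_two]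
    simp [LinearMap.toMatrix_apply, Complex.sq_norm, Complex.normSq_apply]
  simp only [this, abs_pow, abs_norm]
  rw [ENNReal.ofReal_pow (norm_nonneg _), ofReal_norm]

/-- The angles at which the circle of centre `c` and radius `r` lies in `U`. -/
def angleSet (U : Set ℂ) (c : ℂ) (r : ℝ) : Set ℝ :=
  {x ∈ Ioo (-Real.pi) Real.pi | circleMap c r x ∈ U}

lemma isOpen_angleSet {U : Set ℂ} (hU : IsOpen U) (c : ℂ) (r : ℝ) : IsOpen (angleSet U c r) :=
  isOpen_Ioo.inter (hU.preimage (continuous_circleMap c r))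

lemma sq_lintegral_le {E : Set ℝ} (hE : E ⊆ Ioo (-Real.pi) Real.pi) {h : ℝ → ℝ≥0∞}
    (hh : Measurable h) :
    (∫⁻ x in E, h x) ^ 2 ≤ ENNReal.ofReal (2 * Real.pi) * ∫⁻ x in E, h x ^ 2 := by
  have h1 := ENNReal.lintegral_mul_le_Lp_mul_Lq (volume.restrict E)
    (Real.holderConjugate_iff.2 ⟨one_lt_two, by norm_num⟩ : (2 : ℝ).HolderConjugate 2)
    (f := h) (g := fun _ => 1) hh.aemeasurable aemeasurable_const
  have h2 : volume E ≤ ENNReal.ofReal (2 * Real.pi) := by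
    refine (measure_mono hE).trans ?_
    rw [Real.volume_Ioo]; exact ENNReal.ofReal_le_ofReal (by linarith)
  simp only [Pi.mul_apply, mul_one, ENNReal.one_rpow, lintegral_const, Measure.restrict_apply,
    MeasurableSet.univ, univ_inter, one_mul] at h1
  calc _ ≤ _ := pow_le_pow_left₀ (zero_le) h1 2
    _ = (∫⁻ x in E, h x ^ 2) * volume E := by
      rw [mul_pow, ← ENNReal.rpow_natCast, ← ENNReal.rpow_natCast, ← ENNReal.rpow_mul,
        ← ENNReal.rpow_mul]
      simp
    _ ≤ _ := by rw [mul_comm]; gcongr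

lemma length_area {U : Set ℂ} (hU : IsOpen U) {φ : ℂ → ℂ} (hd : DifferentiableOn ℂ φ U)
    (hi : InjOn φ U) {c p : ℂ} {a s : ℝ} (ha : 0 < a) (hs : 0 < s)
    (hconn : ∀ r ∈ Icc a (Real.exp 80 * a), (angleSet U c r).OrdConnected)
    (hmeet : ∀ r ∈ Icc a (Real.exp 80 * a), ∃ x ∈ angleSet U c r, ‖φ (circleMap c r x) - p‖ ≤ s) :
    ∃ r ∈ Icc a (Real.exp 80 * a), ∀ x ∈ angleSet U c r, ‖φ (circleMap c r x) - p‖ ≤ 2 * s := by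
  by_contra! hcon
  have hpi := Real.pi_pos
  set S := U ∩ φ ⁻¹' ball p (2 * s) with hS
  have hSo : IsOpen S := hd.continuousOn.isOpen_inter_preimage hU isOpen_ball
  set F : ℂ → ℝ≥0∞ := S.indicator (fun z => ‖deriv φ z‖ₑ ^ 2) with hF
  have hFm : Measurable F := ((measurable_deriv φ).enorm.pow_const 2).indicator hSo.measurableSet
  have key : ∀ r ∈ Icc a (Real.exp 80 * a), ENNReal.ofReal (s ^ 2 / (2 * Real.pi) * r⁻¹) ≤
      ∫⁻ x in Ioo (-Real.pi) Real.pi, ENNReal.ofReal r * F (circleMap c r x) := by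
    intro r hr
    have hr0 : 0 < r := ha.trans_le hr.1
    obtain ⟨x, hx, hxs⟩ := hmeet r hr
    obtain ⟨y, hy, hys⟩ := hcon r hr
    have hder : ∀ x ∈ angleSet U c r, HasDerivAt (fun x => φ (circleMap c r x) - p)
        (deriv φ (circleMap c r x) * (circleMap 0 r x * Complex.I)) x := fun x hx =>
      ((hd.differentiableAt (hU.mem_nhds hx.2)).hasDerivAt.comp x
        (hasDerivAt_circleMap c r x)).sub_const p
    have h1 := ofReal_le_lintegral_of_oscillation (isOpen_angleSet hU c r) (hconn r hr) hder hs
      ⟨x, hx, hxs⟩ ⟨y, hy, hys.le⟩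
    set E := angleSet U c r ∩ {x | ‖φ (circleMap c r x) - p‖ < 2 * s} with hE
    have hEo : IsOpen E := by
      have : E = Ioo (-Real.pi) Real.pi ∩ circleMap c r ⁻¹' S := by
        ext x; simp [hE, hS, angleSet, dist_eq_norm, and_assoc]
      rw [this]; exact isOpen_Ioo.inter (hSo.preimage (continuous_circleMap c r))
    have h2 : ∫⁻ x in E, ‖deriv φ (circleMap c r x) * (circleMap 0 r x * Complex.I)‖ₑ =
        ∫⁻ x in E, ENNReal.ofReal r * ‖deriv φ (circleMap c r x)‖ₑ := by
      congr 1; ext x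
      rw [enorm_mul, enorm_mul, mul_comm]
      congr 1
      rw [← ofReal_norm, ← ofReal_norm]; simp [abs_of_pos hr0]
    have hm : Measurable fun x => ENNReal.ofReal r * ‖deriv φ (circleMap c r x)‖ₑ :=
      ((measurable_deriv φ).comp (continuous_circleMap c r).measurable).enorm.const_mul _
    rw [h2] at h1
    have h3 := (pow_le_pow_left₀ zero_le h1 2).trans
      (sq_lintegral_le (inter_subset_left.trans fun x hx => hx.1) hm)
    have h4 : ∫⁻ x in E, (ENNReal.ofReal r * ‖deriv φ (circleMap c r x)‖ₑ) ^ 2 ≤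
        ENNReal.ofReal r * ∫⁻ x in Ioo (-Real.pi) Real.pi, ENNReal.ofReal r *
          F (circleMap c r x) := by
      rw [← lintegral_const_mul' _ _ ENNReal.ofReal_ne_top]
      calc _ = ∫⁻ x in E, ENNReal.ofReal r * (ENNReal.ofReal r * F (circleMap c r x)) := by
            refine setLIntegral_congr_fun hEo.measurableSet fun x hx => ?_
            have : circleMap c r x ∈ S := ⟨hx.1.2, by simpa [dist_eq_norm] using hx.2⟩
            simp only [hF, indicator_of_mem this]; ring
        _ ≤ _ := lintegral_mono_set (inter_subset_left.trans fun x hx => hx.1)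
    have h5 := h3.trans (mul_le_mul_right h4 _)
    rw [← mul_assoc, ← ENNReal.ofReal_mul (by positivity), ← ENNReal.ofReal_pow hs.le] at h5
    rw [show s ^ 2 / (2 * Real.pi) * r⁻¹ = s ^ 2 / (2 * Real.pi * r) by field_simp,
      ENNReal.ofReal_div_of_pos (by positivity)]
    exact ENNReal.div_le_of_le_mul' h5
  have hle : a ≤ Real.exp 80 * a := by nlinarith [Real.add_one_le_exp (80 : ℝ)]
  have hint : ∫⁻ r in Icc a (Real.exp 80 * a), ENNReal.ofReal (s ^ 2 / (2 * Real.pi) * r⁻¹) =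
      ENNReal.ofReal (s ^ 2 / (2 * Real.pi) * 80) := by
    have hcont : ContinuousOn (fun r : ℝ => s ^ 2 / (2 * Real.pi) * r⁻¹)
        (Icc a (Real.exp 80 * a)) := continuousOn_const.mul
      (continuousOn_inv₀.mono fun r hr => (ha.trans_le hr.1).ne')
    rw [← ofReal_integral_eq_lintegral_ofReal hcont.integrableOn_Icc, integral_Icc_eq_integral_Ioc,
      ← intervalIntegral.integral_of_le hle, intervalIntegral.integral_const_mul,
      integral_inv_of_pos ha (by positivity), mul_div_assoc, div_self ha.ne', mul_one, Real.log_exp]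
    refine (ae_restrict_mem measurableSet_Icc).mono fun r hr => ?_
    have := ha.trans_le hr.1
    simp only [Pi.zero_apply]; positivity
  have h6 : ENNReal.ofReal (s ^ 2 / (2 * Real.pi) * 80) ≤ ∫⁻ z, F z := by
    rw [← hint, ← lintegral_add_left_eq_self F c, ← Complex.lintegral_comp_polarCoord_symm]
    have hm : Measurable fun q : ℝ × ℝ => ENNReal.ofReal q.1 *
        F (circleMap c q.1 q.2) := by
      refine (ENNReal.measurable_ofReal.comp measurable_fst).mul (hFm.comp ?_)
      unfold circleMap; fun_prop
    calc _ ≤ ∫⁻ r in Icc a (Real.exp 80 * a), ∫⁻ x in Ioo (-Real.pi) Real.pi,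
            ENNReal.ofReal r * F (circleMap c r x) := setLIntegral_mono' measurableSet_Icc key
      _ ≤ ∫⁻ r in Ioi 0, ∫⁻ x in Ioo (-Real.pi) Real.pi,
            ENNReal.ofReal r * F (circleMap c r x) :=
          lintegral_mono_set fun r hr => ha.trans_le hr.1
      _ = ∫⁻ q in polarCoord.target, ENNReal.ofReal q.1 * F (circleMap c q.1 q.2) := by
          rw [polarCoord_target, Measure.volume_eq_prod, ← Measure.prod_restrict,
            lintegral_prod _ hm.aemeasurable]
      _ = _ := by
          congr 1; ext q
          rw [Complex.polarCoord_symm_apply, circleMap, Complex.exp_mul_I]; simp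
  have h7 : ∫⁻ z, F z ≤ ENNReal.ofReal (4 * Real.pi * s ^ 2) := by
    rw [hF, lintegral_indicator hSo.measurableSet,
      lintegral_enorm_deriv_sq hSo (hd.mono inter_subset_left) (hi.mono inter_subset_left)]
    calc _ ≤ volume (ball p (2 * s)) := measure_mono (by rintro _ ⟨z, hz, rfl⟩; exact hz.2)
      _ = _ := by
        have h8 : (NNReal.pi : ℝ≥0∞) = ENNReal.ofReal Real.pi := by
          rw [← NNReal.coe_real_pi, ENNReal.ofReal_coe_nnreal]
        rw [Complex.volume_ball, h8, ← ENNReal.ofReal_pow (by positivity),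
          ← ENNReal.ofReal_mul (by positivity)]
        congr 1; ring
  have h8 := (ENNReal.ofReal_le_ofReal_iff (by positivity)).1 (h6.trans h7)
  have h9 := Real.pi_lt_d4
  rw [div_mul_eq_mul_div, div_le_iff₀ (by positivity)] at h8
  have h10 : Real.pi ^ 2 < 10 := by nlinarith
  nlinarith [mul_pos hs hs]

lemma exists_circleMap_eq {c z : ℂ} {r : ℝ} (hz : z ∈ sphere c r) :
    ∃ x ∈ Ioc (-Real.pi) Real.pi, circleMap c r x = z := by
  refine ⟨(z - c).arg, Complex.arg_mem_Ioc _, ?_⟩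
  have : (r : ℂ) = ‖z - c‖ := by rw [mem_sphere_iff_norm.1 hz]
  rw [circleMap, this, Complex.norm_mul_exp_arg_mul_I]; ring

lemma le_of_forall_circleMap_le {c : ℂ} {r : ℝ} (hr : 0 ≤ r) {g : ℂ → ℝ}
    (hg : ContinuousOn g (sphere c r)) {C : ℝ}
    (h : ∀ x ∈ Ioo (-Real.pi) Real.pi, g (circleMap c r x) ≤ C) {z : ℂ} (hz : z ∈ sphere c r) :
    g z ≤ C := by
  obtain ⟨x, hx, rfl⟩ := exists_circleMap_eq hz
  have hc : Continuous (fun x => g (circleMap c r x)) :=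
    hg.comp_continuous (continuous_circleMap c r) fun x => circleMap_mem_sphere c hr x
  refine le_on_closure h hc.continuousOn continuousOn_const ?_
  rw [closure_Ioo (by linarith [Real.pi_pos])]
  exact ⟨hx.1.le, hx.2⟩

/-- A weak form of the Koebe distortion theorem. -/
lemma norm_sub_le_three_mul {ζ p : ℂ} {R : ℝ} (hR : 0 < R) {φ : ℂ → ℂ}
    (hd : DifferentiableOn ℂ φ (ball ζ R)) (hi : InjOn φ (ball ζ R))
    (hp : ∀ z ∈ ball ζ R, φ z ≠ p) {η : ℂ} (hη : ‖η - ζ‖ ≤ Real.exp (-81) * R) :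
    ‖φ η - p‖ ≤ 3 * ‖φ ζ - p‖ := by
  set s := ‖φ ζ - p‖ with hs
  have hs0 : 0 < s := norm_pos_iff.2 (sub_ne_zero.2 (hp ζ (mem_ball_self hR)))
  have he : Real.exp 80 * (Real.exp (-81) * R) < R := by
    rw [← mul_assoc, ← Real.exp_add]
    have : Real.exp (80 + -81) < 1 :=
      (Real.exp_lt_exp.2 (by norm_num : (80 + -81 : ℝ) < 0)).trans_eq Real.exp_zero
    nlinarith
  have hsub : ∀ r ∈ Icc (Real.exp (-81) * R) (Real.exp 80 * (Real.exp (-81) * R)),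
      0 < r ∧ closedBall ζ r ⊆ ball ζ R := fun r hr =>
    ⟨lt_of_lt_of_le (by positivity) hr.1, closedBall_subset_ball (hr.2.trans_lt he)⟩
  have hang : ∀ r ∈ Icc (Real.exp (-81) * R) (Real.exp 80 * (Real.exp (-81) * R)),
      angleSet (ball ζ R) ζ r = Ioo (-Real.pi) Real.pi := by
    intro r hr
    obtain ⟨h1, h2⟩ := hsub r hr
    ext x
    exact ⟨fun h => h.1, fun h => ⟨h, h2 (circleMap_mem_closedBall ζ h1.le x)⟩⟩
  have hfr : ∀ r ∈ Icc (Real.exp (-81) * R) (Real.exp 80 * (Real.exp (-81) * R)),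
      frontier (ball ζ r) = sphere ζ r := fun r hr => frontier_ball ζ (hsub r hr).1.ne'
  have hdc : ∀ r ∈ Icc (Real.exp (-81) * R) (Real.exp 80 * (Real.exp (-81) * R)),
      ∀ {g : ℂ → ℂ}, DifferentiableOn ℂ g (ball ζ R) → DiffContOnCl ℂ g (ball ζ r) := by
    intro r hr g hg
    refine DifferentiableOn.diffContOnCl (hg.mono ?_)
    rw [closure_ball ζ (hsub r hr).1.ne']; exact (hsub r hr).2
  obtain ⟨r, hr, hle⟩ := length_area isOpen_ball hd hi (c := ζ) (p := p)
    (a := Real.exp (-81) * R) (s := 3 / 2 * s) (by positivity) (by positivity)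
    (fun r hr => by rw [hang r hr]; exact ordConnected_Ioo) (by
      intro r hr
      by_contra! hcon
      rw [hang r hr] at hcon
      obtain ⟨h1, h2⟩ := hsub r hr
      have h3 : ContinuousOn (fun z => -‖φ z - p‖) (sphere ζ r) :=
        ((hd.continuousOn.mono (sphere_subset_closedBall.trans h2)).sub
          continuousOn_const).norm.neg
      have h4 : ∀ z ∈ frontier (ball ζ r), ‖(φ z - p)⁻¹‖ ≤ (3 / 2 * s)⁻¹ := by
        intro z hz
        rw [hfr r hr] at hz
        have := le_of_forall_circleMap_le h1.le h3
          (fun x hx => neg_le_neg (hcon x hx).le) hz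
        rw [norm_inv]
        exact inv_anti₀ (by positivity) (neg_le_neg_iff.1 this)
      have h5 := Complex.norm_le_of_forall_mem_frontier_norm_le isBounded_ball
        (hdc r hr ((hd.sub_const p).inv fun z hz => sub_ne_zero.2 (hp z hz))) h4
        (subset_closure (mem_ball_self h1))
      simp only [Pi.inv_apply, norm_inv, ← hs] at h5
      have := (inv_le_inv₀ (by positivity) (by positivity)).1 h5
      linarith)
  rw [hang r hr] at hle
  obtain ⟨h1, h2⟩ := hsub r hr
  refine Complex.norm_le_of_forall_mem_frontier_norm_le isBounded_ball
    (hdc r hr (hd.sub_const p)) (U := ball ζ r) (fun z hz => ?_) ?_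
  · rw [hfr r hr] at hz
    have := le_of_forall_circleMap_le h1.le
      ((hd.continuousOn.mono (sphere_subset_closedBall.trans h2)).sub continuousOn_const).norm
      hle hz
    simpa [← mul_assoc] using this.trans_eq (by ring)
  · rw [closure_ball ζ h1.ne', mem_closedBall_iff_norm]; exact hη.trans hr.1

/-- The constant in the Harnack-type inequality `norm_sub_le_harnack`. -/
noncomputable def harnackConst (M : ℝ) : ℝ := 3 ^ (⌈M * Real.exp 81⌉₊ + 1)

lemma one_le_harnackConst (M : ℝ) : 1 ≤ harnackConst M := one_le_pow₀ (by norm_num)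

lemma norm_sub_le_harnack {U : Set ℂ} {φ : ℂ → ℂ} (hd : DifferentiableOn ℂ φ U)
    (hi : InjOn φ U) {p : ℂ} (hp : ∀ z ∈ U, φ z ≠ p) {ζ η : ℂ} {ρ M : ℝ} (hρ : 0 < ρ)
    (hU : ∀ t ∈ Icc (0 : ℝ) 1, ball (ζ + t * (η - ζ)) ρ ⊆ U) (hM : ‖η - ζ‖ ≤ M * ρ) :
    ‖φ η - p‖ ≤ harnackConst M * ‖φ ζ - p‖ := by
  set N := ⌈M * Real.exp 81⌉₊ + 1 with hN
  have hN0 : (0 : ℝ) < N := by positivity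
  have key : ∀ k : ℕ, k ≤ N → ‖φ (ζ + (k / N : ℝ) * (η - ζ)) - p‖ ≤ 3 ^ k * ‖φ ζ - p‖ := by
    intro k
    induction k with
    | zero => intro; simp
    | succ k ih =>
      intro hk
      have hb := hU (k / N) ⟨by positivity, (div_le_one hN0).2 (by exact_mod_cast (by omega))⟩
      refine (norm_sub_le_three_mul hρ (hd.mono hb) (hi.mono hb) (fun z hz => hp z (hb hz))
        (?_)).trans ?_
      · have h1 : ζ + ((k + 1 : ℕ) / N : ℝ) * (η - ζ) - (ζ + (k / N : ℝ) * (η - ζ)) =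
            ((1 / N : ℝ) : ℂ) * (η - ζ) := by push_cast; ring
        rw [h1, norm_mul, Complex.norm_real, Real.norm_of_nonneg (by positivity),
          div_mul_eq_mul_div, one_mul, div_le_iff₀ hN0]
        have h2 : M * Real.exp 81 ≤ N := (Nat.le_ceil _).trans (by rw [hN]; push_cast; linarith)
        have h3 : Real.exp (-81) * Real.exp 81 = 1 := by rw [← Real.exp_add]; simp
        calc ‖η - ζ‖ ≤ M * ρ := hM
          _ = Real.exp (-81) * ρ * (M * Real.exp 81) := by linear_combination (-M * ρ) * h3
          _ ≤ _ := by gcongr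
      · rw [pow_succ']
        linarith [ih (by omega)]
  have := key N le_rfl
  rwa [div_self hN0.ne', Complex.ofReal_one, one_mul, add_sub_cancel] at this

/-- The open upper half-plane. -/
def hp : Set ℂ := {z | 0 < z.im}

lemma isOpen_hp : IsOpen hp := isOpen_lt continuous_const Complex.continuous_im

lemma convex_hp : Convex ℝ hp := convex_halfSpace_im_gt 0

lemma ball_subset_hp {z : ℂ} {r : ℝ} (h : r ≤ z.im) : ball z r ⊆ hp := by
  intro w hw
  have h1 := (Complex.abs_im_le_norm (w - z)).trans_lt (mem_ball_iff_norm.1 hw)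
  rw [Complex.sub_im, abs_lt] at h1
  show 0 < w.im
  linarith

lemma norm_sub_le_harnack_hp {φ : ℂ → ℂ} (hd : DifferentiableOn ℂ φ hp)
    (hi : InjOn φ hp) {p : ℂ} (hp' : ∀ z ∈ hp, φ z ≠ p) {ζ η : ℂ} {ρ M : ℝ} (hρ : 0 < ρ)
    (hζ : ρ ≤ ζ.im) (hη : ρ ≤ η.im) (hM : ‖η - ζ‖ ≤ M * ρ) :
    ‖φ η - p‖ ≤ harnackConst M * ‖φ ζ - p‖ := by
  refine norm_sub_le_harnack hd hi hp' hρ (fun t ht => ball_subset_hp ?_) hM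
  simp only [Complex.add_im, Complex.im_ofReal_mul, Complex.sub_im]
  nlinarith [ht.1, ht.2]

lemma angleSet_hp (x : ℝ) {r : ℝ} (hr : 0 < r) : angleSet hp x r = Ioo 0 Real.pi := by
  have hpi := Real.pi_pos
  ext y
  have him : (circleMap x r y).im = r * Real.sin y := by
    rw [circleMap, Complex.exp_mul_I]; simp [Complex.cos_ofReal_im, Complex.sin_ofReal_re]
  simp only [angleSet, hp, mem_ofPred_eq, him, mul_pos_iff_of_pos_left hr]
  constructor
  · rintro ⟨h1, h2⟩
    refine ⟨?_, h1.2⟩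
    by_contra! h
    exact absurd h2 (not_lt.2 (Real.sin_nonpos_of_nonpos_of_neg_pi_le h h1.1.le))
  · rintro h
    exact ⟨⟨by linarith [h.1], h.2⟩, Real.sin_pos_of_pos_of_lt_pi h.1 h.2⟩

lemma exists_angle_of_mem_hp {x r : ℝ} {z : ℂ} (hz : z ∈ hp) (h : ‖z - x‖ = r) :
    ∃ y ∈ angleSet hp x r, circleMap x r y = z := by
  obtain ⟨y, hy, rfl⟩ := exists_circleMap_eq (mem_sphere_iff_norm.2 h)
  refine ⟨y, ⟨⟨hy.1, lt_of_le_of_ne hy.2 ?_⟩, hz⟩, rfl⟩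
  rintro rfl
  simp [hp, circleMap] at hz

/-- A connected set crossing a large half-annulus, and sent in a small disc, yields a
half-circle sent in a small disc. -/
lemma exists_halfCircle_of_crossing {φ : ℂ → ℂ} (hd : DifferentiableOn ℂ φ hp)
    (hi : InjOn φ hp) {p : ℂ} {x a s : ℝ} (ha : 0 < a) (hs : 0 < s) {Γ : Set ℂ}
    (hΓ : IsPreconnected Γ) (hΓU : Γ ⊆ hp) {z w : ℂ} (hz : z ∈ Γ) (hw : w ∈ Γ)
    (hza : ‖z - x‖ ≤ a) (hwa : Real.exp 80 * a ≤ ‖w - x‖) (hφ : ∀ y ∈ Γ, ‖φ y - p‖ ≤ s) :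
    ∃ r ∈ Icc a (Real.exp 80 * a), ∀ y ∈ hp, ‖y - x‖ = r → ‖φ y - p‖ ≤ 2 * s := by
  obtain ⟨r, hr, h⟩ := length_area isOpen_hp hd hi (c := x) (p := p) ha hs
    (fun r hr => by rw [angleSet_hp x (ha.trans_le hr.1)]; exact ordConnected_Ioo) (by
      intro r hr
      obtain ⟨y, hy, hyr⟩ := hΓ.intermediate_value hz hw
        (f := fun y => ‖y - x‖) (by fun_prop) ⟨hza.trans hr.1, hr.2.trans hwa⟩
      obtain ⟨t, ht, rfl⟩ := exists_angle_of_mem_hp (hΓU hy) hyr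
      exact ⟨t, ht, hφ _ hy⟩)
  refine ⟨r, hr, fun y hy hyr => ?_⟩
  obtain ⟨t, ht, rfl⟩ := exists_angle_of_mem_hp hy hyr
  exact h t ht

end LengthArea

open Set Filter Topology Metric Bornology

/-- A complex function has a continuous logarithm. -/
def HasLog {X : Type*} [TopologicalSpace X] (f : X → ℂ) : Prop :=
  ∃ l : X → ℂ, Continuous l ∧ ∀ x, Complex.exp (l x) = f x

section HasLog

variable {X : Type*} [TopologicalSpace X]

lemma HasLog.mul {f g : X → ℂ} (hf : HasLog f) (hg : HasLog g) : HasLog fun x => f x * g x := by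
  obtain ⟨l, hl, h⟩ := hf
  obtain ⟨m, hm, h'⟩ := hg
  exact ⟨fun x => l x + m x, hl.add hm, fun x => by rw [Complex.exp_add, h, h']⟩

lemma HasLog.inv {f : X → ℂ} (hf : HasLog f) : HasLog fun x => (f x)⁻¹ := by
  obtain ⟨l, hl, h⟩ := hf
  exact ⟨fun x => -l x, hl.neg, fun x => by rw [Complex.exp_neg, h]⟩

lemma HasLog.comp {Y : Type*} [TopologicalSpace Y] {f : X → ℂ} (hf : HasLog f) {g : Y → X}
    (hg : Continuous g) : HasLog fun y => f (g y) := by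
  obtain ⟨l, hl, h⟩ := hf
  exact ⟨fun y => l (g y), hl.comp hg, fun y => h (g y)⟩

lemma hasLog_const {c : ℂ} (hc : c ≠ 0) : HasLog fun _ : X => c :=
  ⟨fun _ => Complex.log c, continuous_const, fun _ => Complex.exp_log hc⟩

lemma hasLog_of_slitPlane {f : X → ℂ} (hf : Continuous f) (h : ∀ x, f x ∈ Complex.slitPlane) :
    HasLog f :=
  ⟨fun x => Complex.log (f x), hf.clog h,
    fun x => Complex.exp_log (Complex.slitPlane_ne_zero (h x))⟩

lemma mem_slitPlane_div {a b : ℂ} (h : ‖a - b‖ < ‖b‖) : a / b ∈ Complex.slitPlane := by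
  have hb : b ≠ 0 := by rintro rfl; simp at h; linarith [norm_nonneg a]
  have : a / b = 1 + (a - b) / b := by field_simp; ring
  rw [this]
  refine Complex.mem_slitPlane_of_norm_lt_one ?_
  rwa [norm_div, div_lt_one (norm_pos_iff.2 hb)]

lemma HasLog.of_norm_sub_lt {f g : X → ℂ} (hf : HasLog f) (hfc : Continuous f)
    (hg : Continuous g) (h : ∀ x, ‖g x - f x‖ < ‖f x‖) : HasLog g := by
  have h0 : ∀ x, f x ≠ 0 := fun x hx => by
    have := h x
    simp [hx] at this; linarith [norm_nonneg (g x)]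
  convert! hf.mul (hasLog_of_slitPlane (hg.div₀ hfc h0)
    fun x => mem_slitPlane_div (h x)) using 2 with x
  exact (mul_div_cancel₀ _ (h0 x)).symm

lemma HasLog.of_connected {Y : Type*} [TopologicalSpace Y] [CompactSpace X] [PreconnectedSpace Y]
    {H : Y → X → ℂ} (hH : Continuous fun q : Y × X => H q.1 q.2) (h0 : ∀ y x, H y x ≠ 0)
    {y y' : Y} (h : HasLog (H y)) : HasLog (H y') := by
  have hc : ∀ y, Continuous (H y) := fun y => hH.comp (Continuous.prodMk_right y)
  have key : ∀ y, ∀ᶠ w in 𝓝 y, ∀ x, ‖H w x - H y x‖ < ‖H y x‖ / 2 := by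
    intro y
    have ho : IsOpen {q : Y × X | ‖H q.1 q.2 - H y q.2‖ < ‖H y q.2‖ / 2} :=
      isOpen_lt (hH.sub ((hc y).comp continuous_snd)).norm
        (((hc y).comp continuous_snd).norm.div_const 2)
    obtain ⟨u, v, hu, -, hyu, hv, huv⟩ := generalized_tube_lemma isCompact_singleton (s := {y})
      isCompact_univ ho (by
        rintro ⟨w, x⟩ ⟨hw, -⟩
        obtain rfl : w = y := hw
        simpa using h0 w x)
    filter_upwards [hu.mem_nhds (hyu rfl)] with w hw x
    exact huv (show (w, x) ∈ u ×ˢ v from ⟨hw, hv (mem_univ x)⟩)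
  have hclopen : IsClopen {y | HasLog (H y)} := by
    refine ⟨isOpen_compl_iff.1 ?_, ?_⟩
    · refine isOpen_iff_mem_nhds.2 fun y hy => ?_
      filter_upwards [key y] with w hw hwl
      refine hy (HasLog.of_norm_sub_lt hwl (hc w) (hc y) fun x => ?_)
      have h1 := hw x
      have h2 := norm_sub_norm_le (H y x) (H w x)
      rw [norm_sub_rev] at h1
      linarith
    · refine isOpen_iff_mem_nhds.2 fun y hy => ?_
      filter_upwards [key y] with w hw
      exact HasLog.of_norm_sub_lt hy (hc y) (hc w) fun x => (hw x).trans_le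
        (by linarith [norm_nonneg (H y x)])
  exact (Set.ext_iff.1 (hclopen.eq_univ ⟨y, h⟩) y').2 (mem_univ y')

lemma HasLog.of_homotopy [CompactSpace X] {S : Set ℂ} (hS : IsPreconnected S) {H : ℂ → X → ℂ}
    (hH : ContinuousOn (fun q : ℂ × X => H q.1 q.2) (S ×ˢ univ)) (h0 : ∀ y ∈ S, ∀ x, H y x ≠ 0)
    {y y' : ℂ} (hy : y ∈ S) (hy' : y' ∈ S) (h : HasLog (H y)) : HasLog (H y') := by
  have := Subtype.preconnectedSpace hS
  refine HasLog.of_connected (Y := S) (H := fun y => H y) (y := ⟨y, hy⟩) (y' := ⟨y', hy'⟩) ?_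
    (fun y => h0 y y.2) h
  exact hH.comp_continuous (by fun_prop : Continuous fun q : S × X => ((q.1 : ℂ), q.2))
    fun q => ⟨q.1.2, mem_univ _⟩

end HasLog

lemma eq_zero_of_exp_eq_one {w : ℂ} (h : Complex.exp w = 1) (hw : ‖w‖ < 1) : w = 0 := by
  obtain ⟨n, rfl⟩ := Complex.exp_eq_one_iff.1 h
  by_contra hne
  have hn : n ≠ 0 := by rintro rfl; simp at hne
  have h1 : (1 : ℝ) ≤ |(n : ℝ)| := by exact_mod_cast Int.one_le_abs hn
  simp [abs_of_pos Real.pi_pos] at hw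
  nlinarith [Real.pi_gt_three]

lemma eq_of_exp_eq_one {X : Type*} [TopologicalSpace X] {S : Set X} (hS : IsPreconnected S)
    {g : X → ℂ} (hg : ContinuousOn g S) (h : ∀ x ∈ S, Complex.exp (g x) = 1) {x y : X}
    (hx : x ∈ S) (hy : y ∈ S) : g x = g y := by
  have := Subtype.preconnectedSpace hS
  have hc : Continuous (S.domRestrict g) := continuousOn_iff_continuous_domRestrict.1 hg
  have hl : IsLocallyConstant (S.domRestrict g) := by
    refine (IsLocallyConstant.iff_eventually_eq _).2 fun z => ?_
    have := hc.continuousAt (x := z)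
    filter_upwards [this (ball_mem_nhds _ one_pos)] with w hw
    refine sub_eq_zero.1 (eq_zero_of_exp_eq_one ?_ (mem_ball_iff_norm.1 hw))
    rw [Complex.exp_sub, domRestrict_apply, domRestrict_apply, h w w.2, h z z.2, div_one]
  exact hl.apply_eq_of_preconnectedSpace (⟨x, hx⟩ : S) ⟨y, hy⟩

lemma eqOn_of_exp_eq {X : Type*} [TopologicalSpace X] {S : Set X} (hS : IsPreconnected S)
    {g k : X → ℂ} (hg : ContinuousOn g S) (hk : ContinuousOn k S)
    (h : ∀ x ∈ S, Complex.exp (g x) = Complex.exp (k x)) {x : X}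
    (hx : x ∈ S) (hxe : g x = k x) : EqOn g k S := by
  intro y hy
  have := eq_of_exp_eq_one hS (hg.sub hk) (fun z hz => by
    rw [Pi.sub_apply, Complex.exp_sub, h z hz, div_self (Complex.exp_ne_zero _)]) hx hy
  simp only [Pi.sub_apply, hxe, sub_self] at this
  exact (sub_eq_zero.1 this.symm)

lemma not_hasLog_circle_coe : ¬ HasLog fun u : Circle => (u : ℂ) := by
  rintro ⟨l, hl, h⟩
  have h1 := eqOn_of_exp_eq (S := (univ : Set ℝ)) isPreconnected_univ
    (g := fun t => l (Circle.exp t)) (k := fun t => t * Complex.I + l 1)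
    (by fun_prop) (by fun_prop) (fun t _ => by
      simp only [h, Complex.exp_add, Circle.coe_exp, Circle.coe_one, mul_one])
    (mem_univ 0) (by simp)
  have h2 := h1 (mem_univ (2 * Real.pi))
  simp only [Circle.exp_two_pi] at h2
  have : (2 * Real.pi : ℝ) * Complex.I = 0 := by linear_combination -h2
  simp [Real.pi_ne_zero] at this

/-- A nowhere vanishing continuous function on the plane has a logarithm. -/
lemma hasLog_of_simplyConnected {X : Type*} [TopologicalSpace X] [SimplyConnectedSpace X]
    [LocallyPathConnectedSpace X] {f : X → ℂ} (hf : Continuous f) (h0 : ∀ x, f x ≠ 0) :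
    HasLog f := by
  have hs : IsSimplyConnected (univ : Set X) :=
    (Homeomorph.Set.univ X).toHomotopyEquiv.simplyConnectedSpace
  obtain ⟨l, hl, h⟩ := Complex.exists_continuousOn_eqOn_exp_comp hs isOpen_univ hf.continuousOn
    (by rintro ⟨x, -, hx⟩; exact h0 x hx)
  exact ⟨l, continuousOn_univ.1 hl, fun x => h (mem_univ x)⟩

lemma isPreconnected_norm_gt {R : ℝ} (hR : 0 < R) : IsPreconnected {z : ℂ | R < ‖z‖} := by
  have : {z : ℂ | R < ‖z‖} = Complex.exp '' {z | Real.log R < z.re} := by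
    ext z
    constructor
    · intro hz
      have h0 : z ≠ 0 := norm_pos_iff.1 (hR.trans hz)
      refine ⟨Complex.log z, ?_, Complex.exp_log h0⟩
      simpa [Complex.log_re] using Real.log_lt_log hR hz
    · rintro ⟨w, hw, rfl⟩
      have := Real.exp_lt_exp.2 hw
      rw [Real.exp_log hR] at this
      simpa [Complex.norm_exp] using this
  rw [this]
  exact (convex_halfSpace_re_gt _).isPreconnected.image _ Complex.continuous_exp.continuousOn

lemma frontier_connectedComponentIn_subset {E : Type*} [TopologicalSpace E]
    [LocallyConnectedSpace E] {U : Set E} (hU : IsOpen U) (z : E) :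
    frontier (connectedComponentIn U z) ⊆ Uᶜ := by
  intro q hq hqU
  have hVo : IsOpen (connectedComponentIn U z) := hU.connectedComponentIn
  rw [hVo.frontier_eq] at hq
  obtain ⟨w, hw, hwz⟩ := mem_closure_iff.1 hq.1 _ (hU.connectedComponentIn (x := q))
    (mem_connectedComponentIn hqU)
  have h1 := connectedComponentIn_eq hw
  have h2 := connectedComponentIn_eq hwz
  exact hq.2 (h2 ▸ h1 ▸ mem_connectedComponentIn hqU)

/-- The circle of radius `R` winds around each point inside it. -/
lemma not_hasLog_circle_sub {R : ℝ} {z : ℂ} (hz : ‖z‖ < R) :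
    ¬ HasLog fun u : Circle => (R * u - z : ℂ) := by
  intro h
  have hR : 0 < R := (norm_nonneg z).trans_lt hz
  have h1 := h.of_homotopy (S := closedBall 0 ‖z‖) (H := fun y (u : Circle) => (R * u - y : ℂ))
    (convex_closedBall _ _).isPreconnected (by fun_prop) (fun y hy u h0 => ?_)
    (y' := 0) (by simp) (by simp)
  · refine not_hasLog_circle_coe ?_
    convert! h1.mul (hasLog_const (c := (R : ℂ)⁻¹) (by simpa using hR.ne')) using 2 with u
    have : (R : ℂ) ≠ 0 := by exact_mod_cast hR.ne'
    field_simp; simp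
  · have h2 : ‖y‖ = R := by rw [← sub_eq_zero.1 h0, norm_mul, Circle.norm_coe]; simp [abs_of_pos hR]
    rw [mem_closedBall_zero_iff] at hy
    linarith

lemma mem_connectedComponentIn_of_log {X : Set ℂ} (hX : IsCompact X) {z z' : ℂ} (hz : z ∉ X)
    (hz' : z' ∉ X) {l : ℂ → ℂ} (hl : ContinuousOn l X)
    (hle : ∀ q ∈ X, Complex.exp (l q) = (q - z') / (q - z))
    (hb : Bornology.IsBounded (connectedComponentIn Xᶜ z)) :
    z' ∈ connectedComponentIn Xᶜ z := by
  classical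
  by_contra hV
  set V := connectedComponentIn Xᶜ z with hVdef
  have hzV : z ∈ V := mem_connectedComponentIn hz
  have hfr : frontier V ⊆ X := by
    simpa using frontier_connectedComponentIn_subset hX.isClosed.isOpen_compl z
  obtain ⟨L, hL⟩ := ContinuousMap.exists_restrict_eq hX.isClosed ⟨_, hl.domRestrict⟩
  have hLX : ∀ q ∈ X, L q = l q := fun q hq => DFunLike.congr_fun hL ⟨q, hq⟩
  set r : ℂ → ℂ := fun q => if q ∈ V then (q - z') * Complex.exp (-L q) else q - z with hr
  have hrc : Continuous r := by
    refine Continuous.if (fun q hq => ?_) (by fun_prop) (by fun_prop)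
    have hqX : q ∈ X := hfr hq
    have h1 : q - z ≠ 0 := sub_ne_zero.2 (by rintro rfl; exact hz hqX)
    have h2 : q - z' ≠ 0 := sub_ne_zero.2 (by rintro rfl; exact hz' hqX)
    rw [hLX q hqX, Complex.exp_neg, hle q hqX]; field_simp
  have hr0 : ∀ q, r q ≠ 0 := by
    intro q
    simp only [hr]
    split_ifs with h
    · exact mul_ne_zero (sub_ne_zero.2 (by rintro rfl; exact hV h)) (Complex.exp_ne_zero _)
    · exact sub_ne_zero.2 (by rintro rfl; exact h hzV)
  obtain ⟨R, hR⟩ := hb.exists_norm_le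
  have hR' : ‖z‖ < R + 1 := (hR z hzV).trans_lt (lt_add_one R)
  refine not_hasLog_circle_sub hR' ?_
  have h1 := (hasLog_of_simplyConnected hrc hr0).comp
    (g := fun u : Circle => ((R + 1 : ℝ) * u : ℂ)) (by fun_prop)
  convert! h1 using 2 with u
  have : ((R + 1 : ℝ) * u : ℂ) ∉ V := fun h => by
    have := hR _ h
    rw [norm_mul, Circle.norm_coe, mul_one, Complex.norm_real] at this
    linarith [le_abs_self (R + 1), Real.norm_eq_abs (R + 1)]
  simp only [hr, this, if_false]

/-- Borsuk's separation criterion. -/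
lemma mem_connectedComponentIn_of_log' {X : Set ℂ} (hX : IsCompact X) {z z' : ℂ} (hz : z ∉ X)
    (hz' : z' ∉ X) {l : ℂ → ℂ} (hl : ContinuousOn l X)
    (hle : ∀ q ∈ X, Complex.exp (l q) = (q - z') / (q - z)) :
    z' ∈ connectedComponentIn Xᶜ z := by
  by_cases hb : Bornology.IsBounded (connectedComponentIn Xᶜ z)
  · exact mem_connectedComponentIn_of_log hX hz hz' hl hle hb
  by_cases hb' : Bornology.IsBounded (connectedComponentIn Xᶜ z')
  · have := mem_connectedComponentIn_of_log hX hz' hz hl.neg (fun q hq => by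
      rw [Pi.neg_apply, Complex.exp_neg, hle q hq, inv_div]) hb'
    rw [← connectedComponentIn_eq this]; exact mem_connectedComponentIn hz'
  obtain ⟨R, hR0, hR⟩ := hX.isBounded.exists_pos_norm_le
  have hsub : {w : ℂ | R < ‖w‖} ⊆ Xᶜ := fun w hw hwX => absurd hw (not_lt.2 (hR w hwX))
  have key : ∀ w, ¬ Bornology.IsBounded (connectedComponentIn Xᶜ w) →
      {w : ℂ | R < ‖w‖} ⊆ connectedComponentIn Xᶜ w := by
    intro w hw
    have : ∃ v ∈ connectedComponentIn Xᶜ w, R < ‖v‖ := by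
      by_contra! h
      exact hw (isBounded_iff_forall_norm_le.2 ⟨R, h⟩)
    obtain ⟨v, hv, hvR⟩ := this
    rw [connectedComponentIn_eq hv]
    exact (isPreconnected_norm_gt hR0).subset_connectedComponentIn hvR hsub
  have hv : ((R + 1 : ℝ) : ℂ) ∈ {w : ℂ | R < ‖w‖} := by
    simp only [mem_ofPred_eq, Complex.norm_real]
    exact (lt_add_one R).trans_le (le_abs_self _)
  rw [connectedComponentIn_eq (key z hb hv), ← connectedComponentIn_eq (key z' hb' hv)]
  exact mem_connectedComponentIn hz'

/-- Borsuk's separation criterion for unbounded closed sets. -/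
lemma exists_preconnected_of_log_atInfinity {X : Set ℂ} (hX : IsClosed X) (h0 : (0 : ℂ) ∉ X)
    {z z' : ℂ} (hz0 : z ≠ 0) (hz0' : z' ≠ 0) (hz : z ∉ X) (hz' : z' ∉ X) {l : ℂ → ℂ}
    (hl : ContinuousOn l X) (hle : ∀ q ∈ X, Complex.exp (l q) = (q - z') / (q - z))
    (hlim : Tendsto l (cobounded ℂ ⊓ 𝓟 X) (𝓝 0)) :
    ∃ Γ, IsPreconnected Γ ∧ Γ ⊆ Xᶜ ∧ z ∈ Γ ∧ z' ∈ Γ := by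
  classical
  set Y : Set ℂ := insert 0 (Inv.inv ⁻¹' X) with hY
  have hYinv : ∀ {q : ℂ}, q ≠ 0 → (q⁻¹ ∈ Y ↔ q ∈ X) := fun {q} hq => by simp [hY, hq]
  obtain ⟨ρ, hρ, hρX⟩ := Metric.isOpen_iff.1 hX.isOpen_compl 0 h0
  have hYc : IsCompact Y := by
    refine Metric.isCompact_of_isClosed_isBounded ?_ ?_
    · refine isOpen_compl_iff.1 (isOpen_iff_mem_nhds.2 fun q hq => ?_)
      have hq0 : q ≠ 0 := by rintro rfl; exact hq (mem_insert _ _)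
      have h1 : q⁻¹ ∈ Xᶜ := fun h => hq (mem_insert_of_mem _ h)
      filter_upwards [(continuousAt_inv₀ hq0) (hX.isOpen_compl.mem_nhds h1),
        isOpen_ne.mem_nhds hq0] with w hw hw0 hwY
      exact hwY.elim hw0 hw
    · refine isBounded_iff_forall_norm_le.2 ⟨ρ⁻¹, fun q hq => ?_⟩
      rcases hq with rfl | hq
      · simp [hρ.le]
      · have : ρ ≤ ‖q⁻¹‖ := by
          by_contra! h
          exact hρX (mem_ball_zero_iff.2 h) hq
        rw [norm_inv] at this
        exact (le_inv_comm₀ hρ (norm_pos_iff.2 (by rintro rfl; simp at this; linarith))).1 this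
  set m : ℂ → ℂ := fun q => (if q = 0 then 0 else l q⁻¹) + Complex.log (z / z') with hm
  have hmc : ContinuousOn m Y := by
    intro q hq
    refine ContinuousWithinAt.add ?_ continuousWithinAt_const
    by_cases hq0 : q = 0
    · subst hq0
      rw [hY, continuousWithinAt_insert_self]
      rw [ContinuousWithinAt, if_pos rfl]
      have h1 : Tendsto Inv.inv (𝓝[Inv.inv ⁻¹' X] (0 : ℂ)) (cobounded ℂ ⊓ 𝓟 X) := by
        refine tendsto_inf.2 ⟨?_, tendsto_principal.2 self_mem_nhdsWithin⟩
        refine tendsto_inv₀_nhdsNE_zero.mono_left (nhdsWithin_mono _ fun w hw => ?_)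
        rintro rfl
        exact h0 (by simpa using hw)
      refine (hlim.comp h1).congr' ?_
      filter_upwards [self_mem_nhdsWithin] with w hw
      have : w ≠ 0 := by rintro rfl; exact h0 (by simpa using hw)
      simp [this]
    · have hqX : q⁻¹ ∈ X := hq.resolve_left hq0
      have h1 : ContinuousWithinAt (fun q => l q⁻¹) (Inv.inv ⁻¹' X) q :=
        (hl _ hqX).comp (continuousAt_inv₀ hq0).continuousWithinAt fun w hw => hw
      have h2 : ContinuousWithinAt (fun q => l q⁻¹) Y q := by
        refine h1.mono_of_mem_nhdsWithin ?_
        filter_upwards [self_mem_nhdsWithin, mem_nhdsWithin_of_mem_nhds (isOpen_ne.mem_nhds hq0)]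
          with w hw hw0 using hw.resolve_left hw0
      refine h2.congr_of_eventuallyEq ?_ (if_neg hq0)
      filter_upwards [mem_nhdsWithin_of_mem_nhds (isOpen_ne.mem_nhds hq0)] with w hw
      exact if_neg hw
  have key := mem_connectedComponentIn_of_log' hYc (z := z⁻¹) (z' := z'⁻¹)
    (by rwa [hYinv hz0]) (by rwa [hYinv hz0']) hmc (by
      intro q hq
      simp only [hm]
      rw [Complex.exp_add, Complex.exp_log (div_ne_zero hz0 hz0')]
      split_ifs with hq0
      · subst hq0; field_simp; simp
      · have hqX : q⁻¹ ∈ X := hq.resolve_left hq0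
        have h1 : q⁻¹ - z ≠ 0 := sub_ne_zero.2 (by rintro h; exact hz (h ▸ hqX))
        have h3 : q - z⁻¹ ≠ 0 := sub_ne_zero.2 (by rintro h; rw [h, inv_inv] at h1; simp at h1)
        rw [hle _ hqX, div_mul_div_comm, div_eq_div_iff (mul_ne_zero h1 hz0') h3]
        field_simp
        ring)
  set Γ := connectedComponentIn Yᶜ z⁻¹ with hΓ
  have hΓY : Γ ⊆ Yᶜ := connectedComponentIn_subset _ _
  have hΓ0 : ∀ q ∈ Γ, q ≠ 0 := fun q hq h => hΓY hq (h ▸ mem_insert _ _)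
  refine ⟨Inv.inv '' Γ, isPreconnected_connectedComponentIn.image _
    (continuousOn_inv₀.mono hΓ0), ?_, ⟨z⁻¹, mem_connectedComponentIn (by
      rw [mem_compl_iff, hYinv hz0]; exact hz), inv_inv z⟩, ⟨z'⁻¹, key, inv_inv z'⟩⟩
  rintro _ ⟨q, hq, rfl⟩ h
  exact hΓY hq (mem_insert_of_mem _ h)

lemma hasLog_slope_circle {f : ℂ ≃ₜ ℂ} (hf : OrientationPreserving f) (x : ℂ) :
    HasLog fun u : Circle => (f (x + u) - f x) / u := by
  obtain ⟨H, hH, h0, h1, hne⟩ := hf x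
  have hc : Continuous fun q : unitInterval × Circle => (H (q.2, q.1) - f x) / (q.2 : ℂ) :=
    (by fun_prop : Continuous fun q : unitInterval × Circle => H (q.2, q.1) - f x).div₀
      (by fun_prop : Continuous fun q : unitInterval × Circle => (q.2 : ℂ))
      fun q => Circle.coe_ne_zero _
  have h2 := HasLog.of_connected (y := (1 : unitInterval)) (y' := 0)
    (H := fun t (u : Circle) => (H (u, t) - f x) / u) hc
    (fun t u => div_ne_zero (sub_ne_zero.2 (hne (u, t))) (Circle.coe_ne_zero u)) (by
      convert! hasLog_const one_ne_zero using 2 with u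
      simp only [h1, add_sub_cancel_left]
      exact div_self (Circle.coe_ne_zero u))
  simpa only [h0] using h2

/-- A continuous logarithm of the slopes of `f`. -/
structure IsLogSlope (f : ℂ → ℂ) (M : ℂ → ℂ → ℂ) : Prop where
  continuousAt : ∀ q z, q ≠ z → ContinuousAt (fun p : ℂ × ℂ => M p.1 p.2) (q, z)
  exp_eq : ∀ q z, q ≠ z → Complex.exp (M q z) = (f z - f q) / (z - q)
  symm : ∀ q z, q ≠ z → M q z = M z q

lemma exists_isLogSlope {f : ℂ ≃ₜ ℂ} (hf : OrientationPreserving f) :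
    ∃ M, IsLogSlope f M := by
  have hne : ∀ q u : ℂ, f (q + Complex.exp u) - f q ≠ 0 := fun q u =>
    sub_ne_zero.2 (f.injective.ne (by simp))
  obtain ⟨N, hN, hNe⟩ := hasLog_of_simplyConnected
    (f := fun p : ℂ × ℂ => (f (p.1 + Complex.exp p.2) - f p.1) / Complex.exp p.2)
    (Continuous.div₀ (by fun_prop) (by fun_prop) fun p => Complex.exp_ne_zero _)
    fun p => div_ne_zero (hne _ _) (Complex.exp_ne_zero _)
  have hper1 : ∀ q, N (q, (2 * Real.pi : ℝ) * Complex.I) = N (q, 0) := by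
    intro q
    obtain ⟨l, hl, hle⟩ := hasLog_slope_circle hf q
    have h1 := eq_of_exp_eq_one (S := (univ : Set ℝ)) isPreconnected_univ
      (g := fun t => N (q, t * Complex.I) - l (Circle.exp t)) (by fun_prop) (fun t _ => by
        rw [Complex.exp_sub, hNe, hle]
        simp only [Circle.coe_exp]
        exact div_self (div_ne_zero (hne _ _) (Complex.exp_ne_zero _)))
      (mem_univ 0) (mem_univ (2 * Real.pi))
    simp only [Complex.ofReal_zero, zero_mul, Circle.exp_zero, Circle.exp_two_pi] at h1
    linear_combination -h1
  have hper2 : ∀ q u, N (q, u + 2 * Real.pi * Complex.I) = N (q, u) := by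
    intro q u
    have h1 := eq_of_exp_eq_one (S := (univ : Set ℂ)) isPreconnected_univ
      (g := fun u => N (q, u + 2 * Real.pi * Complex.I) - N (q, u)) (by fun_prop) (fun t _ => by
        rw [Complex.exp_sub, hNe, hNe]
        simp only [Complex.exp_periodic t]
        exact div_self (div_ne_zero (hne _ _) (Complex.exp_ne_zero _)))
      (mem_univ u) (mem_univ 0)
    have h2 := hper1 q
    push_cast at h2
    simp only [zero_add, h2, sub_self] at h1
    exact sub_eq_zero.1 h1
  have hper : ∀ q u v, Complex.exp u = Complex.exp v → N (q, u) = N (q, v) := by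
    intro q u v huv
    obtain ⟨n, rfl⟩ := Complex.exp_eq_exp_iff_exists_int.1 huv
    have : Function.Periodic (fun u => N (q, u)) (2 * Real.pi * Complex.I) := hper2 q
    exact this.int_mul n v
  set M : ℂ → ℂ → ℂ := fun q z => N (q, Complex.log (z - q)) with hM
  have hMN : ∀ q u, M q (q + Complex.exp u) = N (q, u) := fun q u => by
    refine hper _ _ _ ?_
    rw [add_sub_cancel_left, Complex.exp_log (Complex.exp_ne_zero u)]
  have hMc : ∀ q z, q ≠ z → ContinuousAt (fun p : ℂ × ℂ => M p.1 p.2) (q, z) := by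
    intro q z hqz
    have hsub : z - q ≠ 0 := sub_ne_zero.2 hqz.symm
    rcases Complex.mem_slitPlane_or_neg_mem_slitPlane hsub with h | h
    · have : ContinuousAt (fun p : ℂ × ℂ => (p.1, Complex.log (p.2 - p.1))) (q, z) :=
        continuousAt_fst.prodMk ((continuousAt_snd.sub continuousAt_fst).clog h)
      exact hN.continuousAt.comp this
    · have : ContinuousAt (fun p : ℂ × ℂ =>
          (p.1, Complex.log (-(p.2 - p.1)) + Real.pi * Complex.I)) (q, z) :=
        continuousAt_fst.prodMk
          (((continuousAt_snd.sub continuousAt_fst).neg.clog h).add continuousAt_const)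
      refine (hN.continuousAt.comp this).congr ?_
      have ho : IsOpen {p : ℂ × ℂ | p.1 ≠ p.2} := isOpen_ne_fun continuous_fst continuous_snd
      filter_upwards [ho.mem_nhds (show (q, z) ∈ {p : ℂ × ℂ | p.1 ≠ p.2} from hqz)] with p hp
      refine hper _ _ _ ?_
      have hp' : p.2 - p.1 ≠ 0 := sub_ne_zero.2 (Ne.symm hp)
      rw [Complex.exp_add, Complex.exp_log (neg_ne_zero.2 hp'), Complex.exp_pi_mul_I,
        Complex.exp_log hp']
      ring
  have hMe : ∀ q z, q ≠ z → Complex.exp (M q z) = (f z - f q) / (z - q) := by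
    intro q z hqz
    have hsub : z - q ≠ 0 := sub_ne_zero.2 hqz.symm
    simp only [hM, hNe, Complex.exp_log hsub, add_sub_cancel]
  refine ⟨M, hMc, hMe, fun q z hqz => ?_⟩
  have hne' : ∀ p : ℂ × ℂ, p.1 ≠ p.1 + Complex.exp p.2 := fun p => by simp
  have hne'' : ∀ q z, q ≠ z → (f z - f q) / (z - q) ≠ 0 := fun q z h =>
    div_ne_zero (sub_ne_zero.2 (f.injective.ne h.symm)) (sub_ne_zero.2 h.symm)
  have hD : ∀ q z q' z', q ≠ z → q' ≠ z' → M q z - M z q = M q' z' - M z' q' := by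
    intro q z q' z' h h'
    have h1 := eq_of_exp_eq_one (S := (univ : Set (ℂ × ℂ))) isPreconnected_univ
      (g := fun p => M p.1 (p.1 + Complex.exp p.2) - M (p.1 + Complex.exp p.2) p.1)
      (continuousOn_univ.2 (continuous_iff_continuousAt.2 fun p =>
        ((hMc _ _ (hne' p)).comp (f := fun p : ℂ × ℂ => (p.1, p.1 + Complex.exp p.2))
          (by fun_prop)).sub ((hMc _ _ (hne' p).symm).comp
          (f := fun p : ℂ × ℂ => (p.1 + Complex.exp p.2, p.1)) (by fun_prop)))) (fun p _ => by
        rw [Complex.exp_sub, hMe _ _ (hne' p), hMe _ _ (hne' p).symm,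
          ← neg_sub, ← neg_sub p.1, neg_div_neg_eq]
        exact div_self (hne'' _ _ (hne' p).symm))
      (mem_univ (q, Complex.log (z - q))) (mem_univ (q', Complex.log (z' - q')))
    simpa only [Complex.exp_log (sub_ne_zero.2 h.symm), Complex.exp_log (sub_ne_zero.2 h'.symm),
      add_sub_cancel] using h1
  linear_combination (hD q z z q hqz hqz.symm) / 2

lemma IsLogSlope.const_of_connected {f : ℂ → ℂ} {M : ℂ → ℂ → ℂ} (hM : IsLogSlope f M) {F : Set ℂ}
    (hF : IsPreconnected F) (hfix : ∀ x ∈ F, f x = x) :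
    ∃ c, Complex.exp c = 1 ∧ ∀ q ∈ F, ∀ z ∈ F, q ≠ z → M q z = c := by
  classical
  have hexp : ∀ q ∈ F, ∀ z ∈ F, q ≠ z → Complex.exp (M q z) = 1 := fun q hq z hz h => by
    rw [hM.exp_eq q z h, hfix q hq, hfix z hz, div_self (sub_ne_zero.2 h.symm)]
  have hc : ∀ q z, q ≠ z → ContinuousAt (M q) z := fun q z h =>
    (hM.continuousAt q z h).comp (f := fun w => (q, w)) (by fun_prop)
  have hloc : ∀ q ∈ F, ∀ z ∈ F, q ≠ z → ∀ᶠ w in 𝓝[F] z, M q w = M q z := by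
    intro q hq z hz h
    filter_upwards [mem_nhdsWithin_of_mem_nhds (hc q z h (ball_mem_nhds _ one_pos)),
      self_mem_nhdsWithin, mem_nhdsWithin_of_mem_nhds (isOpen_ne.mem_nhds h.symm)]
      with w hw hwF hwq
    refine sub_eq_zero.1 (eq_zero_of_exp_eq_one ?_ (mem_ball_iff_norm.1 hw))
    rw [Complex.exp_sub, hexp q hq w hwF (Ne.symm hwq), hexp q hq z hz h, div_one]
  have hstep : ∀ q ∈ F, ∀ a ∈ F, ∀ b ∈ F, q ≠ a → q ≠ b → M q a ≠ M q b → M a q = M a b := by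
    intro q hq a ha b hb hqa hqb hab
    set G : ℂ → ℂ := fun x => if x = q ∨ M q x = M q a then M a q else M a x with hG
    have hG' : ∀ x ∈ F, ∀ᶠ w in 𝓝[F] x, G w = G x := by
      intro x hx
      by_cases hxq : x = q
      · subst hxq
        filter_upwards [hloc a ha x hx hqa.symm] with w hw
        simp [hG, hw]
      by_cases hxa : M q x = M q a
      · filter_upwards [hloc q hq x hx (Ne.symm hxq)] with w hw
        simp [hG, hw, hxa]
      · have hne : a ≠ x := by rintro rfl; exact hxa rfl
        filter_upwards [hloc q hq x hx (Ne.symm hxq), hloc a ha x hx hne,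
          mem_nhdsWithin_of_mem_nhds (isOpen_ne.mem_nhds hxq)] with w hw hwa hwq
        simp [hG, hw, hxa, hwa, hxq, show w ≠ q from hwq]
    have hGc : ContinuousOn G F := fun x hx =>
      (tendsto_const_nhds (x := G x)).congr' ((hG' x hx).mono fun w hw => hw.symm)
    have h1 := eq_of_exp_eq_one hF hGc (fun x hx => by
      simp only [hG]
      split_ifs with h
      · exact hexp a ha q hq hqa.symm
      · refine hexp a ha x hx ?_
        rintro rfl; exact h (Or.inr rfl)) hq hb
    simpa [hG, hqb.symm, hab.symm] using h1
  have hq : ∀ q ∈ F, ∀ a ∈ F, ∀ b ∈ F, q ≠ a → q ≠ b → M q a = M q b := by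
    intro q hq a ha b hb hqa hqb
    by_contra hab
    have hne : a ≠ b := by rintro rfl; exact hab rfl
    have h1 := hstep q hq a ha b hb hqa hqb hab
    have h2 := hstep q hq b hb a ha hqb hqa (Ne.symm hab)
    exact hab (by rw [hM.symm q a hqa, h1, hM.symm a b hne, ← h2, hM.symm b q hqb.symm])
  by_cases hsub : F.Subsingleton
  · exact ⟨0, Complex.exp_zero, fun q hq z hz h => absurd (hsub hq hz) h⟩
  obtain ⟨q₀, hq₀, z₀, hz₀, hne⟩ := not_subsingleton_iff.1 hsub
  refine ⟨M q₀ z₀, hexp q₀ hq₀ z₀ hz₀ hne, fun q hqF z hz h => ?_⟩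
  by_cases hqq : q₀ = q
  · subst hqq; exact hq _ hq₀ z hz z₀ hz₀ h hne
  · rw [hq q hqF z hz q₀ hq₀ h (Ne.symm hqq), hM.symm q q₀ (Ne.symm hqq)]
    exact hq _ hq₀ q hqF z₀ hz₀ hqq hne

lemma IsLogSlope.sub_const {f : ℂ → ℂ} {M : ℂ → ℂ → ℂ} (hM : IsLogSlope f M) {c : ℂ}
    (hc : Complex.exp c = 1) : IsLogSlope f fun q z => M q z - c where
  continuousAt q z h := (hM.continuousAt q z h).sub_const c
  exp_eq q z h := by rw [Complex.exp_sub, hc, div_one, hM.exp_eq q z h]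
  symm q z h := by rw [hM.symm q z h]

lemma IsLogSlope.eq_log {f : ℂ → ℂ} {M : ℂ → ℂ → ℂ} (hM : IsLogSlope f M) (hf : Continuous f)
    {q a : ℂ} {W : Set ℂ} (hW : IsPreconnected W) (haW : a ∈ W) (hfq : f q = q) (hfa : f a = a)
    (hqa : M q a = 0) (hqW : ∀ w ∈ W, ‖f w - w‖ < ‖w - q‖) {z : ℂ} (hz : z ∈ W) :
    M q z = Complex.log ((f z - q) / (z - q)) := by
  have hne : ∀ w ∈ W, w ≠ q := fun w hw h => by
    have := hqW w hw
    rw [h, sub_self, norm_zero] at this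
    exact absurd this (not_lt.2 (norm_nonneg _))
  have hsl : ∀ w ∈ W, (f w - q) / (w - q) ∈ Complex.slitPlane := fun w hw =>
    mem_slitPlane_div (by simpa using hqW w hw)
  refine eqOn_of_exp_eq hW (g := M q) (k := fun w => Complex.log ((f w - q) / (w - q)))
    (fun w hw => ((hM.continuousAt q w (hne w hw).symm).comp (f := fun w => (q, w))
      (by fun_prop)).continuousWithinAt)
    (ContinuousOn.clog (ContinuousOn.div (by fun_prop) (by fun_prop) fun w hw =>
      sub_ne_zero.2 (hne w hw)) hsl) (fun w hw => ?_) haW ?_ hz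
  · rw [hM.exp_eq q w (hne w hw).symm, hfq, Complex.exp_log (Complex.slitPlane_ne_zero (hsl w hw))]
  · rw [hqa, hfa, div_self (sub_ne_zero.2 (hne a haW)), Complex.log_one]

/-- Points close to `p` and off `F` are connected to their image off `F` and close to `p`. -/
def LocalLink (f : ℂ → ℂ) (F : Set ℂ) (p : ℂ) : Prop :=
  ∀ ε > 0, ∃ δ > 0, ∀ z ∉ F, ‖z - p‖ < δ →
    ∃ Γ, IsPreconnected Γ ∧ (∀ w ∈ Γ, ‖w - p‖ < ε ∧ w ∉ F) ∧ z ∈ Γ ∧ f z ∈ Γ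

/-- Points close to infinity and off `F` are connected to their image off `F` and close to
infinity. -/
def LinkAtInfinity (f : ℂ → ℂ) (F : Set ℂ) : Prop :=
  ∀ R : ℝ, ∃ R' : ℝ, ∀ z ∉ F, R' < ‖z‖ →
    ∃ Γ, IsPreconnected Γ ∧ (∀ w ∈ Γ, R < ‖w‖ ∧ w ∉ F) ∧ z ∈ Γ ∧ f z ∈ Γ

lemma IsPreconnected.forall_lt_of_forall_ne {X : Type*} [TopologicalSpace X] {Γ : Set X}
    (hΓ : IsPreconnected Γ) {g : X → ℝ} (hg : ContinuousOn g Γ) {c : ℝ} (h : ∀ w ∈ Γ, g w ≠ c)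
    {z : X} (hz : z ∈ Γ) (hzc : g z < c) : ∀ w ∈ Γ, g w < c := by
  intro w hw
  by_contra! hc
  obtain ⟨y, hy, hyc⟩ := hΓ.intermediate_value hz hw hg ⟨hzc.le, hc⟩
  exact h y hy hyc

lemma notMem_of_fixed {f : ℂ ≃ₜ ℂ} {F : Set ℂ} (hfix : ∀ x ∈ F, f x = x) {z : ℂ} (hz : z ∉ F) :
    f z ∉ F := fun h => hz (f.injective (hfix _ h) ▸ h)

lemma IsLogSlope.localLink {f : ℂ ≃ₜ ℂ} {M : ℂ → ℂ → ℂ} (hM : IsLogSlope f M) {F : Set ℂ}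
    (hF : IsClosed F) (hfix : ∀ x ∈ F, f x = x)
    (hM0 : ∀ q ∈ F, ∀ z ∈ F, q ≠ z → M q z = 0) {p : ℂ} (hp : p ∈ F) : LocalLink f F p := by
  classical
  intro ε hε
  have hcont : ContinuousAt (fun w => f w - w) p := by fun_prop
  obtain ⟨δ₀, hδ₀, hδf⟩ := Metric.continuousAt_iff.1 hcont (ε / 4) (by positivity)
  refine ⟨min δ₀ (ε / 2), by positivity, fun z hzF hz => ?_⟩
  have hW : ∀ w ∈ ball p (min δ₀ (ε / 2)), ‖w - p‖ < ε / 2 ∧ ‖f w - w‖ < ε / 4 := by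
    intro w hw
    rw [mem_ball_iff_norm] at hw
    have := hδf (x := w) (by rw [dist_eq_norm]; exact hw.trans_le (min_le_left _ _))
    rw [dist_eq_norm, hfix p hp, sub_self, sub_zero] at this
    exact ⟨hw.trans_le (min_le_right _ _), this⟩
  have hzW : z ∈ ball p (min δ₀ (ε / 2)) := mem_ball_iff_norm.2 hz
  have hsph : ∀ q ∈ sphere p ε, ∀ w ∈ ball p (min δ₀ (ε / 2)), ‖f w - w‖ < ‖w - q‖ := by
    intro q hq w hw
    obtain ⟨h1, h2⟩ := hW w hw
    have h3 := mem_sphere_iff_norm.1 hq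
    have h4 := norm_sub_le_norm_sub_add_norm_sub q w p
    rw [norm_sub_rev q w] at h4
    linarith
  obtain ⟨hz1, hz2⟩ := hW z hzW
  have hfz : ‖f z - p‖ < ε := by
    have := norm_sub_le_norm_sub_add_norm_sub (f z) z p
    linarith
  have hfzF := notMem_of_fixed hfix hzF
  set X := (F ∩ closedBall p ε) ∪ sphere p ε with hX
  have hnX : ∀ w ∉ F, ‖w - p‖ < ε → w ∉ X := by
    rintro w hw hwe (h | h)
    · exact hw h.1
    · exact hwe.ne (mem_sphere_iff_norm.1 h)
  have hXc : IsCompact X := ((isCompact_closedBall p ε).inter_left hF).union (isCompact_sphere p ε)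
  set l : ℂ → ℂ := fun q => if q ∈ F then M q z else Complex.log ((f z - q) / (z - q)) with hl
  have hlF : ∀ q ∈ F, l q = M q z := fun q hq => if_pos hq
  have hlS : ∀ q ∈ sphere p ε, l q = Complex.log ((f z - q) / (z - q)) := by
    intro q hq
    by_cases hqF : q ∈ F
    · rw [hlF q hqF]
      have hqp : q ≠ p := by
        rintro rfl
        have := mem_sphere_iff_norm.1 hq
        simp at this; exact hε.ne this
      exact hM.eq_log f.continuous (convex_ball p _).isPreconnected
        (mem_ball_self (by positivity)) (hfix q hqF) (hfix p hp) (hM0 q hqF p hp hqp)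
        (hsph q hq) hzW
    · exact if_neg hqF
  have hne : ∀ q ∈ X, q ≠ z := by rintro q hq rfl; exact hnX q hzF (by linarith) hq
  have hsl : ∀ q ∈ sphere p ε, (f z - q) / (z - q) ∈ Complex.slitPlane := fun q hq =>
    mem_slitPlane_div (by simpa using hsph q hq z hzW)
  have hlc : ContinuousOn l X := by
    refine ContinuousOn.union_of_isClosed ?_ ?_ (hF.inter isClosed_closedBall) isClosed_sphere
    · refine ContinuousOn.congr (f := fun q => M q z) (fun q hq => ?_) fun q hq => hlF q hq.1
      exact ((hM.continuousAt q z (hne q (Or.inl hq))).comp (f := fun q => (q, z))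
        (by fun_prop)).continuousWithinAt
    · refine ContinuousOn.congr (ContinuousOn.clog (ContinuousOn.div (by fun_prop) (by fun_prop)
        fun q hq => sub_ne_zero.2 (hne q (Or.inr hq)).symm) hsl) hlS
  have key := mem_connectedComponentIn_of_log' hXc (hnX z hzF (by linarith))
    (hnX _ hfzF hfz) hlc (by
    rintro q (hq | hq)
    · rw [hlF q hq.1, hM.exp_eq q z (hne q (Or.inl hq)), hfix q hq.1, ← neg_sub q, ← neg_sub q,
        neg_div_neg_eq]
    · rw [hlS q hq, Complex.exp_log (Complex.slitPlane_ne_zero (hsl q hq)), ← neg_sub q,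
        ← neg_sub q, neg_div_neg_eq])
  have hsub := connectedComponentIn_subset Xᶜ z
  have hzΓ : z ∈ connectedComponentIn Xᶜ z := mem_connectedComponentIn (hnX z hzF (by linarith))
  have hlt : ∀ w ∈ connectedComponentIn Xᶜ z, ‖w - p‖ < ε :=
    isPreconnected_connectedComponentIn.forall_lt_of_forall_ne (by fun_prop)
      (fun w hw h => hsub hw (Or.inr (mem_sphere_iff_norm.2 h))) hzΓ (by linarith)
  exact ⟨_, isPreconnected_connectedComponentIn, fun w hw => ⟨hlt w hw, fun h =>
    hsub hw (Or.inl ⟨h, mem_closedBall_iff_norm.2 (hlt w hw).le⟩)⟩, hzΓ, key⟩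

lemma IsLogSlope.linkAtInfinity {f : ℂ ≃ₜ ℂ} {M : ℂ → ℂ → ℂ} (hM : IsLogSlope f M) {F : Set ℂ}
    (hF : IsClosed F) (hfix : ∀ x ∈ F, f x = x)
    (hM0 : ∀ q ∈ F, ∀ z ∈ F, q ≠ z → M q z = 0) (hne : F.Nonempty) : LinkAtInfinity f F := by
  intro R₀
  obtain ⟨a, ha⟩ := hne
  set R := max R₀ 1 with hR
  have hR1 : 1 ≤ R := le_max_right _ _
  obtain ⟨B, hB⟩ := (((isCompact_closedBall (0 : ℂ) R).image f.continuous).isBounded).exists_norm_le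
  have hB' : ∀ q : ℂ, ‖q‖ ≤ R → ‖f q‖ ≤ B := fun q hq =>
    hB _ ⟨q, mem_closedBall_zero_iff.2 hq, rfl⟩
  have hB0 : 0 ≤ B := (norm_nonneg _).trans (hB' 0 (by simp; linarith))
  obtain ⟨T, hT⟩ := (((isCompact_closedBall (0 : ℂ) (2 * B + R)).image
    f.symm.continuous).isBounded).exists_norm_le
  refine ⟨max R T, fun z hzF hz => ?_⟩
  have hzR : R < ‖z‖ := (le_max_left _ _).trans_lt hz
  have hfzB : 2 * B + R < ‖f z‖ := by
    by_contra! h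
    exact absurd (hT z ⟨f z, mem_closedBall_zero_iff.2 h, f.symm_apply_apply z⟩)
      (not_le.2 ((le_max_right _ _).trans_lt hz))
  have hfzF := notMem_of_fixed hfix hzF
  set X := (F ∩ {q : ℂ | R ≤ ‖q‖}) ∪ sphere 0 R with hX
  have hXcl : IsClosed X :=
    (hF.inter (isClosed_le continuous_const continuous_norm)).union isClosed_sphere
  have hnX : ∀ w ∉ F, R < ‖w‖ → w ∉ X := by
    rintro w hw hwe (h | h)
    · exact hw h.1
    · exact hwe.ne' (mem_sphere_zero_iff_norm.1 h)
  have hneX : ∀ q ∈ X, q ≠ z := by rintro q hq rfl; exact hnX q hzF hzR hq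
  have hsl : ∀ q ∈ X, (f z - q) / (f z - f q) ∈ Complex.slitPlane := by
    intro q hq
    refine mem_slitPlane_div ?_
    rw [sub_sub_sub_cancel_left]
    rcases hq with hq | hq
    · rw [hfix q hq.1, sub_self, norm_zero, norm_pos_iff, sub_ne_zero]
      rintro rfl; exact hfzF hq.1
    · have h1 := mem_sphere_zero_iff_norm.1 hq
      have h2 := hB' q h1.le
      have h3 := norm_sub_le (f q) q
      have h4 := norm_sub_norm_le (f z) (f q)
      linarith
  set l : ℂ → ℂ := fun q => M q z + Complex.log ((f z - q) / (f z - f q)) with hl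
  have hlc : ContinuousOn l X := by
    refine ContinuousOn.add (fun q hq => ((hM.continuousAt q z (hneX q hq)).comp
      (f := fun q => (q, z)) (by fun_prop)).continuousWithinAt) ?_
    refine ContinuousOn.clog (ContinuousOn.div (by fun_prop) (by fun_prop) fun q hq => ?_) hsl
    exact sub_ne_zero.2 (f.injective.ne (hneX q hq).symm)
  have hlog : ∀ᶠ q in cobounded ℂ ⊓ 𝓟 X, l q = Complex.log ((f z - q) / (z - q)) := by
    obtain ⟨C₁, hC₁⟩ := ((segment_eq_image ℝ a z ▸
      isCompact_Icc.image (by fun_prop) : IsCompact (segment ℝ a z))).isBounded.exists_norm_le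
    obtain ⟨C₂, hC₂⟩ := ((segment_eq_image ℝ a z ▸
      isCompact_Icc.image (by fun_prop) : IsCompact (segment ℝ a z)).image
        (f := fun w => f w - w) (by fun_prop)).isBounded.exists_norm_le
    have h1 : ∀ᶠ q in cobounded ℂ, max R (C₁ + C₂) < ‖q‖ :=
      tendsto_norm_cobounded_atTop.eventually_gt_atTop _
    filter_upwards [mem_inf_of_left h1, mem_inf_of_right (mem_principal_self X)] with q hq hqX
    have hqF : q ∈ F := by
      rcases hqX with h | h
      · exact h.1
      · exact absurd (mem_sphere_zero_iff_norm.1 h) ((le_max_left _ _).trans_lt hq).ne'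
    have hq2 : C₁ + C₂ < ‖q‖ := (le_max_right _ _).trans_lt hq
    have hW : ∀ w ∈ segment ℝ a z, ‖f w - w‖ < ‖w - q‖ := by
      intro w hw
      have h1 := hC₁ w hw
      have h2 := hC₂ _ ⟨w, hw, rfl⟩
      have h3 := norm_sub_norm_le q w
      rw [norm_sub_rev] at h3
      linarith
    have hqa : q ≠ a := by
      rintro rfl
      have := hW q (left_mem_segment _ _ _)
      simp [hfix q hqF] at this
    have hfz : f z - q ≠ 0 := sub_ne_zero.2 (by rintro h; exact hfzF (h ▸ hqF))
    simp only [hl]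
    rw [hM.eq_log f.continuous (convex_segment a z).isPreconnected (left_mem_segment _ _ _)
      (hfix q hqF) (hfix a ha) (hM0 q hqF a ha hqa) hW (right_mem_segment _ _ _), hfix q hqF,
      div_self hfz, Complex.log_one, add_zero]
  have hlim : Tendsto l (cobounded ℂ ⊓ 𝓟 X) (𝓝 0) := by
    refine Tendsto.congr' (hlog.mono fun q hq => hq.symm) (Tendsto.mono_left ?_ inf_le_left)
    have h1 : Tendsto (fun q => z - q) (cobounded ℂ) (cobounded ℂ) := by
      rw [← tendsto_norm_atTop_iff_cobounded]
      refine tendsto_atTop_mono (fun q => ?_)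
        (tendsto_atTop_add_const_right _ (-‖z‖) (tendsto_norm_cobounded_atTop (E := ℂ)))
      have := norm_sub_norm_le q z
      rw [norm_sub_rev] at this; linarith
    have h2 : Tendsto (fun q => 1 + (f z - z) * (z - q)⁻¹) (cobounded ℂ) (𝓝 1) := by
      simpa using (tendsto_const_nhds (x := (1 : ℂ))).add
        ((tendsto_inv₀_cobounded.comp h1).const_mul (f z - z))
    have h3 := h2.clog (by simp)
    rw [Complex.log_one] at h3
    refine h3.congr' ?_
    filter_upwards [tendsto_norm_cobounded_atTop.eventually_gt_atTop ‖z‖] with q hq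
    have : z - q ≠ 0 := sub_ne_zero.2 (by rintro rfl; exact lt_irrefl _ hq)
    congr 1; field_simp; ring
  have hz0 : z ≠ 0 := by rintro rfl; simp at hzR; linarith
  have hfz0 : f z ≠ 0 := by intro h; rw [h] at hfzB; simp at hfzB; linarith
  have h0X : (0 : ℂ) ∉ X := by
    rintro (h | h)
    · have := h.2; simp at this; linarith
    · simp at h; linarith
  obtain ⟨Γ, hΓ, hΓX, hzΓ, hfzΓ⟩ := exists_preconnected_of_log_atInfinity hXcl h0X hz0 hfz0
    (hnX z hzF hzR) (hnX _ hfzF (by linarith)) hlc (fun q hq => by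
      have h1 : f z - f q ≠ 0 := sub_ne_zero.2 (f.injective.ne (hneX q hq).symm)
      have h2 : z - q ≠ 0 := sub_ne_zero.2 (hneX q hq).symm
      simp only [hl]
      rw [Complex.exp_add, Complex.exp_log (Complex.slitPlane_ne_zero (hsl q hq)),
        hM.exp_eq q z (hneX q hq), ← neg_sub q z, ← neg_sub q (f z), ← neg_div_neg_eq (q - f z)]
      rw [neg_sub] at *
      field_simp) hlim
  have hgt := hΓ.forall_lt_of_forall_ne (g := fun w => -‖w‖) (c := -R) (by fun_prop)
      (fun w hw h => hΓX hw (Or.inr (mem_sphere_zero_iff_norm.2 (neg_injective h)))) hzΓ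
      (neg_lt_neg hzR)
  refine ⟨Γ, hΓ, fun w hw => ?_, hzΓ, hfzΓ⟩
  have hwR : R < ‖w‖ := neg_lt_neg_iff.1 (hgt w hw)
  exact ⟨(le_max_left _ _).trans_lt hwR, fun h => hΓX hw (Or.inl ⟨h, hwR.le⟩)⟩

/-- The two linking properties of an orientation-preserving homeomorphism fixing a connected
closed set. -/
theorem link_of_orientationPreserving {f : ℂ ≃ₜ ℂ} (hf : OrientationPreserving f) {F : Set ℂ}
    (hFc : IsClosed F) (hF : IsConnected F) (hfix : ∀ x ∈ F, f x = x) :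
    (∀ p ∈ F, LocalLink f F p) ∧ LinkAtInfinity f F := by
  obtain ⟨M, hM⟩ := exists_isLogSlope hf
  obtain ⟨c, hc, hMc⟩ := hM.const_of_connected hF.isPreconnected hfix
  have h0 : ∀ q ∈ F, ∀ z ∈ F, q ≠ z → M q z - c = 0 := fun q hq z hz h => by
    rw [hMc q hq z hz h, sub_self]
  exact ⟨fun p hp => (hM.sub_const hc).localLink hFc hfix h0 hp,
    (hM.sub_const hc).linkAtInfinity hFc hfix h0 hF.nonempty⟩

section Univalent

variable {U : Set ℂ} {h ψ : ℂ → ℂ}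

lemma nhds_le_map_of_injOn (hU : IsOpen U) (hd : DifferentiableOn ℂ h U) (hi : InjOn h U) {z : ℂ}
    (hz : z ∈ U) : 𝓝 (h z) ≤ map h (𝓝 z) := by
  refine (hd.analyticAt (hU.mem_nhds hz)).eventually_constant_or_nhds_le_map_nhds.resolve_left
    fun hc => ?_
  have h1 : ∀ᶠ w in 𝓝[≠] z, w = z := by
    filter_upwards [nhdsWithin_le_nhds hc, nhdsWithin_le_nhds (hU.mem_nhds hz)] with w hw hwU
    exact hi hwU hz hw
  obtain ⟨w, hw, hwz⟩ := (h1.and self_mem_nhdsWithin).exists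
  exact hwz hw

lemma isOpen_image_of_injOn (hU : IsOpen U) (hd : DifferentiableOn ℂ h U) (hi : InjOn h U) :
    IsOpen (h '' U) := by
  rw [isOpen_iff_mem_nhds]
  rintro _ ⟨z, hz, rfl⟩
  exact nhds_le_map_of_injOn hU hd hi hz
    (mem_map.2 (mem_of_superset (hU.mem_nhds hz) (subset_preimage_image h U)))

lemma tendsto_leftInvOn (hU : IsOpen U) (hd : DifferentiableOn ℂ h U) (hψ : LeftInvOn ψ h U)
    {z : ℂ} (hz : z ∈ U) : Tendsto ψ (𝓝 (h z)) (𝓝 z) := by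
  refine Tendsto.mono_left ?_ (nhds_le_map_of_injOn hU hd hψ.injOn hz)
  rw [tendsto_map'_iff]
  refine tendsto_id.congr' ?_
  filter_upwards [hU.mem_nhds hz] with w hw
  exact (hψ hw).symm

lemma differentiableOn_leftInvOn_of_deriv_ne_zero (hU : IsOpen U) (hd : DifferentiableOn ℂ h U)
    (hψ : LeftInvOn ψ h U) {z : ℂ} (hz : z ∈ U) (h0 : deriv h z ≠ 0) :
    HasDerivAt ψ (deriv h z)⁻¹ (h z) := by
  refine HasDerivAt.of_local_left_inverse (f := h) ?_ ?_ h0 ?_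
  · rw [ContinuousAt, hψ hz]; exact tendsto_leftInvOn hU hd hψ hz
  · rw [hψ hz]; exact (hd.differentiableAt (hU.mem_nhds hz)).hasDerivAt
  · filter_upwards [(isOpen_image_of_injOn hU hd hψ.injOn).mem_nhds (mem_image_of_mem h hz)]
    rintro _ ⟨w, hw, rfl⟩
    rw [hψ hw]

lemma deriv_ne_zero_of_injOn (hU : IsOpen U) (hd : DifferentiableOn ℂ h U) (hi : InjOn h U) {z : ℂ}
    (hz : z ∈ U) : deriv h z ≠ 0 := by
  have hψ : LeftInvOn (Function.invFunOn h U) h U := hi.leftInvOn_invFunOn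
  set ψ := Function.invFunOn h U
  have hcont := tendsto_leftInvOn hU hd hψ hz
  have han := (hd.analyticAt (hU.mem_nhds hz)).deriv
  rcases han.eventually_eq_zero_or_eventually_ne_zero with h0 | h0
  · exfalso
    obtain ⟨ε, hε, hb⟩ := Metric.eventually_nhds_iff_ball.1 (h0.and (hU.mem_nhds hz))
    have hzb : z ∈ ball z ε := mem_ball_self hε
    have hw : z + (ε / 2 : ℝ) ∈ ball z ε := by
      simp [abs_of_pos hε]; linarith
    have := isOpen_ball.is_const_of_deriv_eq_zero (convex_ball z ε).isPreconnected
      (hd.mono fun w hw => (hb w hw).2) (fun w hw => (hb w hw).1) hzb hw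
    have := hi hz (hb _ hw).2 this
    simp at this
    linarith
  · rw [eventually_nhdsWithin_iff] at h0
    obtain ⟨ε, hε, hb⟩ := Metric.eventually_nhds_iff_ball.1 (h0.and (hU.mem_nhds hz))
    have hbU : ball z ε ⊆ U := fun w hw => (hb w hw).2
    have hs : h '' ball z ε ∈ 𝓝 (h z) :=
      (isOpen_image_of_injOn isOpen_ball (hd.mono hbU) (hi.mono hbU)).mem_nhds
        (mem_image_of_mem h (mem_ball_self hε))
    have hψd : DifferentiableOn ℂ ψ (h '' ball z ε) := by
      rw [← Complex.differentiableOn_compl_singleton_and_continuousAt_iff hs]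
      refine ⟨?_, by rw [ContinuousAt, hψ hz]; exact hcont⟩
      rintro _ ⟨⟨w, hw, rfl⟩, hwz⟩
      exact (differentiableOn_leftInvOn_of_deriv_ne_zero hU hd hψ (hbU hw)
        ((hb w hw).1 (by rintro rfl; exact hwz rfl))).differentiableAt.differentiableWithinAt
    have h1 := ((hψd.differentiableAt hs).hasDerivAt).comp z
      (hd.differentiableAt (hU.mem_nhds hz)).hasDerivAt
    have h2 : HasDerivAt (ψ ∘ h) 1 z :=
      (hasDerivAt_id z).congr_of_eventuallyEq (by
        filter_upwards [hU.mem_nhds hz] with w hw using hψ hw)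
    intro h3
    have := h1.unique h2
    rw [h3, mul_zero] at this
    exact zero_ne_one this

lemma differentiableOn_leftInvOn (hU : IsOpen U) (hd : DifferentiableOn ℂ h U)
    (hψ : LeftInvOn ψ h U) : DifferentiableOn ℂ ψ (h '' U) := by
  rintro _ ⟨z, hz, rfl⟩
  exact (differentiableOn_leftInvOn_of_deriv_ne_zero hU hd hψ hz
    (deriv_ne_zero_of_injOn hU hd hψ.injOn hz)).differentiableAt.differentiableWithinAt

/-- Hurwitz's theorem for locally uniform limits of injective holomorphic functions. -/
lemma injOn_of_tendstoLocallyUniformlyOn {ι : Type*} {l : Filter ι} [l.NeBot] {H : ι → ℂ → ℂ}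
    (hU : IsOpen U) (hUc : IsPreconnected U) (hH : TendstoLocallyUniformlyOn H h l U)
    (hd : ∀ n, DifferentiableOn ℂ (H n) U) (hi : ∀ n, InjOn (H n) U)
    {z₀ : ℂ} (hz₀ : z₀ ∈ U) (h0 : deriv h z₀ ≠ 0) : InjOn h U := by
  intro a ha b hb hab
  by_contra hne
  have hhd : DifferentiableOn ℂ h U := hH.differentiableOn (Eventually.of_forall hd) hU
  have han := hhd.analyticOnNhd hU
  have hnc : ∀ᶠ z in 𝓝[≠] b, h z ≠ h b := by
    have h1 : AnalyticAt ℂ (fun z => h z - h b) b := (han b hb).sub analyticAt_const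
    rcases h1.eventually_eq_zero_or_eventually_ne_zero with h2 | h2
    · exfalso
      have h3 := han.eqOn_of_preconnected_of_eventuallyEq (g := fun _ => h b)
        analyticOnNhd_const hUc hb (h2.mono fun z hz => sub_eq_zero.1 hz)
      have h4 : h =ᶠ[𝓝 z₀] fun _ => h b := by
        filter_upwards [hU.mem_nhds hz₀] with z hz using h3 hz
      exact h0 (by rw [h4.deriv_eq]; simp)
    · exact h2.mono fun z hz => sub_ne_zero.1 hz
  rw [eventually_nhdsWithin_iff] at hnc
  obtain ⟨ε, hε, hball⟩ := Metric.eventually_nhds_iff_ball.1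
    ((hnc.and (hU.mem_nhds hb)).and (isOpen_ne.mem_nhds (Ne.symm hne)))
  set ρ := ε / 2
  have hρ : 0 < ρ := by positivity
  have hsub : closedBall b ρ ⊆ ball b ε := closedBall_subset_ball (half_lt_self hε)
  have hsubU : closedBall b ρ ⊆ U := fun z hz => (hball z (hsub hz)).1.2
  obtain ⟨m, hm, hmin⟩ : ∃ m > 0, ∀ z ∈ sphere b ρ, m ≤ ‖h z - h b‖ := by
    obtain ⟨z, hz, hzm⟩ := (isCompact_sphere b ρ).exists_isMinOn
      (NormedSpace.sphere_nonempty.2 hρ.le) (f := fun z => ‖h z - h b‖)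
      ((hhd.continuousOn.mono (sphere_subset_closedBall.trans hsubU)).sub continuousOn_const).norm
    refine ⟨_, norm_pos_iff.2 (sub_ne_zero.2 ((hball z (hsub (sphere_subset_closedBall hz))).1.1
      ?_)), fun w hw => hzm hw⟩
    rintro rfl
    simp at hz
    exact hρ.ne hz
  have hunif : TendstoUniformlyOn H h l (sphere b ρ) :=
    (tendstoLocallyUniformlyOn_iff_tendstoUniformlyOn_of_compact (isCompact_sphere b ρ)).1
      (hH.mono (sphere_subset_closedBall.trans hsubU))
  have hta : Tendsto (fun n => H n a) l (𝓝 (h a)) := hH.tendsto_at ha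
  have htb : Tendsto (fun n => H n b) l (𝓝 (h b)) := hH.tendsto_at hb
  have hev : ∀ᶠ n in l, m / 2 ≤ ‖H n b - H n a‖ := by
    filter_upwards [Metric.tendstoUniformlyOn_iff.1 hunif (m / 4) (by positivity),
      Metric.tendsto_nhds.1 hta (m / 4) (by positivity)] with n h1 h2
    have hneA : ∀ z ∈ closedBall b ρ, H n z - H n a ≠ 0 := fun z hz h3 =>
      (hball z (hsub hz)).2 (hi n (hsubU hz) ha (sub_eq_zero.1 h3))
    have hd1 : DiffContOnCl ℂ (fun z => (H n z - H n a)⁻¹) (ball b ρ) := by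
      refine DifferentiableOn.diffContOnCl ?_
      rw [closure_ball b hρ.ne']
      exact (((hd n).mono hsubU).sub (differentiableOn_const _)).inv hneA
    have h4 := Complex.norm_le_of_forall_mem_frontier_norm_le isBounded_ball hd1
      (C := (m / 2)⁻¹) (fun z hz => by
        rw [frontier_ball b hρ.ne'] at hz
        rw [norm_inv]
        refine inv_anti₀ (by positivity) ?_
        have h5 := h1 z hz
        have h6 := hmin z hz
        rw [dist_eq_norm] at h5 h2
        have h7 : h z - h b = (h z - H n z) + (H n z - H n a) + (H n a - h a) := by
          rw [hab]; ring
        have h8 := norm_add₃_le (a := h z - H n z) (b := H n z - H n a) (c := H n a - h a)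
        rw [← h7] at h8
        linarith) (subset_closure (mem_ball_self hρ))
    rw [norm_inv] at h4
    exact (inv_le_inv₀ (norm_pos_iff.2 (hneA b (mem_closedBall_self hρ.le))) (by positivity)).1 h4
  have := ge_of_tendsto (htb.sub hta).norm hev
  rw [hab, sub_self, norm_zero] at this
  linarith

/-- Montel's theorem along an ultrafilter. -/
lemma exists_tendstoLocallyUniformlyOn_of_norm_lt_one {ι : Type*} (l : Ultrafilter ι)
    {H : ι → ℂ → ℂ} (hU : IsOpen U) (hd : ∀ n, DifferentiableOn ℂ (H n) U)
    (hb : ∀ n, ∀ z ∈ U, ‖H n z‖ ≤ 1) : ∃ h, TendstoLocallyUniformlyOn H h l U := by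
  have hlim : ∀ z, ∃ y, z ∈ U → Tendsto (fun n => H n z) l (𝓝 y) := by
    intro z
    by_cases hz : z ∈ U
    · obtain ⟨y, -, hy⟩ := (isCompact_closedBall (0 : ℂ) 1).ultrafilter_le_nhds
        (l.map fun n => H n z) (by
          rw [le_principal_iff]
          exact Ultrafilter.mem_map.2 (univ_mem' fun n => by simpa using hb n z hz))
      exact ⟨y, fun _ => hy⟩
    · exact ⟨0, fun h => absurd h hz⟩
  choose h hh using hlim
  refine ⟨h, Metric.tendstoLocallyUniformlyOn_iff.2 fun ε hε z hz => ?_⟩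
  obtain ⟨r, hr, hrU⟩ := Metric.isOpen_iff.1 hU z hz
  have hlip : ∀ n, ∀ y ∈ ball z r, dist (H n y) (H n z) ≤ 2 / r * dist y z := fun n y hy =>
    Complex.dist_le_div_mul_dist_of_mapsTo_ball ((hd n).mono hrU) (fun w hw => by
      rw [mem_closedBall, dist_eq_norm]
      have := norm_sub_le (H n w) (H n z)
      have := hb n w (hrU hw)
      have := hb n z hz
      linarith) hy
  have hlip' : ∀ y ∈ ball z r, dist (h y) (h z) ≤ 2 / r * dist y z := fun y hy =>
    le_of_tendsto ((hh y (hrU hy)).dist (hh z hz)) (Eventually.of_forall fun n => hlip n y hy)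
  refine ⟨ball z (min r (r * ε / 8)), mem_nhdsWithin_of_mem_nhds (ball_mem_nhds z (by positivity)),
    ?_⟩
  filter_upwards [Metric.tendsto_nhds.1 (hh z hz) (ε / 4) (by positivity)] with n hn y hy
  have hyr : y ∈ ball z r := ball_subset_ball (min_le_left _ _) hy
  have h1 := hlip n y hyr
  have h2 := hlip' y hyr
  have h3 : 2 / r * dist y z ≤ ε / 4 := by
    have : dist y z < r * ε / 8 := lt_of_lt_of_le hy (min_le_right _ _)
    calc 2 / r * dist y z ≤ 2 / r * (r * ε / 8) := by gcongr
      _ = ε / 4 := by field_simp; norm_num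
  have h4 := dist_triangle4 (h y) (h z) (H n z) (H n y)
  rw [dist_comm (h z), dist_comm (H n z) (H n y)] at h4
  linarith

end Univalent

section Blaschke

/-- The Blaschke factor of the unit disc vanishing at `a`. -/
noncomputable def blaschke (a z : ℂ) : ℂ := (z - a) / (1 - starRingEnd ℂ a * z)

variable {a z : ℂ}

lemma blaschke_denom_ne_zero (ha : ‖a‖ < 1) (hz : ‖z‖ < 1) : 1 - starRingEnd ℂ a * z ≠ 0 := by
  intro h
  have h1 : ‖starRingEnd ℂ a * z‖ < 1 := by
    rw [norm_mul, RCLike.norm_conj]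
    nlinarith [norm_nonneg a, norm_nonneg z]
  rw [← sub_eq_zero.1 h, norm_one] at h1
  exact lt_irrefl _ h1

lemma norm_blaschke_lt_one (ha : ‖a‖ < 1) (hz : ‖z‖ < 1) : ‖blaschke a z‖ < 1 := by
  rw [blaschke, norm_div, div_lt_one (norm_pos_iff.2 (blaschke_denom_ne_zero ha hz))]
  have h1 : Complex.normSq a < 1 := by rw [Complex.normSq_eq_norm_sq]; nlinarith [norm_nonneg a]
  have h2 : Complex.normSq z < 1 := by rw [Complex.normSq_eq_norm_sq]; nlinarith [norm_nonneg z]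
  refine lt_of_pow_lt_pow_left₀ 2 (norm_nonneg _) ?_
  rw [← Complex.normSq_eq_norm_sq, ← Complex.normSq_eq_norm_sq]
  simp only [Complex.normSq_apply, Complex.sub_re, Complex.sub_im, Complex.mul_re, Complex.mul_im,
    Complex.conj_re, Complex.conj_im, Complex.one_re, Complex.one_im] at h1 h2 ⊢
  nlinarith

lemma hasDerivAt_blaschke (ha : ‖a‖ < 1) (hz : ‖z‖ < 1) :
    HasDerivAt (blaschke a)
      ((1 - ‖a‖ ^ 2 : ℝ) / (1 - starRingEnd ℂ a * z) ^ 2) z := by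
  have h1 : HasDerivAt (fun z => z - a) 1 z := (hasDerivAt_id z).sub_const a
  have h2 : HasDerivAt (fun z => 1 - starRingEnd ℂ a * z) (-(starRingEnd ℂ a)) z := by
    simpa using ((hasDerivAt_id z).const_mul (starRingEnd ℂ a)).const_sub 1
  refine (h1.div h2 (blaschke_denom_ne_zero ha hz)).congr_deriv ?_
  congr 1
  have h3 := Complex.conj_mul' a
  push_cast
  rw [← h3]; ring

lemma injOn_blaschke (ha : ‖a‖ < 1) : InjOn (blaschke a) (ball 0 1) := by
  intro z hz w hw h
  have hz' := blaschke_denom_ne_zero ha (mem_ball_zero_iff.1 hz)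
  have hw' := blaschke_denom_ne_zero ha (mem_ball_zero_iff.1 hw)
  rw [blaschke, blaschke, div_eq_div_iff hz' hw'] at h
  have h3 := Complex.conj_mul' a
  have h4 : (1 - (‖a‖ : ℂ) ^ 2) * (z - w) = 0 := by rw [← h3]; linear_combination h
  have h5 : (1 - (‖a‖ : ℂ) ^ 2) ≠ 0 := by
    have : (1 - ‖a‖ ^ 2 : ℝ) ≠ 0 := by nlinarith [norm_nonneg a]
    exact_mod_cast this
  exact sub_eq_zero.1 ((mul_eq_zero.1 h4).resolve_left h5)

end Blaschke

section RiemannMapping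

variable {U : Set ℂ} {h q : ℂ → ℂ}

lemma hasDerivAt_of_sq_eq (hU : IsOpen U) (hd : DifferentiableOn ℂ h U) (h0 : ∀ z ∈ U, h z ≠ 0)
    (hq : ContinuousOn q U) (hqh : ∀ z ∈ U, q z ^ 2 = h z) {z : ℂ} (hz : z ∈ U) :
    HasDerivAt q (deriv h z / (2 * q z)) z := by
  have hqz : q z ≠ 0 := fun h1 => h0 z hz (by rw [← hqh z hz, h1]; simp)
  rw [hasDerivAt_iff_tendsto_slope]
  have h1 := hasDerivAt_iff_tendsto_slope.1 (hd.differentiableAt (hU.mem_nhds hz)).hasDerivAt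
  have hqz2 : 2 * q z ≠ 0 := mul_ne_zero two_ne_zero hqz
  have hqc : Tendsto (fun w => q w + q z) (𝓝[≠] z) (𝓝 (2 * q z)) := by
    rw [two_mul]
    exact ((hq.continuousAt (hU.mem_nhds hz)).tendsto.mono_left nhdsWithin_le_nhds).add_const _
  refine (h1.div hqc hqz2).congr' ?_
  filter_upwards [nhdsWithin_le_nhds (hU.mem_nhds hz), hqc.eventually_ne hqz2, self_mem_nhdsWithin]
    with w hw hw2 (hwz : w ≠ z)
  have hwz' := sub_ne_zero.2 hwz
  simp only [Pi.div_apply]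
  rw [slope_def_field, slope_def_field, ← hqh w hw, ← hqh z hz]
  field_simp
  ring

lemma injOn_of_sq_eq (hi : InjOn h U) (hqh : ∀ z ∈ U, q z ^ 2 = h z) : InjOn q U :=
  fun z hz w hw hzw => hi hz hw (by rw [← hqh z hz, ← hqh w hw, hzw])

/-- Univalent zero-free functions on `U` have continuous square roots. -/
def HasUnivalentSqrt (U : Set ℂ) : Prop :=
  ∀ h : ℂ → ℂ, DifferentiableOn ℂ h U → InjOn h U → (∀ z ∈ U, h z ≠ 0) →
    ∃ q, ContinuousOn q U ∧ ∀ z ∈ U, q z ^ 2 = h z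

/-- Univalent maps from `U` to the unit disc sending `z₀` to `0`. -/
def discMaps (U : Set ℂ) (z₀ : ℂ) : Set (ℂ → ℂ) :=
  {h | DifferentiableOn ℂ h U ∧ InjOn h U ∧ (∀ z ∈ U, ‖h z‖ < 1) ∧ h z₀ = 0}

lemma blaschke_comp_mem_discMaps {z₀ : ℂ} (hd : DifferentiableOn ℂ h U) (hi : InjOn h U)
    (hb : ∀ z ∈ U, ‖h z‖ < 1) (hz₀ : z₀ ∈ U) :
    (fun z => blaschke (h z₀) (h z)) ∈ discMaps U z₀ := by
  refine ⟨fun z hz => ?_, ?_, fun z hz => norm_blaschke_lt_one (hb z₀ hz₀) (hb z hz), ?_⟩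
  · exact (hasDerivAt_blaschke (hb z₀ hz₀) (hb z hz)).differentiableAt.comp_differentiableWithinAt
      z (hd z hz)
  · exact (injOn_blaschke (hb z₀ hz₀)).comp hi fun z hz => mem_ball_zero_iff.2 (hb z hz)
  · simp [blaschke]

lemma discMaps_nonempty (hU : IsOpen U) {z₀ : ℂ} (hz₀ : z₀ ∈ U) (hne : U ≠ univ)
    (hs : HasUnivalentSqrt U) : (discMaps U z₀).Nonempty := by
  obtain ⟨b, hb⟩ := (ne_univ_iff_exists_notMem U).1 hne
  have hd : DifferentiableOn ℂ (fun z => z - b) U := by fun_prop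
  have h0 : ∀ z ∈ U, z - b ≠ 0 := fun z hz h => hb (sub_eq_zero.1 h ▸ hz)
  have hi : InjOn (fun z => z - b) U := fun z _ w _ h => sub_left_injective h
  obtain ⟨q, hq, hqh⟩ := hs _ hd hi h0
  have hqd : DifferentiableOn ℂ q U := fun z hz =>
    (hasDerivAt_of_sq_eq hU hd h0 hq hqh hz).differentiableAt.differentiableWithinAt
  have hqi := injOn_of_sq_eq hi hqh
  obtain ⟨r, hr, hrq⟩ := Metric.isOpen_iff.1 (isOpen_image_of_injOn hU hqd hqi) _
    (mem_image_of_mem q hz₀)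
  have hfar : ∀ z ∈ U, r ≤ ‖q z + q z₀‖ := by
    intro z hz
    by_contra! hlt
    obtain ⟨w, hw, hwz⟩ := hrq (show -q z ∈ ball (q z₀) r by
      rw [mem_ball, dist_eq_norm, ← norm_neg]; convert! hlt using 2; ring)
    have h1 : w = z := hi hw hz (by
      show w - b = z - b
      rw [← hqh w hw, ← hqh z hz, hwz]; ring)
    rw [h1] at hwz
    have h2 : q z = 0 := by linear_combination hwz / 2
    exact h0 z hz (by rw [← hqh z hz, h2]; ring)
  have hne0 : ∀ z ∈ U, q z + q z₀ ≠ 0 := fun z hz => norm_pos_iff.1 (hr.trans_le (hfar z hz))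
  refine ⟨_, blaschke_comp_mem_discMaps (h := fun z => (r / 2 : ℝ) / (q z + q z₀)) ?_ ?_ ?_ hz₀⟩
  · exact (differentiableOn_const _).div (hqd.add_const _) hne0
  · intro z hz w hw hzw
    have hr' : ((r / 2 : ℝ) : ℂ) ≠ 0 := by exact_mod_cast (half_pos hr).ne'
    simp only at hzw
    rw [div_eq_div_iff (hne0 z hz) (hne0 w hw)] at hzw
    exact hqi hz hw (add_right_cancel (mul_left_cancel₀ hr' hzw).symm)
  · intro z hz
    rw [norm_div, Complex.norm_of_nonneg (by positivity), div_lt_one (hr.trans_le (hfar z hz))]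
    linarith [hfar z hz]

lemma exists_discMaps_lt_deriv (hU : IsOpen U) {z₀ : ℂ} (hz₀ : z₀ ∈ U)
    (hs : HasUnivalentSqrt U) (hh : h ∈ discMaps U z₀) {ω : ℂ} (hω : ‖ω‖ < 1)
    (hωh : ∀ z ∈ U, h z ≠ ω) : ∃ k ∈ discMaps U z₀, ‖deriv h z₀‖ < ‖deriv k z₀‖ := by
  obtain ⟨hd, hi, hb, hz⟩ := hh
  set B := fun z => blaschke ω (h z)
  have hBd : ∀ z ∈ U, HasDerivAt B ((1 - ‖ω‖ ^ 2 : ℝ) / (1 - starRingEnd ℂ ω * h z) ^ 2 *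
      deriv h z) z := fun z hz =>
    (hasDerivAt_blaschke hω (hb z hz)).comp z (hd.differentiableAt (hU.mem_nhds hz)).hasDerivAt
  have hBD : DifferentiableOn ℂ B U := fun z hz =>
    (hBd z hz).differentiableAt.differentiableWithinAt
  have hBi : InjOn B U := (injOn_blaschke hω).comp hi fun z hz => mem_ball_zero_iff.2 (hb z hz)
  have hB0 : ∀ z ∈ U, B z ≠ 0 := fun z hz =>
    div_ne_zero (sub_ne_zero.2 (hωh z hz)) (blaschke_denom_ne_zero hω (hb z hz))
  obtain ⟨q, hq, hqh⟩ := hs B hBD hBi hB0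
  have hqd : ∀ z ∈ U, HasDerivAt q (deriv B z / (2 * q z)) z := fun z hz =>
    hasDerivAt_of_sq_eq hU hBD hB0 hq hqh hz
  have hqb : ∀ z ∈ U, ‖q z‖ < 1 := fun z hz => by
    have h1 := norm_blaschke_lt_one hω (hb z hz)
    have h2 : ‖q z‖ ^ 2 < 1 := by rw [← norm_pow, hqh z hz]; exact h1
    exact (sq_lt_one_iff₀ (norm_nonneg _)).1 h2
  refine ⟨_, blaschke_comp_mem_discMaps (h := q)
    (fun z hz => (hqd z hz).differentiableAt.differentiableWithinAt)
    (injOn_of_sq_eq hBi hqh) hqb hz₀, ?_⟩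
  have hk := (hasDerivAt_blaschke (hqb z₀ hz₀) (hqb z₀ hz₀)).comp z₀ (hqd z₀ hz₀)
  have hω0 : ω ≠ 0 := fun h1 => hωh z₀ hz₀ (by rw [hz, h1])
  have hq2 : ‖q z₀‖ ^ 2 = ‖ω‖ := by
    rw [← norm_pow, hqh z₀ hz₀]; simp [B, hz, blaschke]
  have hq1 := hqb z₀ hz₀
  have hqpos : 0 < ‖q z₀‖ := by
    rw [norm_pos_iff]; intro h1; rw [h1] at hq2; simp at hq2; exact hω0 (norm_eq_zero.1 hq2.symm)
  have hder : ‖deriv (fun z => blaschke (q z₀) (q z)) z₀‖ =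
      (1 + ‖q z₀‖ ^ 2) / (2 * ‖q z₀‖) * ‖deriv h z₀‖ := by
    have e1 : (1 - starRingEnd ℂ (q z₀) * q z₀) = ((1 - ‖q z₀‖ ^ 2 : ℝ) : ℂ) := by
      rw [Complex.conj_mul']; push_cast; ring
    have h3 : 0 < 1 - ‖q z₀‖ ^ 2 := by nlinarith
    have h4 : 0 < 1 - ‖ω‖ ^ 2 := by nlinarith [norm_nonneg ω]
    rw [show (fun z => blaschke (q z₀) (q z)) = blaschke (q z₀) ∘ q from rfl, hk.deriv,
      (hBd z₀ hz₀).deriv, hz, e1]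
    simp only [norm_mul, norm_div, norm_pow, mul_zero, sub_zero, one_pow, div_one,
      Complex.norm_real, Real.norm_of_nonneg h3.le, Real.norm_of_nonneg h4.le, Complex.norm_ofNat]
    rw [← hq2]
    field_simp
    ring
  have hpos : 0 < ‖deriv h z₀‖ := norm_pos_iff.2 (deriv_ne_zero_of_injOn hU hd hi hz₀)
  rw [hder]
  refine lt_mul_of_one_lt_left hpos ?_
  rw [one_lt_div (by positivity)]
  nlinarith

theorem exists_riemannMap (hU : IsOpen U) (hUc : IsPreconnected U) {z₀ : ℂ} (hz₀ : z₀ ∈ U)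
    (hne : U ≠ univ) (hs : HasUnivalentSqrt U) :
    ∃ φ : ℂ → ℂ, DifferentiableOn ℂ φ (ball 0 1) ∧ InjOn φ (ball 0 1) ∧
      φ '' ball 0 1 = U ∧ φ 0 = z₀ := by
  set A := (fun h => ‖deriv h z₀‖) '' discMaps U z₀
  have hA : A.Nonempty := (discMaps_nonempty hU hz₀ hne hs).image _
  obtain ⟨r, hr, hrU⟩ := Metric.isOpen_iff.1 hU z₀ hz₀
  have hAb : BddAbove A := by
    refine ⟨1 / r, ?_⟩
    rintro _ ⟨h, ⟨hd, -, hb, h0⟩, rfl⟩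
    exact Complex.norm_deriv_le_div_of_mapsTo_ball (hd.mono hrU)
      (fun w hw => by rw [h0, mem_closedBall_zero_iff]; exact (hb w (hrU hw)).le) hr
  obtain ⟨u, -, hu, huA⟩ := exists_seq_tendsto_sSup hA hAb
  choose H hHm hHu using huA
  have hMpos : 0 < sSup A := by
    obtain ⟨h, hh⟩ := discMaps_nonempty hU hz₀ hne hs
    exact (norm_pos_iff.2 (deriv_ne_zero_of_injOn hU hh.1 hh.2.1 hz₀)).trans_le
      (le_csSup hAb (mem_image_of_mem _ hh))
  obtain ⟨h, hh⟩ := exists_tendstoLocallyUniformlyOn_of_norm_lt_one (hyperfilter ℕ) hU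
    (fun n => (hHm n).1) (fun n z hz => ((hHm n).2.2.1 z hz).le)
  have hder : ‖deriv h z₀‖ = sSup A := by
    have h1 := ((hh.deriv (Eventually.of_forall fun n => (hHm n).1) hU).tendsto_at hz₀).norm
    refine tendsto_nhds_unique h1 (Tendsto.congr (fun n => (hHu n).symm) ?_)
    exact hu.mono_left Nat.hyperfilter_le_atTop
  have hd : DifferentiableOn ℂ h U :=
    hh.differentiableOn (Eventually.of_forall fun n => (hHm n).1) hU
  have hi : InjOn h U := injOn_of_tendstoLocallyUniformlyOn hU hUc hh (fun n => (hHm n).1)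
    (fun n => (hHm n).2.1) hz₀ (norm_pos_iff.1 (hder ▸ hMpos))
  have ho := isOpen_image_of_injOn hU hd hi
  have hb : ∀ z ∈ U, ‖h z‖ < 1 := by
    have h1 : h '' U ⊆ closedBall 0 1 := by
      rintro _ ⟨z, hz, rfl⟩
      rw [mem_closedBall_zero_iff]
      exact le_of_tendsto (hh.tendsto_at hz).norm
        (Eventually.of_forall fun n => ((hHm n).2.2.1 z hz).le)
    have h2 := interior_maximal h1 ho
    rw [interior_closedBall _ one_ne_zero] at h2
    exact fun z hz => mem_ball_zero_iff.1 (h2 (mem_image_of_mem h hz))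
  have hm : h ∈ discMaps U z₀ := ⟨hd, hi, hb, tendsto_nhds_unique (hh.tendsto_at hz₀)
    (Tendsto.congr (fun n => ((hHm n).2.2.2).symm) tendsto_const_nhds)⟩
  have himg : h '' U = ball 0 1 := by
    refine Subset.antisymm (by rintro _ ⟨z, hz, rfl⟩; exact mem_ball_zero_iff.2 (hb z hz)) ?_
    intro ω hω
    by_contra hω'
    obtain ⟨k, hk, hlt⟩ := exists_discMaps_lt_deriv hU hz₀ hs hm (mem_ball_zero_iff.1 hω)
      (fun z hz h1 => hω' ⟨z, hz, h1⟩)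
    rw [hder] at hlt
    exact hlt.not_ge (le_csSup hAb (mem_image_of_mem _ hk))
  have hψ := hi.leftInvOn_invFunOn
  refine ⟨Function.invFunOn h U, ?_, ?_, ?_, ?_⟩
  · rw [← himg]; exact differentiableOn_leftInvOn hU hd hψ
  · rw [← himg]; rintro _ ⟨z, hz, rfl⟩ _ ⟨w, hw, rfl⟩ hzw
    rw [hψ hz, hψ hw] at hzw
    rw [hzw]
  · rw [← himg]; exact hψ.image_image
  · rw [← hm.2.2.2]; exact hψ hz₀

end RiemannMapping

/-- `f` has a continuous logarithm on `K`. -/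
def LogOn (K : Set ℂ) (f : ℂ → ℂ) : Prop := HasLog fun z : K => f z

lemma LogOn.exists_log {K : Set ℂ} {f : ℂ → ℂ} (h : LogOn K f) :
    ∃ l, ContinuousOn l K ∧ ∀ z ∈ K, Complex.exp (l z) = f z := by
  classical
  obtain ⟨l, hl, hle⟩ := h
  refine ⟨fun z => if hz : z ∈ K then l ⟨z, hz⟩ else 0, ?_, fun z hz => ?_⟩
  · rw [continuousOn_iff_continuous_domRestrict]
    refine hl.congr fun z => ?_
    simp [Set.domRestrict]
  · simp only [hz, dif_pos]
    exact hle ⟨z, hz⟩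

lemma exists_compact_preconnected_nhds {U : Set ℂ} (hU : IsOpen U) (hUc : IsPreconnected U)
    {z₀ z : ℂ} (hz₀ : z₀ ∈ U) (hz : z ∈ U) :
    ∃ N ⊆ U, IsCompact N ∧ IsPreconnected N ∧ z₀ ∈ N ∧ N ∈ 𝓝 z := by
  have hj := (hU.isConnected_iff_isPathConnected.1 ⟨⟨z₀, hz₀⟩, hUc⟩).joinedIn z₀ hz₀ z hz
  obtain ⟨r, hr, hrU⟩ := Metric.nhds_basis_closedBall.mem_iff.1 (hU.mem_nhds hz)
  refine ⟨range hj.somePath ∪ closedBall z r, union_subset ?_ hrU, ?_, ?_, ?_, ?_⟩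
  · rintro _ ⟨t, rfl⟩; exact hj.somePath_mem t
  · exact (isCompact_range hj.somePath.continuous).union (isCompact_closedBall z r)
  · exact IsPreconnected.union z ⟨1, hj.somePath.target⟩ (mem_closedBall_self hr.le)
      (isPreconnected_range hj.somePath.continuous) (convex_closedBall z r).isPreconnected
  · exact Or.inl ⟨0, hj.somePath.source⟩
  · exact mem_of_superset (closedBall_mem_nhds z hr) subset_union_right

/-- Logarithms on compact subsets of a connected open set can be glued. -/
lemma exists_log_of_compact {U : Set ℂ} (hU : IsOpen U) (hUc : IsPreconnected U) {h : ℂ → ℂ}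
    (H : ∀ K ⊆ U, IsCompact K → LogOn K h) :
    ∃ l, ContinuousOn l U ∧ ∀ z ∈ U, Complex.exp (l z) = h z := by
  rcases U.eq_empty_or_nonempty with rfl | ⟨z₀, hz₀⟩
  · exact ⟨0, continuousOn_empty _, by simp⟩
  have hloc : ∀ K, K ⊆ U → IsCompact K → z₀ ∈ K → ∃ l, ContinuousOn l K ∧
      (∀ z ∈ K, Complex.exp (l z) = h z) ∧ l z₀ = Complex.log (h z₀) := by
    intro K hKU hK hzK
    obtain ⟨l, hl, hle⟩ := (H K hKU hK).exists_log
    have h0 : h z₀ ≠ 0 := by rw [← hle z₀ hzK]; exact Complex.exp_ne_zero _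
    refine ⟨fun z => l z - (l z₀ - Complex.log (h z₀)), hl.sub continuousOn_const,
      fun z hz => ?_, by ring⟩
    rw [Complex.exp_sub, Complex.exp_sub, hle z₀ hzK, Complex.exp_log h0, div_self h0, div_one,
      hle z hz]
  choose! L hLc hLe hL0 using hloc
  have hN : ∀ z, ∃ N, z ∈ U → N ⊆ U ∧ IsCompact N ∧ IsPreconnected N ∧ z₀ ∈ N ∧ N ∈ 𝓝 z := by
    intro z
    by_cases hz : z ∈ U
    · obtain ⟨N, h1⟩ := exists_compact_preconnected_nhds hU hUc hz₀ hz
      exact ⟨N, fun _ => h1⟩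
    · exact ⟨∅, fun h => absurd h hz⟩
  choose N hN using hN
  have hsub : ∀ K K' : Set ℂ, K ⊆ K' → K' ⊆ U → IsCompact K → IsCompact K' → IsPreconnected K →
      z₀ ∈ K → EqOn (L K) (L K') K := by
    intro K K' hKK hK'U hK hK' hKc hzK
    have hKU := hKK.trans hK'U
    refine eqOn_of_exp_eq hKc (hLc K hKU hK hzK) ((hLc K' hK'U hK' (hKK hzK)).mono hKK)
      (fun z hz => ?_) hzK ?_
    · rw [hLe K hKU hK hzK z hz, hLe K' hK'U hK' (hKK hzK) z (hKK hz)]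
    · rw [hL0 K hKU hK hzK, hL0 K' hK'U hK' (hKK hzK)]
  have hag : ∀ z ∈ U, ∀ y ∈ N z, L (N y) y = L (N z) y := by
    intro z hz y hy
    obtain ⟨a1, a2, a3, a4, -⟩ := hN z hz
    obtain ⟨b1, b2, b3, b4, b5⟩ := hN y (a1 hy)
    rw [hsub (N z) (N z ∪ N y) subset_union_left (union_subset a1 b1) a2 (a2.union b2) a3 a4 hy,
      hsub (N y) (N z ∪ N y) subset_union_right (union_subset a1 b1) b2 (a2.union b2) b3 b4
        (mem_of_mem_nhds b5)]
  refine ⟨fun z => L (N z) z, fun z hz => ContinuousAt.continuousWithinAt ?_, fun z hz => ?_⟩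
  · obtain ⟨a1, a2, a3, a4, a5⟩ := hN z hz
    refine ((hLc _ a1 a2 a4).continuousAt a5).congr ?_
    filter_upwards [a5] with y hy using (hag z hz y hy).symm
  · obtain ⟨a1, a2, a3, a4, a5⟩ := hN z hz
    exact hLe _ a1 a2 a4 z (mem_of_mem_nhds a5)

lemma hasUnivalentSqrt_of_logOn {U : Set ℂ} (hU : IsOpen U) (hUc : IsPreconnected U)
    (H : ∀ h : ℂ → ℂ, DifferentiableOn ℂ h U → InjOn h U → (∀ z ∈ U, h z ≠ 0) →
      ∀ K ⊆ U, IsCompact K → LogOn K h) : HasUnivalentSqrt U := by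
  intro h hd hi h0
  obtain ⟨l, hl, hle⟩ := exists_log_of_compact hU hUc (H h hd hi h0)
  refine ⟨fun z => Complex.exp (l z / 2), (hl.div_const 2).cexp, fun z hz => ?_⟩
  rw [← Complex.exp_nat_mul, ← hle z hz]
  congr 1; push_cast; ring

lemma hasUnivalentSqrt_image_ball (f : ℂ ≃ₜ ℂ) (c : ℂ) {r : ℝ} (hr : 0 < r) :
    HasUnivalentSqrt (f '' ball c r) := by
  refine hasUnivalentSqrt_of_logOn (f.isOpenMap _ isOpen_ball)
    ((convex_ball c r).isPreconnected.image _ f.continuous.continuousOn) ?_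
  intro h hd _ h0 K hK _
  have := (convex_ball c r).contractibleSpace ⟨c, mem_ball_self hr⟩
  have := SimplyConnectedSpace.ofContractible (ball c r)
  have := (isOpen_ball (x := c) (ε := r)).locallyPathConnectedSpace
  have h1 : HasLog fun z : ball c r => h (f z) :=
    hasLog_of_simplyConnected (hd.continuousOn.comp_continuous (by fun_prop)
      fun z => mem_image_of_mem f z.2) fun z => h0 _ (mem_image_of_mem f z.2)
  have hm : ∀ z ∈ K, f.symm z ∈ ball c r := fun z hz => by
    obtain ⟨w, hw, rfl⟩ := hK hz
    simpa using hw
  have h2 := h1.comp (g := fun z : K => ⟨f.symm z, hm z z.2⟩) (by fun_prop)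
  simpa [LogOn] using h2

/-- Every bounded relatively clopen subset of `F` is empty. -/
def NoBddClopen (F : Set ℂ) : Prop :=
  ∀ B ⊆ F, IsBounded B → IsClosed B → IsClosed (F \ B) → B = ∅

section LogSub

variable {K : Set ℂ}

lemma isOpen_logOn_sub (hK : IsCompact K) :
    IsOpen {w | w ∉ K ∧ LogOn K fun z => z - w} ∧
      IsOpen {w | w ∉ K ∧ ¬ LogOn K fun z => z - w} := by
  have key : ∀ w ∉ K, ∀ w', ‖w' - w‖ < infDist w K / 2 → K.Nonempty → w' ∉ K ∧
      ((LogOn K fun z => z - w) ↔ LogOn K fun z => z - w') := by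
    intro w hw w' hww hne
    have h1 : ∀ z ∈ K, infDist w K ≤ ‖z - w‖ := fun z hz => by
      rw [← dist_eq_norm, dist_comm]; exact infDist_le_dist_of_mem hz
    have h2 : ∀ z ∈ K, infDist w K / 2 < ‖z - w'‖ := fun z hz => by
      have := norm_add_le (z - w') (w' - w)
      rw [sub_add_sub_cancel] at this
      linarith [h1 z hz]
    have h4 : 0 ≤ infDist w K := infDist_nonneg
    refine ⟨fun h3 => ?_, fun h => ?_, fun h => ?_⟩
    · have := h2 w' h3
      simp at this; linarith
    · refine h.of_norm_sub_lt (by fun_prop) (by fun_prop) fun z => ?_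
      rw [sub_sub_sub_cancel_left, norm_sub_rev]
      have := h1 z z.2
      linarith
    · refine h.of_norm_sub_lt (by fun_prop) (by fun_prop) fun z => ?_
      rw [sub_sub_sub_cancel_left]
      linarith [h2 z z.2]
  rcases K.eq_empty_or_nonempty with rfl | hne
  · have : ∀ w : ℂ, LogOn ∅ fun z => z - w := fun w => ⟨fun _ => 0, continuous_const,
      fun z => absurd z.2 (notMem_empty _)⟩
    simp [this]
  · constructor <;> rw [Metric.isOpen_iff] <;> rintro w ⟨hw, hl⟩ <;>
      refine ⟨infDist w K / 2, half_pos ((hK.isClosed.notMem_iff_infDist_pos hne).1 hw), ?_⟩ <;>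
      intro w' hw' <;> obtain ⟨h1, h2⟩ := key w hw w' (by rwa [← dist_eq_norm]) hne
    · exact ⟨h1, h2.1 hl⟩
    · exact ⟨h1, fun h => hl (h2.2 h)⟩

lemma exists_logOn_sub_of_norm_gt (hK : IsCompact K) {h : ℂ → ℂ} (hc : ContinuousOn h K) :
    ∃ R > 0, ∀ w, R < ‖w‖ → w ∉ h '' K ∧ LogOn K fun z => h z - w := by
  obtain ⟨R, hR0, hR⟩ := (hK.image_of_continuousOn hc).isBounded.exists_pos_norm_le
  refine ⟨R, hR0, fun w hw => ⟨fun h1 => (hR w h1).not_gt hw, ?_⟩⟩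
  have hw0 : -w ≠ 0 := neg_ne_zero.2 (norm_pos_iff.1 (hR0.trans hw))
  have hc' : Continuous fun z : K => h z := hc.domRestrict
  refine (hasLog_const hw0).of_norm_sub_lt continuous_const (hc'.sub continuous_const) fun z => ?_
  rw [sub_neg_eq_add, sub_add_cancel, norm_neg]
  exact (hR _ (mem_image_of_mem h z.2)).trans_lt hw

lemma logOn_sub_of_noBddClopen (hK : IsCompact K) {F : Set ℂ} (hF : IsClosed F)
    (hFc : NoBddClopen F) (hKF : K ⊆ Fᶜ) {b : ℂ} (hb : b ∈ F) : LogOn K fun z => z - b := by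
  obtain ⟨h1, h2⟩ := isOpen_logOn_sub hK
  have hB := hFc {b ∈ F | ¬ LogOn K fun z => z - b} (fun _ h => h.1) ?_ ?_ ?_
  · by_contra h3
    exact (hB ▸ (⟨hb, h3⟩ : b ∈ {b ∈ F | ¬ LogOn K fun z => z - b}) : b ∈ (∅ : Set ℂ))
  · obtain ⟨R, -, hR⟩ := exists_logOn_sub_of_norm_gt hK (h := id) continuousOn_id
    refine isBounded_iff_forall_norm_le.2 ⟨R, fun w hw => ?_⟩
    by_contra! h3
    exact hw.2 (hR w h3).2
  · convert! hF.inter h1.isClosed_compl using 1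
    ext w
    constructor
    · rintro ⟨hw, hw'⟩; exact ⟨hw, fun h => hw' h.2⟩
    · rintro ⟨hw, hw'⟩; exact ⟨hw, fun h => hw' ⟨fun h' => hKF h' hw, h⟩⟩
  · convert! hF.inter h2.isClosed_compl using 1
    ext w
    constructor
    · rintro ⟨hw, hw'⟩; exact ⟨hw, fun h => hw' ⟨hw, h.2⟩⟩
    · rintro ⟨hw, hw'⟩; exact ⟨hw, fun h => hw' ⟨fun h' => hKF h' hw, h.2⟩⟩

end LogSub

lemma continuousOn_divided_difference {U : Set ℂ} (hU : IsOpen U) {h : ℂ → ℂ}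
    (hd : DifferentiableOn ℂ h U) :
    ContinuousOn (fun q : ℂ × ℂ => dslope h q.1 q.2) (U ×ˢ U) := by
  rintro ⟨a, b⟩ ⟨ha, hb⟩
  refine ContinuousAt.continuousWithinAt ?_
  have hca := (hd.differentiableAt (hU.mem_nhds ha)).continuousAt
  have hcb := (hd.differentiableAt (hU.mem_nhds hb)).continuousAt
  by_cases hab : a = b
  · subst hab
    simp only [ContinuousAt, dslope_same]
    have hs := (hd.analyticAt (hU.mem_nhds ha)).hasStrictDerivAt
    have hdc : ContinuousAt (deriv h) a := (hd.analyticAt (hU.mem_nhds ha)).deriv.continuousAt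
    have ho := hs.hasStrictFDerivAt.isLittleO
    rw [Metric.tendsto_nhds]
    intro ε hε
    have h1 := ho.def (half_pos hε)
    have h2 : ∀ᶠ q : ℂ × ℂ in 𝓝 (a, a), dist (deriv h q.1) (deriv h a) < ε :=
      (hdc.tendsto.comp (continuous_fst.tendsto (a, a))) (ball_mem_nhds _ hε)
    filter_upwards [h1, h2] with q hq1 hq2
    by_cases hq : q.2 = q.1
    · rw [hq, dslope_same]; exact hq2
    · rw [dslope_of_ne _ hq, slope_def_field, dist_eq_norm]
      have hq' : q.1 - q.2 ≠ 0 := sub_ne_zero.2 (Ne.symm hq)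
      have e : (h q.2 - h q.1) / (q.2 - q.1) - deriv h a =
          (h q.1 - h q.2 - (q.1 - q.2) * deriv h a) / (q.1 - q.2) := by
        have : q.2 - q.1 ≠ 0 := sub_ne_zero.2 hq
        field_simp; ring
      rw [e, norm_div, div_lt_iff₀ (norm_pos_iff.2 hq')]
      have h3 : ‖h q.1 - h q.2 - (q.1 - q.2) * deriv h a‖ ≤ ε / 2 * ‖q.1 - q.2‖ := by
        simpa using hq1
      have := norm_pos_iff.2 hq'
      nlinarith
  · have hne : ∀ᶠ q : ℂ × ℂ in 𝓝 (a, b), q.2 ≠ q.1 :=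
      (isOpen_ne_fun continuous_snd continuous_fst).mem_nhds (Ne.symm hab)
    have h1 : ContinuousAt (fun q : ℂ × ℂ => (h q.2 - h q.1) / (q.2 - q.1)) (a, b) := by
      refine ContinuousAt.div (ContinuousAt.sub ?_ ?_) (by fun_prop) (sub_ne_zero.2 (Ne.symm hab))
      · exact ContinuousAt.comp' (g := h) (f := Prod.snd) hcb continuous_snd.continuousAt
      · exact ContinuousAt.comp' (g := h) (f := Prod.fst) hca continuous_fst.continuousAt
    refine h1.congr ?_
    filter_upwards [hne] with q hq
    rw [dslope_of_ne _ hq, slope_def_field]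

/-- The filling of a compact set `K` disjoint from `F`, inside a component of the complement
of `F`. -/
lemma exists_filling {F : Set ℂ} (hF : IsClosed F) (hFne : F.Nonempty) (hFc : NoBddClopen F)
    {z₀ : ℂ} {K : Set ℂ} (hK : IsCompact K) (hKU : K ⊆ connectedComponentIn Fᶜ z₀) :
    ∃ K' ⊆ connectedComponentIn Fᶜ z₀, K ⊆ K' ∧ IsCompact K' ∧
      ∀ w ∉ K', LogOn K fun z => z - w := by
  set U := connectedComponentIn Fᶜ z₀
  have hKF : K ⊆ Fᶜ := hKU.trans (connectedComponentIn_subset _ _)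
  obtain ⟨hP, hQ⟩ := isOpen_logOn_sub hK
  set P := {w | w ∉ K ∧ LogOn K fun z => z - w}
  set Q := {w | w ∉ K ∧ ¬ LogOn K fun z => z - w}
  have hFP : F ⊆ P := fun b hb => ⟨fun h => hKF h hb, logOn_sub_of_noBddClopen hK hF hFc hKF hb⟩
  refine ⟨Pᶜ, fun w hw => ?_, fun w hw h => h.1 hw, ?_, fun w hw => (not_not.1 hw).2⟩
  · by_cases hwK : w ∈ K
    · exact hKU hwK
    have hwQ : w ∈ Q := ⟨hwK, fun h => hw ⟨hwK, h⟩⟩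
    have hwF : w ∈ Fᶜ := fun h => hw (hFP h)
    by_contra hwU
    have hU' : IsOpen (connectedComponentIn Fᶜ w) := hF.isOpen_compl.connectedComponentIn
    have hdis : Disjoint (connectedComponentIn Fᶜ w) K := by
      rw [Set.disjoint_left]
      intro y hy hyK
      have h1 := connectedComponentIn_eq hy
      have h2 := connectedComponentIn_eq (hKU hyK)
      exact hwU (show w ∈ connectedComponentIn Fᶜ z₀ by
        rw [h2, ← h1]; exact mem_connectedComponentIn hwF)
    have hsub : connectedComponentIn Fᶜ w ⊆ Q := by
      refine isPreconnected_connectedComponentIn.subset_left_of_subset_union hQ hP ?_ ?_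
        ⟨w, mem_connectedComponentIn hwF, hwQ⟩
      · rw [Set.disjoint_left]; exact fun y hy hy' => hy.2 hy'.2
      · intro y hy
        have := Set.disjoint_left.1 hdis hy
        by_cases hy' : LogOn K fun z => z - y
        · exact Or.inr ⟨this, hy'⟩
        · exact Or.inl ⟨this, hy'⟩
    have hfr : (frontier (connectedComponentIn Fᶜ w)).Nonempty := by
      rw [nonempty_iff_ne_empty, Ne, frontier_eq_empty_iff, not_or]
      refine ⟨nonempty_iff_ne_empty.1 ⟨w, mem_connectedComponentIn hwF⟩, fun h => ?_⟩
      obtain ⟨b, hb⟩ := hFne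
      exact connectedComponentIn_subset Fᶜ w (h ▸ mem_univ b) hb
    obtain ⟨p, hp⟩ := hfr
    have hpP : p ∈ P := hFP (not_not.1 (frontier_connectedComponentIn_subset hF.isOpen_compl w hp))
    obtain ⟨y, hyP, hyU⟩ := mem_closure_iff.1 (frontier_subset_closure hp) P hP hpP
    exact (hsub hyU).2 hyP.2
  · obtain ⟨R, -, hR⟩ := exists_logOn_sub_of_norm_gt hK (h := id) continuousOn_id
    refine (isCompact_closedBall 0 R).of_isClosed_subset hP.isClosed_compl fun w hw => ?_
    rw [mem_closedBall_zero_iff]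
    by_contra! h
    have := hR w h
    rw [image_id] at this
    exact hw this

lemma hasUnivalentSqrt_component {F : Set ℂ} (hF : IsClosed F) (hFne : F.Nonempty)
    (hFc : NoBddClopen F) (z₀ : ℂ) : HasUnivalentSqrt (connectedComponentIn Fᶜ z₀) := by
  set U := connectedComponentIn Fᶜ z₀ with hUdef
  have hU : IsOpen U := hF.isOpen_compl.connectedComponentIn
  have hUc : IsPreconnected U := isPreconnected_connectedComponentIn
  refine hasUnivalentSqrt_of_logOn hU hUc fun h hd hi h0 K hKU hK => ?_
  rcases K.eq_empty_or_nonempty with rfl | hKne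
  · exact ⟨fun _ => 0, continuous_const, fun z => absurd z.2 (notMem_empty _)⟩
  have := isCompact_iff_compactSpace.1 hK
  obtain ⟨K', hK'U, hKK', hK', hlog⟩ := exists_filling hF hFne hFc hK hKU
  have hhc : ContinuousOn h U := hd.continuousOn
  have hX : IsCompact (h '' K') := hK'.image_of_continuousOn (hhc.mono hK'U)
  have hho := isOpen_image_of_injOn hU hd hi
  have hcK : Continuous fun z : K => h z := (hhc.mono hKU).domRestrict
  have htrans : ∀ v ∉ h '' K', ∃ w ∈ U, w ∉ K' ∧
      ((LogOn K fun z => h z - v) ↔ LogOn K fun z => h z - h w) := by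
    intro v hv
    set C := connectedComponentIn (h '' K')ᶜ v
    have hvC : v ∈ C := mem_connectedComponentIn hv
    have hfr : (frontier C).Nonempty := by
      rw [nonempty_iff_ne_empty, Ne, frontier_eq_empty_iff, not_or]
      refine ⟨nonempty_iff_ne_empty.1 ⟨v, hvC⟩, fun h1 => ?_⟩
      obtain ⟨b, hb⟩ := (hKne.mono hKK').image h
      exact connectedComponentIn_subset (h '' K')ᶜ v (by change b ∈ C; rw [h1]; exact mem_univ b) hb
    obtain ⟨p, hp⟩ := hfr
    have hpX := not_not.1 (frontier_connectedComponentIn_subset hX.isClosed.isOpen_compl v hp)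
    obtain ⟨y, ⟨w, hw, rfl⟩, hyC⟩ := mem_closure_iff.1 (frontier_subset_closure hp) _ hho
      (image_mono hK'U hpX)
    refine ⟨w, hw, fun hwK => connectedComponentIn_subset _ v hyC (mem_image_of_mem h hwK), ?_⟩
    have hH : ContinuousOn (fun q : ℂ × K => h q.2 - q.1) (C ×ˢ univ) :=
      ((hcK.comp continuous_snd).sub continuous_fst).continuousOn
    have hH0 : ∀ y ∈ C, ∀ x : K, h x - y ≠ 0 := fun y hy x h1 =>
      connectedComponentIn_subset _ v hy (sub_eq_zero.1 h1 ▸ mem_image_of_mem h (hKK' x.2))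
    exact ⟨fun hl => hl.of_homotopy isPreconnected_connectedComponentIn hH hH0 hvC hyC,
      fun hl => hl.of_homotopy isPreconnected_connectedComponentIn hH hH0 hyC hvC⟩
  obtain ⟨R, hR0, hR⟩ := exists_logOn_sub_of_norm_gt hK (h := h) (hhc.mono hKU)
  obtain ⟨R', hR'0, hR'⟩ := exists_logOn_sub_of_norm_gt hK' (h := h) (hhc.mono hK'U)
  have hbig : max R R' < ‖((max R R' + 1 : ℝ) : ℂ)‖ := by
    rw [Complex.norm_of_nonneg (by positivity)]; linarith
  obtain ⟨w₂, hw₂, hw₂K, hiff₂⟩ := htrans _ (hR' _ ((le_max_right _ _).trans_lt hbig)).1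
  have hl₂ := hiff₂.1 (hR _ ((le_max_left _ _).trans_lt hbig)).2
  obtain ⟨w₁, hw₁, hw₁K, hiff₁⟩ := htrans 0 (by
    rintro ⟨z, hz, hz0⟩; exact h0 z (hK'U hz) hz0)
  have hne : ∀ w ∉ K', ∀ z : K, (z : ℂ) ≠ w := fun w hw z h1 => hw (h1 ▸ hKK' z.2)
  have hslope : ∀ w ∉ K', ∀ z : K, dslope h w z = (h z - h w) / (z - w) := fun w hw z => by
    rw [dslope_of_ne _ (hne w hw z), slope_def_field]
  have hΦ₂ : HasLog fun z : K => dslope h w₂ z := by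
    simp only [hslope w₂ hw₂K, div_eq_mul_inv]
    exact HasLog.mul hl₂ (HasLog.inv (hlog w₂ hw₂K))
  have hΦ₁ : HasLog fun z : K => dslope h w₁ z := by
    refine hΦ₂.of_homotopy hUc (H := fun w (z : K) => dslope h w z) ?_ ?_ hw₂ hw₁
    · exact (continuousOn_divided_difference hU hd).comp (f := fun q : ℂ × K => (q.1, (q.2 : ℂ)))
        (by fun_prop) fun q hq => ⟨hq.1, hKU q.2.2⟩
    · intro w hw z
      by_cases hzw : (z : ℂ) = w
      · rw [hzw, dslope_same]; exact deriv_ne_zero_of_injOn hU hd hi hw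
      · rw [dslope_of_ne _ hzw, slope_def_field]
        exact div_ne_zero (sub_ne_zero.2 fun h1 => hzw (hi (hKU z.2) hw h1)) (sub_ne_zero.2 hzw)
  have hl₁ : LogOn K fun z => h z - h w₁ := by
    have h1 := hΦ₁.mul (hlog w₁ hw₁K)
    have h2 : (fun z : K => h z - h w₁) = fun z : K => dslope h w₁ z * (z - w₁) :=
      funext fun z => ?_
    · rw [LogOn, h2]; exact h1
    have := sub_ne_zero.2 (hne w₁ hw₁K z)
    rw [hslope w₁ hw₁K]
    field_simp
  simpa using hiff₁.2 hl₁

section Shift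

/-- The open upper half of the circle of centre `x` and radius `r`. -/
def halfCircle (x r : ℝ) : Set ℂ := circleMap x r '' Ioo 0 Real.pi

lemma mem_halfCircle_iff {x r : ℝ} (hr : 0 < r) {z : ℂ} :
    z ∈ halfCircle x r ↔ z ∈ hp ∧ ‖z - x‖ = r := by
  constructor
  · rintro ⟨y, hy, rfl⟩
    rw [← angleSet_hp x hr] at hy
    exact ⟨hy.2, by simp [abs_of_pos hr]⟩
  · rintro ⟨h1, h2⟩
    obtain ⟨y, hy, rfl⟩ := exists_angle_of_mem_hp h1 h2
    rw [angleSet_hp x hr] at hy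
    exact mem_image_of_mem _ hy

lemma isPreconnected_halfCircle (x r : ℝ) : IsPreconnected (halfCircle x r) :=
  isPreconnected_Ioo.image _ (continuous_circleMap _ _).continuousOn

lemma sub_mem_closure_halfCircle (x r : ℝ) : ((x - r : ℝ) : ℂ) ∈ closure (halfCircle x r) := by
  have h1 : circleMap x r Real.pi = ((x - r : ℝ) : ℂ) := by simp [circleMap]; ring
  rw [← h1]
  refine image_closure_subset_closure_image (continuous_circleMap _ _) (mem_image_of_mem _ ?_)
  rw [closure_Ioo Real.pi_pos.ne]
  exact right_mem_Icc.2 Real.pi_pos.le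

/-- The common constant bounding hyperbolic displacements. -/
noncomputable def shiftConst : ℝ := harnackConst (100 * Real.exp 80 ^ 2)

lemma one_le_shiftConst : 1 ≤ shiftConst := one_le_harnackConst _

variable {φ : ℂ → ℂ} {p : ℂ}

lemma norm_sub_le_shiftConst (hd : DifferentiableOn ℂ φ hp) (hi : InjOn φ hp)
    (hφp : ∀ z ∈ hp, φ z ≠ p) {ζ η : ℂ} {ρ : ℝ} (hρ : 0 < ρ)
    (hζ : ρ ≤ ζ.im) (hη : ρ ≤ η.im) (hM : ‖η - ζ‖ ≤ 100 * Real.exp 80 ^ 2 * ρ) {s : ℝ}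
    (hs : ‖φ ζ - p‖ ≤ s) : ‖φ η - p‖ ≤ shiftConst * s :=
  (norm_sub_le_harnack_hp hd hi hφp hρ hζ hη hM).trans
    (mul_le_mul_of_nonneg_left hs (zero_le_one.trans one_le_shiftConst))

lemma norm_sub_le_re_im (z w : ℂ) : ‖z - w‖ ≤ |z.re - w.re| + |z.im - w.im| :=
  Complex.norm_le_abs_re_add_abs_im (z - w)

lemma norm_sub_le_of_crossing (hd : DifferentiableOn ℂ φ hp) (hi : InjOn φ hp)
    (hφp : ∀ z ∈ hp, φ z ≠ p) {x t s : ℝ} (ht : 0 < t) (hs : 0 < s) {Γ : Set ℂ}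
    (hΓ : IsPreconnected Γ) (hΓU : Γ ⊆ hp) {z w : ℂ} (hz : z ∈ Γ) (hw : w ∈ Γ)
    (hza : ‖z - x‖ ≤ 2 * t) (hwa : Real.exp 80 * (2 * t) ≤ ‖w - x‖)
    (hφ : ∀ y ∈ Γ, ‖φ y - p‖ ≤ s) {η : ℂ} (hη : η.re = x) (h1 : t ≤ η.im) (h2 : η.im ≤ 2 * t) :
    ‖φ η - p‖ ≤ shiftConst * (2 * s) := by
  have hκ : 1 ≤ Real.exp 80 := Real.one_le_exp (by norm_num)
  obtain ⟨r, hr, hb⟩ := exists_halfCircle_of_crossing hd hi (by positivity) hs hΓ hΓU hz hw hza hwa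
    hφ
  have hr0 : 0 < r := by linarith [hr.1]
  refine norm_sub_le_shiftConst hd hi hφp (ζ := x + r * Complex.I) ht ?_ h1 ?_ (hb _ ?_ ?_)
  · simp; linarith [hr.1]
  · refine (norm_sub_le_re_im _ _).trans ?_
    simp only [hη, Complex.add_re, Complex.ofReal_re, Complex.mul_re, Complex.I_re, mul_zero,
      Complex.ofReal_im, Complex.I_im, mul_one, Complex.add_im, Complex.mul_im, zero_add,
      add_zero, sub_self, abs_zero]
    rw [abs_le]
    constructor <;> nlinarith [hr.1, hr.2]
  · simp [hp, hr0]
  · simp [abs_of_pos hr0]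

lemma map_mem_hp_iff {G : ℂ ≃ₜ ℂ} (hG : ∀ z ∉ hp, G z = z) {z : ℂ} : G z ∈ hp ↔ z ∈ hp := by
  constructor
  · intro h
    by_contra hz
    rw [hG z hz] at h
    exact hz h
  · intro h
    by_contra hz
    have := G.injective (hG _ hz)
    rw [this] at hz
    exact hz h

/-- The key estimate: conjugating by the vertical shift keeps displacements small in the image of
a Riemann map. -/
lemma norm_shift_sub_le (hd : DifferentiableOn ℂ φ hp) (hi : InjOn φ hp)
    (hφp : ∀ z ∈ hp, φ z ≠ p) {G : ℂ ≃ₜ ℂ} (hG : ∀ z ∉ hp, G z = z) {s s₁ : ℝ} (hs₁ : 0 < s₁)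
    (hs : s₁ ≤ s) (hL : ∀ ζ ∈ hp, ‖φ ζ - p‖ ≤ s₁ → ∃ Γ, IsPreconnected Γ ∧ Γ ⊆ hp ∧ ζ ∈ Γ ∧
      G ζ ∈ Γ ∧ ∀ y ∈ Γ, ‖φ y - p‖ ≤ s) {ζ : ℂ} (hζ : ζ ∈ hp) {t : ℝ} (ht : 0 < t)
    (hω : ‖φ (ζ + t * Complex.I) - p‖ ≤ s₁ / (2 * shiftConst)) :
    ‖φ (G ζ + t * Complex.I) - p‖ ≤ 2 * shiftConst * s := by
  have hκ : 1 ≤ Real.exp 80 := Real.one_le_exp (by norm_num)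
  have hκt : t ≤ 100 * Real.exp 80 ^ 2 * t := le_mul_of_one_le_left ht.le (by nlinarith)
  have m1 : t ≤ Real.exp 80 * t := le_mul_of_one_le_left ht.le hκ
  have m2 : Real.exp 80 * t ≤ Real.exp 80 ^ 2 * t := by nlinarith
  have hA := one_le_shiftConst
  set A := shiftConst
  have hA0 : 0 < A := by linarith
  have hs0 : 0 < s := hs₁.trans_le hs
  have hδ0 : 0 < s₁ / (2 * A) := by positivity
  have hAδ : A * (s₁ / (2 * A)) = s₁ / 2 := by field_simp
  have hAs : s ≤ A * s := le_mul_of_one_le_left hs0.le hA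
  set ω := ζ + t * Complex.I
  set ζ' := G ζ
  set ω' := ζ' + t * Complex.I
  have hζ' : ζ' ∈ hp := (map_mem_hp_iff hG).2 hζ
  have hy : 0 < ζ.im := hζ
  have hy' : 0 < ζ'.im := hζ'
  have e1 : ω.re = ζ.re := by simp [ω]
  have e2 : ω.im = ζ.im + t := by simp [ω]
  have e3 : ω'.re = ζ'.re := by simp [ω']
  have e4 : ω'.im = ζ'.im + t := by simp [ω']
  have hωω' : |ζ.re - ζ'.re| + |ζ.im - ζ'.im| ≤ 100 * Real.exp 80 ^ 2 * t →
      ‖φ ω' - p‖ ≤ 2 * A * s := by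
    intro h
    have h1 := norm_sub_le_shiftConst hd hi hφp (ζ := ω) (η := ω') ht
      (by linarith) (by linarith) (by
      refine (norm_sub_le_re_im _ _).trans ?_
      rw [e1, e2, e3, e4, abs_sub_comm, add_sub_add_right_eq_sub, abs_sub_comm ζ'.im]
      exact h) hω
    rw [hAδ] at h1
    linarith
  have hζω' : ∀ η, t ≤ η.im → η.re = ζ'.re → |η.im - ω'.im| ≤ t → ‖φ η - p‖ ≤ s →
      ‖φ ω' - p‖ ≤ 2 * A * s := by
    intro η h1 h2 h3 h4
    have h5 := norm_sub_le_shiftConst hd hi hφp (ζ := η) (η := ω') ht h1 (by linarith) (by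
      refine (norm_sub_le_re_im _ _).trans ?_
      rw [e3, h2, sub_self, abs_zero, zero_add, abs_sub_comm]
      exact h3.trans hκt) h4
    linarith
  rcases le_or_gt t ζ.im with hyt | hyt
  · have hζs : ‖φ ζ - p‖ ≤ s₁ := by
      have h1 := norm_sub_le_shiftConst hd hi hφp (ζ := ω) (η := ζ) ht (by linarith) hyt (by
        refine (norm_sub_le_re_im _ _).trans ?_
        rw [e1, e2, sub_self, abs_zero, zero_add, sub_add_cancel_left, abs_neg, abs_of_pos ht]
        exact hκt) hω
      linarith
    obtain ⟨Γ, hΓ, hΓU, hζΓ, hζ'Γ, hΓs⟩ := hL ζ hζ hζs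
    rcases le_or_gt t ζ'.im with hyt' | hyt'
    · exact hζω' ζ' hyt' rfl (by rw [e4, sub_add_cancel_left, abs_neg, abs_of_pos ht])
        (hΓs _ hζ'Γ)
    · rcases le_or_gt (Real.exp 80 * (2 * t)) ‖ζ - (ζ'.re : ℂ)‖ with hc | hc
      · have h1 := norm_sub_le_of_crossing hd hi hφp (x := ζ'.re) ht hs0 hΓ hΓU hζ'Γ hζΓ (by
          refine (norm_sub_le_re_im _ _).trans ?_
          change |ζ'.re - _| + |ζ'.im - _| ≤ _
          rw [Complex.ofReal_re, Complex.ofReal_im, sub_self, abs_zero, zero_add, sub_zero,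
            abs_of_pos hy']
          linarith) hc hΓs e3 (by linarith) (by linarith)
        linarith
      · refine hωω' ?_
        have h1 := Complex.abs_re_le_norm (ζ - (ζ'.re : ℂ))
        have h2 := Complex.abs_im_le_norm (ζ - (ζ'.re : ℂ))
        simp only [Complex.sub_re, Complex.ofReal_re, Complex.sub_im, Complex.ofReal_im, sub_zero]
          at h1 h2
        rw [abs_of_pos hy] at h2
        have h3 : |ζ.im - ζ'.im| ≤ Real.exp 80 * (2 * t) := by rw [abs_le]; constructor <;> linarith
        linarith
  · set x := ζ.re
    have hvert : ∀ u, 2 * t ≤ u → u ≤ 8 * Real.exp 80 ^ 2 * t →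
        ‖φ (x + u * Complex.I) - p‖ ≤ s₁ / 2 := by
      intro u hu1 hu2
      rw [← hAδ]
      refine norm_sub_le_shiftConst hd hi hφp (ζ := ω) ht (by linarith) (by simp; linarith) ?_ hω
      refine (norm_sub_le_re_im _ _).trans ?_
      simp only [e1, e2, Complex.add_re, Complex.ofReal_re, Complex.mul_re, Complex.I_re, mul_zero,
        Complex.ofReal_im, Complex.I_im, mul_one, Complex.add_im, Complex.mul_im,
        zero_add, add_zero, x, sub_self, abs_zero]
      rw [abs_le]
      constructor <;> linarith
    set Γ₀ := (fun u : ℝ => (x + u * Complex.I : ℂ)) '' Icc (2 * t) (8 * Real.exp 80 ^ 2 * t)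
    have hΓ₀ : IsPreconnected Γ₀ := isPreconnected_Icc.image _ (by fun_prop)
    have hΓ₀U : Γ₀ ⊆ hp := by
      rintro _ ⟨u, hu, rfl⟩
      simp [hp]; linarith [hu.1]
    have hΓ₀s : ∀ y ∈ Γ₀, ‖φ y - p‖ ≤ s₁ / 2 := by
      rintro _ ⟨u, hu, rfl⟩; exact hvert u hu.1 hu.2
    have hmem : ∀ u ∈ Icc (2 * t) (8 * Real.exp 80 ^ 2 * t),
        (x + u * Complex.I : ℂ) ∈ Γ₀ := fun u hu =>
      mem_image_of_mem _ hu
    have hnorm : ∀ u : ℝ, 0 < u → ‖(x + u * Complex.I : ℂ) - x‖ = u := fun u hu => by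
      simp [abs_of_pos hu]
    have hhalf : ∀ a, 4 * t ≤ a → Real.exp 80 * a ≤ 8 * Real.exp 80 ^ 2 * t →
        ∃ r ∈ Icc a (Real.exp 80 * a),
        ∀ y ∈ hp, ‖y - x‖ = r → ‖φ y - p‖ ≤ s₁ := by
      intro a ha1 ha2
      have ha0 : 0 < a := by linarith
      have := exists_halfCircle_of_crossing hd hi (x := x) ha0 (half_pos hs₁) hΓ₀ hΓ₀U
        (hmem (4 * t) ⟨by linarith, by linarith⟩)
        (hmem (Real.exp 80 * a) ⟨by linarith [le_mul_of_one_le_left ha0.le hκ], ha2⟩)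
        ((hnorm (4 * t) (by linarith)).trans_le ha1)
        (hnorm (Real.exp 80 * a) (by positivity)).ge hΓ₀s
      simpa [mul_div_cancel₀] using this
    obtain ⟨r, hr, hrs⟩ := hhalf (4 * t) le_rfl (by linarith)
    obtain ⟨r₂, hr₂, hrs₂⟩ := hhalf (8 * Real.exp 80 * t) (by linarith) (by linarith)
    have hr0 : 0 < r := by linarith [hr.1]
    have hrr₂ : r < r₂ := by linarith [hr.2, hr₂.1]
    have hC : ∀ η ∈ halfCircle x r, ‖φ (G η) - p‖ ≤ s := fun η hη => by
      obtain ⟨h1, h2⟩ := (mem_halfCircle_iff hr0).1 hη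
      obtain ⟨Γ, -, -, -, h3, h4⟩ := hL η h1 (hrs η h1 h2)
      exact h4 _ h3
    have hζx : ‖ζ - x‖ < r := by
      refine (norm_sub_le_re_im _ _).trans_lt ?_
      simp [x, abs_of_pos hy]; linarith [hr.1]
    set S := (fun u : ℝ => ζ' + u * Complex.I) '' Icc 0 t
    have hS : IsPreconnected S := isPreconnected_Icc.image _ (by fun_prop)
    have hζ'S : ζ' ∈ S := ⟨0, left_mem_Icc.2 ht.le, by simp⟩
    have hω'S : ω' ∈ S := ⟨t, right_mem_Icc.2 ht.le, rfl⟩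
    have hSU : S ⊆ hp := by
      rintro _ ⟨u, hu, rfl⟩
      simp [hp]; linarith [hu.1]
    by_cases hcase : ∃ c ∈ S, ‖G.symm c - x‖ = r
    · obtain ⟨c, hcS, hc⟩ := hcase
      have hcC : G.symm c ∈ halfCircle x r :=
        (mem_halfCircle_iff hr0).2 ⟨(map_mem_hp_iff hG).1 (by simpa using hSU hcS), hc⟩
      have hcs : ‖φ c - p‖ ≤ s := by simpa using hC _ hcC
      obtain ⟨τ, hτ, rfl⟩ := hcS
      rcases le_or_gt t ζ'.im with hyt' | hyt'
      · refine hζω' _ ?_ (by simp) ?_ hcs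
        · simp; linarith [hτ.1]
        · rw [e4, abs_le]; simp; constructor <;> linarith [hτ.1, hτ.2]
      · rcases le_or_gt |x - r - ζ'.re| (Real.exp 80 * (2 * t)) with ha | ha
        · refine hωω' ?_
          rw [abs_le] at ha
          have h1 : |x - ζ'.re| ≤ 6 * Real.exp 80 * t := by
            rw [abs_le]; constructor <;> linarith [hr.1, hr.2]
          have h2 : |ζ.im - ζ'.im| ≤ t := by rw [abs_le]; constructor <;> linarith
          linarith
        · have h1 : ((x - r : ℝ) : ℂ) ∈ {η | Real.exp 80 * (2 * t) < ‖G η - (ζ'.re : ℂ)‖} := by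
            rw [mem_ofPred_eq, hG _ (by simp [hp]), ← Complex.ofReal_sub, Complex.norm_real]
            exact ha
          obtain ⟨η, hη1, hη2⟩ := mem_closure_iff.1 (sub_mem_closure_halfCircle x r) _
            (isOpen_lt continuous_const (by fun_prop)) h1
          have h2 := norm_sub_le_of_crossing hd hi hφp (x := ζ'.re) (Γ := G '' halfCircle x r)
            (z := ζ' + τ * Complex.I) (w := G η) (η := ω') ht hs0
            ((isPreconnected_halfCircle x r).image _ G.continuous.continuousOn) (by
              rintro _ ⟨y, hy, rfl⟩
              exact (map_mem_hp_iff hG).2 ((mem_halfCircle_iff hr0).1 hy).1)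
            ⟨_, hcC, by simp⟩ (mem_image_of_mem _ hη2) (by
              refine (norm_sub_le_re_im _ _).trans ?_
              have h3 : 0 ≤ ζ'.im + τ := by linarith [hτ.1]
              simp [abs_of_nonneg h3]; linarith [hτ.2]) hη1.le
            (by rintro _ ⟨y, hy, rfl⟩; exact hC y hy) e3 (by linarith) (by linarith)
          linarith
    · push Not at hcase
      have hin : ‖G.symm ω' - x‖ < r := hS.forall_lt_of_forall_ne
        (g := fun w => ‖G.symm w - x‖) (by fun_prop) hcase hζ'S (by simpa [ζ'] using hζx) _ hω'S
      rcases le_or_gt ‖ω' - x‖ r₂ with hfar | hfar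
      · refine hωω' ?_
        have h1 := Complex.abs_re_le_norm (ω' - x)
        have h2 := Complex.abs_im_le_norm (ω' - x)
        simp only [Complex.sub_re, Complex.ofReal_re, Complex.sub_im, Complex.ofReal_im, sub_zero,
          e3, e4] at h1 h2
        rw [abs_of_pos (by linarith)] at h2
        have h3 : r₂ ≤ 8 * Real.exp 80 ^ 2 * t := by linarith [hr₂.2]
        rw [abs_sub_comm] at h1
        have h4 : |ζ.im - ζ'.im| ≤ 8 * Real.exp 80 ^ 2 * t := by
          rw [abs_le]; constructor <;> linarith
        linarith
      · set W := {η | (G.symm η ∈ hp ∧ ‖G.symm η - x‖ < r) ∧ r₂ < ‖η - x‖}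
        have hc1 : Continuous fun η => ‖G.symm η - x‖ := by fun_prop
        have hc2 : Continuous fun η : ℂ => ‖η - x‖ := by fun_prop
        have hWo : IsOpen W :=
          (IsOpen.and (isOpen_hp.preimage G.symm.continuous) (isOpen_lt hc1 continuous_const)).and
            (isOpen_lt continuous_const hc2)
        have hWcl : closure W ⊆ {η | (0 ≤ (G.symm η).im ∧ ‖G.symm η - x‖ ≤ r) ∧
            r₂ ≤ ‖η - x‖} := by
          refine closure_minimal (fun η hη => ⟨⟨le_of_lt hη.1.1, hη.1.2.le⟩, hη.2.le⟩) ?_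
          exact (IsClosed.and (isClosed_le continuous_const
            (Complex.continuous_im.comp G.symm.continuous))
            (isClosed_le hc1 continuous_const)).and (isClosed_le continuous_const hc2)
        have hWhp : closure W ⊆ hp := fun η hη => by
          obtain ⟨⟨h1, h2⟩, h3⟩ := hWcl hη
          by_contra h4
          have h5 : G.symm η ∉ hp := fun h => h4 (by simpa using (map_mem_hp_iff hG).2 h)
          have h6 := hG _ h5
          rw [G.apply_symm_apply] at h6
          rw [← h6] at h2
          linarith
        have hWb : IsBounded W := by
          refine (((isCompact_closedBall (x : ℂ) r).image G.continuous).isBounded).subset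
            fun η hη => ⟨G.symm η, ?_, by simp⟩
          rw [mem_closedBall, dist_eq_norm]; exact hη.1.2.le
        have hdc : DiffContOnCl ℂ (fun z => φ z - p) W :=
          ((hd.mono hWhp).sub_const p).diffContOnCl
        have := Complex.norm_le_of_forall_mem_frontier_norm_le hWb hdc (C := s) (fun η hη => by
          rw [hWo.frontier_eq] at hη
          obtain ⟨⟨h1, h2⟩, h3⟩ := hWcl hη.1
          have hηhp := hWhp hη.1
          have h4 : G.symm η ∈ hp := (map_mem_hp_iff hG).1 (by simpa using hηhp)
          rcases h2.lt_or_eq with h2 | h2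
          · rcases h3.lt_or_eq with h3 | h3
            · exact absurd ⟨⟨h4, h2⟩, h3⟩ hη.2
            · exact (hrs₂ η hηhp h3.symm).trans hs
          · simpa using hC _ ((mem_halfCircle_iff hr0).2 ⟨h4, h2⟩)) (z := ω')
          (subset_closure ⟨⟨(map_mem_hp_iff hG).1 (by simpa using hSU hω'S), hin⟩, hfar⟩)
        linarith

end Shift

section Isotopy

variable {S T : Type*} [TopologicalSpace S] [TopologicalSpace T]

lemma IsotopicToIdRel.mono {f : S ≃ₜ S} {F F' : Set S} (h : IsotopicToIdRel S f F)
    (hF : F' ⊆ F) : IsotopicToIdRel S f F' := by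
  obtain ⟨H, h1, h2, h3, h4, h5⟩ := h
  exact ⟨H, h1, h2, h3, h4, fun t x hx => h5 t x (hF hx)⟩

lemma IsotopicToIdRel.trans {f g : S ≃ₜ S} {F : Set S} (hf : IsotopicToIdRel S f F)
    (hg : IsotopicToIdRel S g F) : IsotopicToIdRel S (f.trans g) F := by
  obtain ⟨H, h1, h2, h3, h4, h5⟩ := hf
  obtain ⟨K, k1, k2, k3, k4, k5⟩ := hg
  refine ⟨fun t => (H t).trans (K t), k1.comp (h1.prodMk continuous_snd),
    h2.comp (k2.prodMk continuous_snd), by simp only [h3, k3]; rfl,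
    by simp only [h4, k4], fun t x hx => ?_⟩
  rw [Homeomorph.trans_apply, h5 t x hx, k5 t x hx]

lemma IsotopicToIdRel.conj {f : S ≃ₜ S} {F : Set S} (hf : IsotopicToIdRel S f F) (e : S ≃ₜ T) :
    IsotopicToIdRel T ((e.symm.trans f).trans e) (e '' F) := by
  obtain ⟨H, h1, h2, h3, h4, h5⟩ := hf
  refine ⟨fun t => (e.symm.trans (H t)).trans e, ?_, ?_, ?_, by simp only [h4], ?_⟩
  · exact e.continuous.comp (h1.comp ((e.symm.continuous.comp continuous_fst).prodMk
      continuous_snd))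
  · exact e.continuous.comp (h2.comp ((e.symm.continuous.comp continuous_fst).prodMk
      continuous_snd))
  · simp only [h3]; ext x; simp
  · rintro t _ ⟨x, hx, rfl⟩
    simp [h5 t x hx]

lemma IsotopicToIdRel.of_path {H : unitInterval → S ≃ₜ S} {F : Set S}
    (h1 : Continuous fun q : S × unitInterval => H q.2 q.1)
    (h2 : Continuous fun q : S × unitInterval => (H q.2).symm q.1)
    (hF : ∀ t, ∀ x ∈ F, H t x = x) (h0 : IsotopicToIdRel S (H 0) F) :
    IsotopicToIdRel S (H 1) F := by
  have h : IsotopicToIdRel S ((H 1).trans (H 0).symm) F := by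
    refine ⟨fun t => (H t).trans (H 0).symm, (H 0).symm.continuous.comp h1, ?_, ?_, rfl, ?_⟩
    · exact h2.comp (((H 0).continuous.comp continuous_fst).prodMk continuous_snd)
    · ext x; simp
    · intro t x hx
      rw [Homeomorph.trans_apply, hF t x hx, Homeomorph.symm_apply_eq, hF 0 x hx]
  convert! h.trans h0 using 1
  ext x; simp

/-- A jointly continuous family of homeomorphisms of the plane has a jointly continuous family of
inverses. -/
lemma continuous_symm_of_continuous {X : Type*} [TopologicalSpace X] {H : X → ℂ ≃ₜ ℂ}
    (h : Continuous fun q : ℂ × X => H q.2 q.1) :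
    Continuous fun q : ℂ × X => (H q.2).symm q.1 := by
  rw [continuous_iff_continuousAt]
  rintro ⟨y₀, t₀⟩
  set x₀ := (H t₀).symm y₀ with hx₀
  refine Metric.tendsto_nhds.2 fun ε hε => ?_
  have hS : IsCompact (sphere x₀ ε) := isCompact_sphere _ _
  have hc : ∀ t, Continuous fun x => ‖H t x - y₀‖ := fun t => by fun_prop
  obtain ⟨a, ha, hamin⟩ := hS.exists_isMinOn (NormedSpace.sphere_nonempty.2 hε.le)
    (hc t₀).continuousOn
  set δ := ‖H t₀ a - y₀‖
  have hδ : 0 < δ := by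
    rw [norm_pos_iff, sub_ne_zero]
    intro h'
    rw [← Homeomorph.eq_symm_apply, ← hx₀] at h'
    rw [h', mem_sphere, dist_self] at ha
    exact hε.ne ha
  have e1 : ∀ᶠ t in 𝓝 t₀, ∀ x ∈ sphere x₀ ε, δ / 2 < ‖H t x - y₀‖ := by
    refine hS.eventually_forall_of_forall_eventually fun x hx => ?_
    have hc : ContinuousAt (fun q : X × ℂ => ‖H q.1 q.2 - y₀‖) (t₀, x) :=
      ((h.comp continuous_swap).sub continuous_const).norm.continuousAt
    exact hc.eventually_const_lt (lt_of_lt_of_le (half_lt_self hδ) (hamin hx))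
  have e2 : ∀ᶠ t in 𝓝 t₀, ‖H t x₀ - y₀‖ < δ / 2 := by
    have hc : ContinuousAt (fun t => ‖H t x₀ - y₀‖) t₀ :=
      ((h.comp (continuous_const.prodMk continuous_id)).sub continuous_const).norm.continuousAt
    refine hc.eventually_lt_const ?_
    simp [hx₀, hδ]
  have e3 : ∀ᶠ y in 𝓝 y₀, y ∈ ball y₀ (δ / 2) := ball_mem_nhds _ (by positivity)
  rw [nhds_prod_eq]
  filter_upwards [e3.prod_mk (e1.and e2)] with ⟨y, t⟩ ⟨hy, h1, h2⟩
  have := (convex_ball y₀ (δ / 2)).isPreconnected.forall_lt_of_forall_ne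
    (g := fun w => ‖(H t).symm w - x₀‖) (c := ε) (z := H t x₀) (by fun_prop) (fun w hw hw' => by
      have h3 := h1 ((H t).symm w) (by rw [mem_sphere, dist_eq_norm, hw'])
      rw [Homeomorph.apply_symm_apply, ← dist_eq_norm] at h3
      exact h3.not_gt hw) (by rwa [mem_ball, dist_eq_norm]) (by simpa using hε) y hy
  rwa [dist_eq_norm]

end Isotopy

section Cayley

/-- The Möbius transformation taking the upper half-plane to the unit disc, `I` to `0` and `0` to
`u`. -/
noncomputable def cayley (u z : ℂ) : ℂ := -u * (z - Complex.I) / (z + Complex.I)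

/-- The inverse of `cayley u`. -/
noncomputable def cayleyInv (u w : ℂ) : ℂ := Complex.I * (u - w) / (u + w)

lemma add_I_ne_zero {z : ℂ} (hz : 0 ≤ z.im) : z + Complex.I ≠ 0 := fun h => by
  have := congrArg Complex.im h
  simp at this
  linarith

lemma cayleyInv_cayley {u z : ℂ} (hu : u ≠ 0) (hz : 0 ≤ z.im) : cayleyInv u (cayley u z) = z := by
  have h1 := add_I_ne_zero hz
  have h2 : u + cayley u z = 2 * u * Complex.I / (z + Complex.I) := by
    rw [cayley]; field_simp; ring
  have h3 : u - cayley u z = 2 * u * z / (z + Complex.I) := by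
    rw [cayley]; field_simp; ring
  rw [cayleyInv, h2, h3]
  field_simp

lemma norm_cayley_lt_one_iff {u z : ℂ} (hu : ‖u‖ = 1) (hz : 0 ≤ z.im) :
    ‖cayley u z‖ < 1 ↔ 0 < z.im := by
  rw [cayley, norm_div, norm_mul, norm_neg, hu, one_mul,
    div_lt_one (norm_pos_iff.2 (add_I_ne_zero hz)), ← sq_lt_sq₀ (norm_nonneg _) (norm_nonneg _),
    ← Complex.normSq_eq_norm_sq, ← Complex.normSq_eq_norm_sq, Complex.normSq_apply,
    Complex.normSq_apply]
  simp
  constructor <;> intro h <;> nlinarith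

lemma cayley_cayleyInv {u w : ℂ} (hu : u ≠ 0) (hw : u + w ≠ 0) :
    cayley u (cayleyInv u w) = w := by
  have h1 : cayleyInv u w + Complex.I = 2 * u * Complex.I / (u + w) := by
    rw [cayleyInv]; field_simp; ring
  have h2 : cayleyInv u w - Complex.I = - 2 * w * Complex.I / (u + w) := by
    rw [cayleyInv]; field_simp; ring
  rw [cayley, h1, h2]
  field_simp

lemma cayleyInv_im {u w : ℂ} (hu : ‖u‖ = 1) :
    (cayleyInv u w).im = (1 - ‖w‖ ^ 2) / ‖u + w‖ ^ 2 := by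
  have h : ‖u‖ ^ 2 = 1 := by rw [hu, one_pow]
  rw [← Complex.normSq_eq_norm_sq, Complex.normSq_apply] at h
  rw [cayleyInv, mul_div_assoc, Complex.I_mul_im, Complex.div_re, ← Complex.normSq_eq_norm_sq,
    ← Complex.normSq_eq_norm_sq, ← add_div, Complex.normSq_apply w, ← h]
  congr 1
  simp
  ring

lemma cayleyInv_im_nonneg {u w : ℂ} (hu : ‖u‖ = 1) (hw : ‖w‖ ≤ 1) : 0 ≤ (cayleyInv u w).im := by
  rw [cayleyInv_im hu]
  have : ‖w‖ ^ 2 ≤ 1 := pow_le_one₀ (norm_nonneg _) hw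
  exact div_nonneg (by linarith) (by positivity)

lemma ne_zero_of_norm_eq_one_of_norm_lt {u w : ℂ} (hu : ‖u‖ = 1) (hw : ‖w‖ < 1) :
    u + w ≠ 0 := fun h => by
  rw [eq_neg_of_add_eq_zero_left h, norm_neg] at hu
  exact hw.ne hu

lemma cayleyInv_mem_hp {u w : ℂ} (hu : ‖u‖ = 1) (hw : ‖w‖ < 1) : cayleyInv u w ∈ hp := by
  have hu0 : u ≠ 0 := by rintro rfl; simp at hu
  refine (norm_cayley_lt_one_iff hu (cayleyInv_im_nonneg hu hw.le)).1 ?_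
  rwa [cayley_cayleyInv hu0 (ne_zero_of_norm_eq_one_of_norm_lt hu hw)]

lemma image_cayley_hp {u : ℂ} (hu : ‖u‖ = 1) : cayley u '' hp = ball 0 1 := by
  have hu0 : u ≠ 0 := by rintro rfl; simp at hu
  refine Subset.antisymm ?_ fun w hw => ?_
  · rintro _ ⟨z, hz, rfl⟩
    rw [mem_ball_zero_iff]
    exact (norm_cayley_lt_one_iff hu (le_of_lt hz)).2 hz
  · rw [mem_ball_zero_iff] at hw
    exact ⟨cayleyInv u w, cayleyInv_mem_hp hu hw,
      cayley_cayleyInv hu0 (ne_zero_of_norm_eq_one_of_norm_lt hu hw)⟩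

lemma injOn_cayley_hp {u : ℂ} (hu : u ≠ 0) : InjOn (cayley u) hp :=
  LeftInvOn.injOn (f₁' := cayleyInv u) fun _ hz => cayleyInv_cayley hu (le_of_lt hz)

lemma differentiableOn_cayley_hp (u : ℂ) : DifferentiableOn ℂ (cayley u) hp := by
  refine DifferentiableOn.div (by fun_prop) (by fun_prop) fun z hz => add_I_ne_zero (le_of_lt hz)

lemma exists_riemannMap_hp {U : Set ℂ} {z₀ : ℂ} (hU : IsOpen U) (hUc : IsPreconnected U)
    (hz₀ : z₀ ∈ U) (hne : U ≠ univ) (hs : HasUnivalentSqrt U) :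
    ∃ φ : ℂ → ℂ, DifferentiableOn ℂ φ hp ∧ InjOn φ hp ∧ φ '' hp = U ∧ φ Complex.I = z₀ := by
  obtain ⟨φ, h1, h2, h3, h4⟩ := exists_riemannMap hU hUc hz₀ hne hs
  have hc := image_cayley_hp (u := 1) (by simp)
  have hm : MapsTo (cayley 1) hp (ball 0 1) := mapsTo_iff_image_subset.2 hc.subset
  refine ⟨φ ∘ cayley 1, h1.comp (differentiableOn_cayley_hp 1) hm,
    h2.comp (injOn_cayley_hp one_ne_zero) hm, ?_, ?_⟩
  · rw [image_comp, hc, h3]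
  · simp [cayley, h4]

end Cayley

section Lift

/-- Connected sets with image close to `p` do not cross a fixed half-annulus. -/
lemma exists_lt_norm_of_crossing {φ : ℂ → ℂ} (hd : DifferentiableOn ℂ φ hp) (hi : InjOn φ hp)
    {p : ℂ} (hφp : ∀ z ∈ hp, φ z ≠ p) (x : ℝ) {a : ℝ} (ha : 0 < a) :
    ∃ s > 0, ∀ Γ : Set ℂ, IsPreconnected Γ → Γ ⊆ hp → ∀ z ∈ Γ, ∀ w ∈ Γ, ‖z - x‖ ≤ a →
      Real.exp 80 * a ≤ ‖w - x‖ → ∃ y ∈ Γ, s < ‖φ y - p‖ := by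
  set A := harnackConst (Real.exp 80)
  have hA : 1 ≤ A := one_le_harnackConst _
  have hpos : 0 < ‖φ (x + a * Complex.I) - p‖ := by
    rw [norm_pos_iff, sub_ne_zero]
    exact hφp _ (by simp [hp, ha])
  refine ⟨‖φ (x + a * Complex.I) - p‖ / (4 * A), by positivity, ?_⟩
  intro Γ hΓ hΓU z hz w hw hza hwa
  by_contra! hcon
  obtain ⟨r, hr, hb⟩ := exists_halfCircle_of_crossing hd hi ha (by positivity) hΓ hΓU hz hw hza hwa
    hcon
  have hr0 : 0 < r := ha.trans_le hr.1
  have h1 := hb (x + r * Complex.I) (by simp [hp, hr0]) (by simp [abs_of_pos hr0])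
  have h2 := norm_sub_le_harnack_hp hd hi hφp (ζ := x + r * Complex.I) (η := x + a * Complex.I)
    (M := Real.exp 80) ha (by simpa using hr.1) (by simp) (by
      rw [add_sub_add_left_eq_sub, ← sub_mul, norm_mul, Complex.norm_I, mul_one,
        ← Complex.ofReal_sub, Complex.norm_real, Real.norm_eq_abs, abs_le]
      constructor <;> linarith [hr.1, hr.2])
  have h3 : A * (2 * (‖φ (x + a * Complex.I) - p‖ / (4 * A))) =
      ‖φ (x + a * Complex.I) - p‖ / 2 := by
    field_simp; norm_num
  have h4 := mul_le_mul_of_nonneg_left h1 (by linarith : 0 ≤ A)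
  linarith

/-- A conformal parametrization of a component of `Fᶜ` by the upper half-plane. -/
structure ComplementChart (F : Set ℂ) (φ : ℂ → ℂ) : Prop where
  diff : DifferentiableOn ℂ φ hp
  inj : InjOn φ hp
  notMem : ∀ z ∈ hp, φ z ∉ F
  frontier_subset : frontier (φ '' hp) ⊆ F

variable {F : Set ℂ} {φ : ℂ → ℂ} {f : ℂ ≃ₜ ℂ}

lemma ComplementChart.isOpen (h : ComplementChart F φ) : IsOpen (φ '' hp) :=
  isOpen_image_of_injOn isOpen_hp h.diff h.inj

lemma ComplementChart.leftInvOn (h : ComplementChart F φ) :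
    LeftInvOn (Function.invFunOn φ hp) φ hp :=
  h.inj.leftInvOn_invFunOn

lemma ComplementChart.continuousOn_inv (h : ComplementChart F φ) :
    ContinuousOn (Function.invFunOn φ hp) (φ '' hp) :=
  (differentiableOn_leftInvOn isOpen_hp h.diff h.leftInvOn).continuousOn

lemma ComplementChart.subset_of_isPreconnected (h : ComplementChart F φ) {Γ : Set ℂ}
    (hΓ : IsPreconnected Γ) (hΓF : ∀ w ∈ Γ, w ∉ F) {ζ : ℂ} (hζ : ζ ∈ hp) (hζΓ : φ ζ ∈ Γ) :
    Γ ⊆ φ '' hp := by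
  refine hΓ.subset_of_closure_inter_subset h.isOpen ⟨φ ζ, hζΓ, mem_image_of_mem _ hζ⟩ ?_
  rintro w ⟨hw1, hw2⟩
  by_contra hw3
  exact hΓF w hw2 (h.frontier_subset (h.isOpen.frontier_eq ▸ ⟨hw1, hw3⟩))

lemma ComplementChart.exists_pullback (h : ComplementChart F φ) {Γ : Set ℂ}
    (hΓ : IsPreconnected Γ) (hΓF : ∀ w ∈ Γ, w ∉ F) {ζ w : ℂ} (hζ : ζ ∈ hp) (hζΓ : φ ζ ∈ Γ)
    (hw : w ∈ Γ) : ∃ Γ', IsPreconnected Γ' ∧ Γ' ⊆ hp ∧ ζ ∈ Γ' ∧ Function.invFunOn φ hp w ∈ Γ' ∧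
      ∀ y ∈ Γ', φ y ∈ Γ := by
  have hsub := h.subset_of_isPreconnected hΓ hΓF hζ hζΓ
  refine ⟨Function.invFunOn φ hp '' Γ, hΓ.image _ (h.continuousOn_inv.mono hsub), ?_,
    ⟨φ ζ, hζΓ, h.leftInvOn hζ⟩, mem_image_of_mem _ hw, ?_⟩
  · rintro _ ⟨y, hy, rfl⟩
    exact Function.invFunOn_mem (hsub hy)
  · rintro _ ⟨y, hy, rfl⟩
    rwa [Function.invFunOn_eq (hsub hy)]

lemma not_mem_of_apply_mem (hfix : ∀ x ∈ F, f x = x) {z : ℂ} (hz : z ∉ F) : f z ∉ F := fun h => by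
  have := f.injective (hfix _ h)
  rw [this] at h
  exact hz h

/-- Links near a boundary point, or near infinity, prevent the lift from moving boundary points. -/
lemma ComplementChart.tendsto_lift (h : ComplementChart F φ) (hF : F.Nonempty)
    (hl : ∀ p ∈ F, LocalLink f F p) (hinf : LinkAtInfinity f F) (x : ℝ) :
    Tendsto (fun ζ => Function.invFunOn φ hp (f (φ ζ))) (𝓝[hp] x) (𝓝 x) := by
  rw [tendsto_iff_ultrafilter]
  intro 𝒰 h𝒰
  by_contra hcon
  obtain ⟨ε, hε, hεU⟩ : ∃ ε > 0, ∀ᶠ ζ in (𝒰 : Filter ℂ),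
      ε ≤ ‖Function.invFunOn φ hp (f (φ ζ)) - x‖ := by
    rw [Metric.tendsto_nhds] at hcon
    push Not at hcon
    obtain ⟨ε, hε, hc⟩ := hcon
    refine ⟨ε, hε, ?_⟩
    filter_upwards [hc] with ζ hζ
    rwa [dist_eq_norm] at hζ
  have hhp : ∀ᶠ ζ in (𝒰 : Filter ℂ), ζ ∈ hp := h𝒰 self_mem_nhdsWithin
  set a := ε / Real.exp 80
  have ha : 0 < a := by positivity
  have hae : Real.exp 80 * a = ε := by simp only [a]; field_simp
  have hclose : ∀ᶠ ζ in (𝒰 : Filter ℂ), ‖ζ - (x : ℂ)‖ ≤ a := by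
    refine h𝒰 (mem_nhdsWithin_of_mem_nhds ?_)
    filter_upwards [closedBall_mem_nhds (x : ℂ) ha] with ζ hζ
    rwa [mem_closedBall, dist_eq_norm] at hζ
  by_cases hb : ∃ R, ∀ᶠ ζ in (𝒰 : Filter ℂ), φ ζ ∈ closedBall 0 R
  · obtain ⟨R, hR⟩ := hb
    obtain ⟨p, -, hp'⟩ := (isCompact_closedBall (0 : ℂ) R).ultrafilter_le_nhds (𝒰.map φ)
      (by rw [le_principal_iff]; exact hR)
    have hpc : p ∈ closure (φ '' hp) := by
      refine mem_closure_of_tendsto (f := φ) (b := (𝒰 : Filter ℂ)) hp' ?_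
      filter_upwards [hhp] with ζ hζ using mem_image_of_mem _ hζ
    have hpU : p ∉ φ '' hp := by
      rintro ⟨q, hq, rfl⟩
      have h1 : Tendsto (fun ζ => Function.invFunOn φ hp (φ ζ)) 𝒰 (𝓝 q) :=
        (tendsto_leftInvOn isOpen_hp h.diff h.leftInvOn hq).comp hp'
      have h2 : Tendsto (fun ζ => ζ) (𝒰 : Filter ℂ) (𝓝 q) := by
        refine h1.congr' ?_
        filter_upwards [hhp] with ζ hζ using h.leftInvOn hζ
      have h3 : q = x := tendsto_nhds_unique h2 (h𝒰.trans nhdsWithin_le_nhds)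
      rw [h3] at hq
      simp [hp] at hq
    have hpF : p ∈ F := h.frontier_subset (h.isOpen.frontier_eq ▸ ⟨hpc, hpU⟩)
    obtain ⟨s, hs, hcross⟩ := exists_lt_norm_of_crossing h.diff h.inj
      (fun z hz hzp => h.notMem z hz (hzp ▸ hpF)) x ha
    obtain ⟨δ, hδ, hlink⟩ := hl p hpF s hs
    have hnear : ∀ᶠ ζ in (𝒰 : Filter ℂ), ‖φ ζ - p‖ < δ := by
      have : ∀ᶠ ζ in (𝒰 : Filter ℂ), φ ζ ∈ ball p δ := hp' (ball_mem_nhds p hδ)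
      filter_upwards [this] with ζ hζ
      rwa [mem_ball, dist_eq_norm] at hζ
    obtain ⟨ζ, hζ, hζ1, hζ2, hζ3⟩ := (hhp.and (hεU.and (hclose.and hnear))).exists
    obtain ⟨Γ, hΓ, hΓs, hΓ1, hΓ2⟩ := hlink _ (h.notMem ζ hζ) hζ3
    obtain ⟨Γ', g1, g2, g3, g4, g5⟩ := h.exists_pullback hΓ (fun w hw => (hΓs w hw).2) hζ hΓ1 hΓ2
    obtain ⟨y, hy, hys⟩ := hcross Γ' g1 g2 _ g3 _ g4 hζ2 (by rwa [hae])
    exact hys.not_gt (hΓs _ (g5 y hy)).1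
  · obtain ⟨q, hq⟩ := hF
    have hne : ∀ z ∈ hp, φ z - q ≠ 0 := fun z hz hzq =>
      h.notMem z hz (by rwa [sub_eq_zero.1 hzq])
    obtain ⟨s, hs, hcross⟩ := exists_lt_norm_of_crossing (φ := fun z => (φ z - q)⁻¹) (p := 0)
      ((h.diff.sub_const q).inv hne) (fun z hz w hw hzw => h.inj hz hw (by simpa using hzw))
      (fun z hz => inv_ne_zero (hne z hz)) x ha
    obtain ⟨R', hlink⟩ := hinf (‖q‖ + s⁻¹)
    have hnear : ∀ᶠ ζ in (𝒰 : Filter ℂ), R' < ‖φ ζ‖ := by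
      push Not at hb
      filter_upwards [hb R'] with ζ hζ
      simpa using hζ
    obtain ⟨ζ, hζ, hζ1, hζ2, hζ3⟩ := (hhp.and (hεU.and (hclose.and hnear))).exists
    obtain ⟨Γ, hΓ, hΓs, hΓ1, hΓ2⟩ := hlink _ (h.notMem ζ hζ) hζ3
    obtain ⟨Γ', g1, g2, g3, g4, g5⟩ := h.exists_pullback hΓ (fun w hw => (hΓs w hw).2) hζ hΓ1 hΓ2
    obtain ⟨y, hy, hys⟩ := hcross Γ' g1 g2 _ g3 _ g4 hζ2 (by rwa [hae])
    have h1 := (hΓs _ (g5 y hy)).1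
    have h2 := norm_sub_norm_le (φ y) q
    rw [sub_zero, norm_inv, lt_inv_comm₀ hs (norm_pos_iff.2 (hne y (g2 hy)))] at hys
    linarith

/-- The image of a component of `Fᶜ` is this component. -/
lemma ComplementChart.map_mem (h : ComplementChart F φ) (hFc : F.Nonempty)
    (hfix : ∀ x ∈ F, f x = x)
    (hl : ∀ p ∈ F, LocalLink f F p) {w : ℂ} (hw : w ∈ φ '' hp) : f w ∈ φ '' hp := by
  have hI : Complex.I ∈ hp := by simp [hp]
  have hne : (φ '' hp).Nonempty := ⟨_, mem_image_of_mem φ hI⟩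
  have hnu : φ '' hp ≠ univ := by
    intro h'
    obtain ⟨q, hq⟩ := hFc
    obtain ⟨z, hz, rfl⟩ : q ∈ φ '' hp := h' ▸ mem_univ q
    exact h.notMem z hz hq
  obtain ⟨p, hp'⟩ := (nonempty_frontier_iff (s := φ '' hp)).2 ⟨hne, hnu⟩
  obtain ⟨δ, hδ, hlink⟩ := hl p (h.frontier_subset hp') 1 one_pos
  obtain ⟨_, ⟨ζ, hζ, rfl⟩, hd⟩ := Metric.mem_closure_iff.1 (frontier_subset_closure hp') δ hδ
  rw [dist_comm, dist_eq_norm] at hd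
  obtain ⟨Γ, hΓ, hΓs, hΓ1, hΓ2⟩ := hlink _ (h.notMem ζ hζ) hd
  obtain ⟨ζ', hζ', h1⟩ := h.subset_of_isPreconnected hΓ (fun w hw => (hΓs w hw).2) hζ hΓ1 hΓ2
  have hUc : IsPreconnected (φ '' hp) := convex_hp.isPreconnected.image _ h.diff.continuousOn
  refine h.subset_of_isPreconnected (hUc.image f f.continuous.continuousOn) ?_ hζ' ?_
    (mem_image_of_mem f hw)
  · rintro _ ⟨_, ⟨z, hz, rfl⟩, rfl⟩
    exact not_mem_of_apply_mem hfix (h.notMem z hz)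
  · rw [h1]; exact mem_image_of_mem _ (mem_image_of_mem _ hζ)

open Classical in
lemma ComplementChart.continuous_lift (h : ComplementChart F φ) (hF : F.Nonempty)
    (hfix : ∀ x ∈ F, f x = x)
    (hl : ∀ p ∈ F, LocalLink f F p) (hinf : LinkAtInfinity f F) :
    Continuous fun ζ => if ζ ∈ hp then Function.invFunOn φ hp (f (φ ζ)) else ζ := by
  rw [continuous_iff_continuousAt]
  intro z
  by_cases hz : z ∈ hp
  · have hc : ContinuousAt (fun ζ => Function.invFunOn φ hp (f (φ ζ))) z := by
      have h1 : ContinuousAt φ z := h.diff.continuousOn.continuousAt (isOpen_hp.mem_nhds hz)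
      have h2 : ContinuousAt (fun ζ => f (φ ζ)) z := f.continuous.continuousAt.comp h1
      exact ContinuousAt.comp (f := fun ζ => f (φ ζ)) (h.continuousOn_inv.continuousAt
        (h.isOpen.mem_nhds (h.map_mem hF hfix hl (mem_image_of_mem _ hz)))) h2
    refine hc.congr ?_
    filter_upwards [isOpen_hp.mem_nhds hz] with ζ hζ
    rw [if_pos hζ]
  · have key : Tendsto (fun ζ => if ζ ∈ hp then Function.invFunOn φ hp (f (φ ζ)) else ζ)
        (𝓝[hp] z) (𝓝 z) := by
      by_cases hz' : z.im = 0
      · have hz'' : ((z.re : ℝ) : ℂ) = z := Complex.ext (by simp) (by simp [hz'])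
        have := h.tendsto_lift hF hl hinf z.re
        rw [hz''] at this
        refine this.congr' ?_
        filter_upwards [self_mem_nhdsWithin] with ζ hζ
        rw [if_pos hζ]
      · have hlt : z.im < 0 := lt_of_le_of_ne (not_lt.1 hz) hz'
        have : 𝓝[hp] z = ⊥ := by
          rw [← notMem_closure_iff_nhdsWithin_eq_bot, ← mem_compl_iff, ← interior_compl,
            mem_interior_iff_mem_nhds]
          filter_upwards [(isOpen_lt Complex.continuous_im continuous_const).mem_nhds hlt] with w hw
          exact not_lt_of_gt hw
        rw [this]; exact tendsto_bot
    have hsplit : 𝓝 z = 𝓝[hp] z ⊔ 𝓝[hpᶜ] z := by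
      rw [← nhdsWithin_union, union_compl_self, nhdsWithin_univ]
    rw [ContinuousAt, if_neg hz]
    refine Tendsto.mono_left ?_ hsplit.le
    refine key.sup ?_
    refine Tendsto.congr' ?_ (tendsto_id.mono_left nhdsWithin_le_nhds)
    filter_upwards [self_mem_nhdsWithin] with ζ hζ
    rw [if_neg hζ]; rfl

lemma LocalLink.symm (hfix : ∀ x ∈ F, f x = x) {p : ℂ} (hpF : p ∈ F) (hl : LocalLink f F p) :
    LocalLink f.symm F p := by
  intro ε hε
  obtain ⟨δ, hδ, h⟩ := hl ε hε
  have hfp : f.symm p = p := by rw [Homeomorph.symm_apply_eq, hfix p hpF]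
  obtain ⟨δ', hδ', h'⟩ := Metric.continuousAt_iff.1 (f.symm.continuous.continuousAt (x := p)) δ hδ
  refine ⟨δ', hδ', fun z hz hzp => ?_⟩
  obtain ⟨Γ, h1, h2, h3, h4⟩ := h (f.symm z) (fun hz' => hz (by
    have := hfix _ hz'
    rw [f.apply_symm_apply] at this
    rwa [this])) (by
      rw [← dist_eq_norm] at hzp ⊢
      simpa [hfp] using h' hzp)
  exact ⟨Γ, h1, h2, by simpa using h4, h3⟩

lemma LinkAtInfinity.symm (hfix : ∀ x ∈ F, f x = x) (hl : LinkAtInfinity f F) :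
    LinkAtInfinity f.symm F := by
  intro R
  obtain ⟨R₁, h⟩ := hl R
  have hlim : Tendsto f.symm (cobounded ℂ) (cobounded ℂ) := by
    rw [Metric.cobounded_eq_cocompact]; exact f.symm.isClosedEmbedding.tendsto_cocompact
  have h1 : ∀ᶠ z in cobounded ℂ, R₁ < ‖f.symm z‖ :=
    (tendsto_norm_cobounded_atTop.comp hlim).eventually_gt_atTop R₁
  rw [← comap_norm_atTop, eventually_comap, eventually_atTop] at h1
  obtain ⟨R', hR'⟩ := h1
  refine ⟨R', fun z hz hzR => ?_⟩
  obtain ⟨Γ, h1, h2, h3, h4⟩ := h (f.symm z) (fun hz' => hz (by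
    have := hfix _ hz'
    rw [f.apply_symm_apply] at this
    rwa [this])) (hR' ‖z‖ hzR.le z rfl)
  exact ⟨Γ, h1, h2, by simpa using h4, h3⟩

lemma symm_fix (hfix : ∀ x ∈ F, f x = x) : ∀ x ∈ F, f.symm x = x := fun x hx => by
  rw [Homeomorph.symm_apply_eq, hfix x hx]

/-- The lift of `f` to the upper half-plane, extended by the identity. -/
lemma ComplementChart.exists_lift (h : ComplementChart F φ) (hF : F.Nonempty)
    (hfix : ∀ x ∈ F, f x = x)
    (hl : ∀ p ∈ F, LocalLink f F p) (hinf : LinkAtInfinity f F) :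
    ∃ G : ℂ ≃ₜ ℂ, (∀ z ∉ hp, G z = z) ∧ ∀ z ∈ hp, φ (G z) = f (φ z) := by
  classical
  have hl' : ∀ p ∈ F, LocalLink f.symm F p := fun p hpF => (hl p hpF).symm hfix hpF
  have hmem : ∀ z ∈ hp, f (φ z) ∈ φ '' hp :=
    fun z hz => h.map_mem hF hfix hl (mem_image_of_mem _ hz)
  have hmem' : ∀ z ∈ hp, f.symm (φ z) ∈ φ '' hp := fun z hz =>
    h.map_mem hF (symm_fix hfix) hl' (mem_image_of_mem _ hz)
  let G : ℂ ≃ₜ ℂ :=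
    { toFun := fun ζ => if ζ ∈ hp then Function.invFunOn φ hp (f (φ ζ)) else ζ
      invFun := fun ζ => if ζ ∈ hp then Function.invFunOn φ hp (f.symm (φ ζ)) else ζ
      left_inv := fun z => by
        by_cases hz : z ∈ hp
        · beta_reduce
          rw [if_pos hz, if_pos (Function.invFunOn_mem (hmem z hz)),
            Function.invFunOn_eq (hmem z hz), f.symm_apply_apply, h.leftInvOn hz]
        · beta_reduce
          rw [if_neg hz, if_neg hz]
      right_inv := fun z => by
        by_cases hz : z ∈ hp
        · beta_reduce
          rw [if_pos hz, if_pos (Function.invFunOn_mem (hmem' z hz)),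
            Function.invFunOn_eq (hmem' z hz), f.apply_symm_apply, h.leftInvOn hz]
        · beta_reduce
          rw [if_neg hz, if_neg hz]
      continuous_toFun := h.continuous_lift hF hfix hl hinf
      continuous_invFun := h.continuous_lift hF (symm_fix hfix) hl' (hinf.symm hfix) }
  exact ⟨G, fun z hz => if_neg hz, fun z hz => by
    change φ (if z ∈ hp then _ else _) = _
    rw [if_pos hz, Function.invFunOn_eq (hmem z hz)]⟩

end Lift

section Slide

/-- Conjugation of `G` by vertical translations, from the identity at time `0` to `G` at
time `1`. -/
noncomputable def slide (G : ℂ → ℂ) (t : unitInterval) (ζ : ℂ) : ℂ :=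
  if (t : ℝ) = 0 then ζ else
    G (ζ - ((1 - t) / t : ℝ) * Complex.I) + ((1 - t) / t : ℝ) * Complex.I

lemma slide_zero (G : ℂ → ℂ) (ζ : ℂ) : slide G 0 ζ = ζ := by simp [slide]

lemma slide_one (G : ℂ → ℂ) (ζ : ℂ) : slide G 1 ζ = G ζ := by simp [slide]

lemma slide_symm_slide (G : ℂ ≃ₜ ℂ) (t : unitInterval) (ζ : ℂ) :
    slide G.symm t (slide G t ζ) = ζ := by
  by_cases ht : (t : ℝ) = 0 <;> simp [slide, ht]

lemma mem_hp_of_sub_mem {ζ : ℂ} {a : ℝ} (ha : 0 ≤ a) (h : ζ - a * Complex.I ∈ hp) : ζ ∈ hp := by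
  have h' : 0 < (ζ - a * Complex.I).im := h
  simp at h'
  exact show 0 < ζ.im by linarith

lemma slide_of_notMem {G : ℂ ≃ₜ ℂ} (hG : ∀ z ∉ hp, G z = z) (t : unitInterval) {ζ : ℂ}
    (hζ : ζ ∉ hp) : slide G t ζ = ζ := by
  by_cases ht : (t : ℝ) = 0
  · simp [slide, ht]
  · have h0 : 0 ≤ (1 - t : ℝ) / t := div_nonneg (by linarith [t.2.2]) t.2.1
    rw [slide, if_neg ht, hG _ fun h => hζ (mem_hp_of_sub_mem h0 h), sub_add_cancel]

lemma symm_fix_hp {G : ℂ ≃ₜ ℂ} (hG : ∀ z ∉ hp, G z = z) : ∀ z ∉ hp, G.symm z = z := fun z hz => by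
  rw [Homeomorph.symm_apply_eq, hG z hz]

lemma slide_mem_hp {G : ℂ ≃ₜ ℂ} (hG : ∀ z ∉ hp, G z = z) (t : unitInterval) {ζ : ℂ}
    (hζ : ζ ∈ hp) : slide G t ζ ∈ hp := by
  by_contra h
  have := slide_of_notMem (symm_fix_hp hG) t h
  rw [slide_symm_slide] at this
  rw [← this] at h
  exact h hζ

lemma continuous_slide {G : ℂ ≃ₜ ℂ} (hG : ∀ z ∉ hp, G z = z) :
    Continuous fun q : ℂ × unitInterval => slide G q.2 q.1 := by
  rw [continuous_iff_continuousAt]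
  rintro ⟨ζ, t⟩
  have ht' : ContinuousAt (fun q : ℂ × unitInterval => (q.2 : ℝ)) (ζ, t) := by fun_prop
  by_cases ht : (t : ℝ) = 0
  · set M := |ζ.im| + 1
    have hM : 0 < M := by positivity
    have e1 : ∀ᶠ q : ℂ × unitInterval in 𝓝 (ζ, t), (q.2 : ℝ) < 1 / (M + 1) :=
      ht'.eventually_lt_const (by simp only [ht]; positivity)
    have e2 : ∀ᶠ q : ℂ × unitInterval in 𝓝 (ζ, t), q.1.im < M :=
      (Complex.continuous_im.comp continuous_fst).continuousAt.eventually_lt_const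
        (by simp only [Function.comp, M]; linarith [le_abs_self ζ.im])
    refine (continuous_fst.continuousAt (x := (ζ, t))).congr ?_
    filter_upwards [e1, e2] with ⟨w, s⟩ h1 h2
    by_cases hs : (s : ℝ) = 0
    · simp [slide, hs]
    · have hs0 : 0 < (s : ℝ) := lt_of_le_of_ne s.2.1 (Ne.symm hs)
      have h3 : M ≤ (1 - s : ℝ) / s := by
        rw [le_div_iff₀ hs0]
        rw [lt_div_iff₀ (by positivity)] at h1
        simp only at h1
        linarith
      rw [slide, if_neg hs, hG, sub_add_cancel]
      intro h
      have h' : 0 < (w - ((1 - s) / s : ℝ) * Complex.I).im := h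
      rw [Complex.sub_im, Complex.mul_I_im, Complex.ofReal_re] at h'
      simp only at h2
      linarith
  · have hτ : ContinuousAt (fun q : ℂ × unitInterval => (((1 - q.2) / q.2 : ℝ) : ℂ)) (ζ, t) :=
      Complex.continuous_ofReal.continuousAt.comp ((continuousAt_const.sub ht').div ht' ht)
    have hc : ContinuousAt (fun q : ℂ × unitInterval =>
        G (q.1 - ((1 - q.2) / q.2 : ℝ) * Complex.I) + ((1 - q.2) / q.2 : ℝ) * Complex.I)
        (ζ, t) :=
      (ContinuousAt.comp (f := fun q : ℂ × unitInterval => q.1 - ((1 - q.2) / q.2 : ℝ) * Complex.I)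
        G.continuous.continuousAt (continuousAt_fst.sub (hτ.mul continuousAt_const))).add
        (hτ.mul continuousAt_const)
    refine hc.congr ?_
    filter_upwards [ht'.eventually_ne ht] with ⟨w, s⟩ hs
    exact (if_neg hs).symm

/-- Sliding moves points close to `p` in the image of the chart by a small amount, uniformly with
respect to the chart. -/
lemma exists_norm_slide_sub_lt {F : Set ℂ} {f : ℂ ≃ₜ ℂ} {p : ℂ} (hpF : p ∈ F) (hfp : f p = p)
    (hl : LocalLink f F p) {ε : ℝ} (hε : 0 < ε) : ∃ δ > 0, ∀ φ : ℂ → ℂ, ComplementChart F φ →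
      ∀ G : ℂ ≃ₜ ℂ, (∀ z ∉ hp, G z = z) → (∀ z ∈ hp, φ (G z) = f (φ z)) → ∀ ω ∈ hp,
      ∀ t : unitInterval, ‖φ ω - p‖ < δ → ‖φ (slide G t ω) - p‖ < ε := by
  have hA := one_le_shiftConst
  set A := shiftConst
  have hA0 : 0 < A := by linarith
  set s := ε / (4 * A)
  have hs : 0 < s := by positivity
  have hAs : 2 * A * s = ε / 2 := by simp only [s]; field_simp; norm_num
  obtain ⟨δ₁, hδ₁, hlink⟩ := hl s hs
  set s₁ := min s (δ₁ / 2)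
  have hs₁ : 0 < s₁ := by positivity
  obtain ⟨δ₂, hδ₂, hf⟩ := Metric.continuousAt_iff.1 (f.continuous.continuousAt (x := p)) ε hε
  refine ⟨min (s₁ / (2 * A)) (min δ₂ ε), by positivity, ?_⟩
  intro φ hφ G hG hφG ω hω t hωp
  obtain ⟨h1, h2, h3⟩ : ‖φ ω - p‖ < s₁ / (2 * A) ∧ ‖φ ω - p‖ < δ₂ ∧ ‖φ ω - p‖ < ε := by
    simpa using hωp
  by_cases ht : (t : ℝ) = 0
  · simpa [slide, ht] using h3
  have h0 : 0 ≤ (1 - t : ℝ) / t := div_nonneg (by linarith [t.2.2]) t.2.1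
  rw [slide, if_neg ht]
  set τ := (1 - t : ℝ) / t
  rcases h0.eq_or_lt with hτ | hτ
  · rw [← hτ, Complex.ofReal_zero, zero_mul, sub_zero, add_zero, hφG ω hω]
    rw [← dist_eq_norm] at h2 ⊢
    simpa [hfp] using hf h2
  · by_cases hζ : ω - τ * Complex.I ∈ hp
    · have := norm_shift_sub_le hφ.diff hφ.inj (fun z hz hzp => hφ.notMem z hz (hzp ▸ hpF)) hG hs₁
        (min_le_left s (δ₁ / 2)) (fun ζ hζ hζs => ?_) hζ hτ (by rw [sub_add_cancel]; exact h1.le)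
      · exact this.trans_lt (by rw [hAs]; linarith)
      · obtain ⟨Γ, g1, g2, g3, g4⟩ := hlink (φ ζ) (hφ.notMem ζ hζ)
          (hζs.trans_lt ((min_le_right _ _).trans_lt (half_lt_self hδ₁)))
        obtain ⟨Γ', k1, k2, k3, k4, k5⟩ := hφ.exists_pullback g1 (fun w hw => (g2 w hw).2) hζ g3 g4
        rw [← hφG ζ hζ, hφ.leftInvOn ((map_mem_hp_iff hG).2 hζ)] at k4
        exact ⟨Γ', k1, k2, k3, k4, fun y hy => (g2 _ (k5 y hy)).1.le⟩
    · rwa [hG _ hζ, sub_add_cancel]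

variable {F : Set ℂ} {f : ℂ ≃ₜ ℂ} {Φ : Set ℂ → ℂ → ℂ} {𝒢 : Set ℂ → ℂ ≃ₜ ℂ}

open Classical in
/-- The map sliding each component of `Fᶜ` in its chart. -/
noncomputable def glide (F : Set ℂ) (Φ : Set ℂ → ℂ → ℂ) (𝒢 : Set ℂ → ℂ ≃ₜ ℂ) (t : unitInterval)
    (z : ℂ) : ℂ :=
  if z ∈ F then z else Φ (connectedComponentIn Fᶜ z) (slide (𝒢 (connectedComponentIn Fᶜ z)) t
    (Function.invFunOn (Φ (connectedComponentIn Fᶜ z)) hp z))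

lemma glide_apply (hchart : ∀ w ∉ F, ComplementChart F (Φ (connectedComponentIn Fᶜ w)))
    (himg : ∀ w ∉ F, Φ (connectedComponentIn Fᶜ w) '' hp = connectedComponentIn Fᶜ w)
    {w : ℂ} (hw : w ∉ F) {ζ : ℂ} (hζ : ζ ∈ hp) (t : unitInterval) :
    glide F Φ 𝒢 t (Φ (connectedComponentIn Fᶜ w) ζ) =
      Φ (connectedComponentIn Fᶜ w) (slide (𝒢 (connectedComponentIn Fᶜ w)) t ζ) := by
  have h1 : Φ (connectedComponentIn Fᶜ w) ζ ∈ connectedComponentIn Fᶜ w := by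
    exact (himg w hw).subset (mem_image_of_mem _ hζ)
  rw [glide, if_neg ((hchart w hw).notMem ζ hζ), ← connectedComponentIn_eq h1,
    (hchart w hw).leftInvOn hζ]

lemma continuous_glide (hF : IsClosed F) (hfix : ∀ x ∈ F, f x = x)
    (hl : ∀ p ∈ F, LocalLink f F p)
    (hchart : ∀ w ∉ F, ComplementChart F (Φ (connectedComponentIn Fᶜ w)))
    (himg : ∀ w ∉ F, Φ (connectedComponentIn Fᶜ w) '' hp = connectedComponentIn Fᶜ w)
    (hG : ∀ w ∉ F, ∀ z ∉ hp, 𝒢 (connectedComponentIn Fᶜ w) z = z)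
    (hφG : ∀ w ∉ F, ∀ z ∈ hp, Φ (connectedComponentIn Fᶜ w) (𝒢 (connectedComponentIn Fᶜ w) z) =
      f (Φ (connectedComponentIn Fᶜ w) z)) :
    Continuous fun q : ℂ × unitInterval => glide F Φ 𝒢 q.2 q.1 := by
  rw [continuous_iff_continuousAt]
  rintro ⟨z, t⟩
  by_cases hz : z ∈ F
  · have h0 : glide F Φ 𝒢 t z = z := if_pos hz
    rw [ContinuousAt, h0, Metric.tendsto_nhds]
    intro ε hε
    obtain ⟨δ, hδ, h⟩ := exists_norm_slide_sub_lt hz (hfix z hz) (hl z hz) hε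
    have e1 : ∀ᶠ q : ℂ × unitInterval in 𝓝 (z, t), q.1 ∈ ball z (min δ ε) :=
      continuousAt_fst (ball_mem_nhds z (by positivity))
    filter_upwards [e1] with ⟨w, s⟩ hw
    rw [mem_ball, dist_eq_norm, lt_min_iff] at hw
    rw [dist_eq_norm]
    by_cases hwF : w ∈ F
    · simp only [glide, if_pos hwF]; exact hw.2
    · obtain ⟨ζ, hζ, hζw⟩ : w ∈ Φ (connectedComponentIn Fᶜ w) '' hp := by
        rw [himg w hwF]; exact mem_connectedComponentIn hwF
      have := glide_apply (𝒢 := 𝒢) hchart himg hwF hζ s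
      rw [hζw] at this
      rw [this]
      exact h _ (hchart w hwF) _ (hG w hwF) (hφG w hwF) ζ hζ s (by rw [hζw]; exact hw.1)
  · have hU : connectedComponentIn Fᶜ z ∈ 𝓝 z :=
      hF.isOpen_compl.connectedComponentIn.mem_nhds (mem_connectedComponentIn hz)
    set U := connectedComponentIn Fᶜ z with hUdef
    have hc := hchart z hz
    have hψm : ∀ w ∈ U, Function.invFunOn (Φ U) hp w ∈ hp := fun w hw =>
      Function.invFunOn_mem ((himg z hz).symm.subset hw)
    have hψ : ContinuousAt (Function.invFunOn (Φ U) hp) z :=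
      hc.continuousOn_inv.continuousAt (by rw [← hUdef, himg z hz]; exact hU)
    have hS : ContinuousAt (fun q : ℂ × unitInterval =>
        slide (𝒢 U) q.2 (Function.invFunOn (Φ U) hp q.1)) (z, t) :=
      ContinuousAt.comp (f := fun q : ℂ × unitInterval => (Function.invFunOn (Φ U) hp q.1, q.2))
        (continuous_slide (hG z hz)).continuousAt
        ((ContinuousAt.comp (f := Prod.fst) (x := (z, t)) hψ continuousAt_fst).prodMk
          continuousAt_snd)
    have hmem : slide (𝒢 U) t (Function.invFunOn (Φ U) hp z) ∈ hp :=
      slide_mem_hp (hG z hz) t (hψm z (mem_of_mem_nhds hU))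
    have hall := ContinuousAt.comp (f := fun q : ℂ × unitInterval =>
      slide (𝒢 U) q.2 (Function.invFunOn (Φ U) hp q.1)) (x := (z, t))
      (hc.diff.continuousOn.continuousAt (isOpen_hp.mem_nhds hmem)) hS
    refine hall.congr ?_
    filter_upwards [continuousAt_fst (p := (z, t)) hU] with ⟨w, s⟩ hw
    have hwF : w ∉ F := connectedComponentIn_subset _ _ hw
    have hUw : connectedComponentIn Fᶜ w = U := (connectedComponentIn_eq hw).symm
    simp only [glide, if_neg hwF, hUw, Function.comp, hUdef]

lemma ComplementChart.exists (hF : IsClosed F) (hFne : F.Nonempty) (hFc : NoBddClopen F) {w : ℂ}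
    (hw : w ∉ F) : ∃ φ, ComplementChart F φ ∧ φ '' hp = connectedComponentIn Fᶜ w ∧
      φ Complex.I = w := by
  have hsub : connectedComponentIn Fᶜ w ⊆ Fᶜ := connectedComponentIn_subset _ _
  obtain ⟨φ, h1, h2, h3, h4⟩ := exists_riemannMap_hp hF.isOpen_compl.connectedComponentIn
    isPreconnected_connectedComponentIn (mem_connectedComponentIn hw) (fun h => by
      obtain ⟨q, hq⟩ := hFne
      exact hsub (h ▸ mem_univ q) hq) (hasUnivalentSqrt_component hF hFne hFc w)
  refine ⟨φ, ⟨h1, h2, fun z hz => hsub (h3 ▸ mem_image_of_mem _ hz), ?_⟩, h3, h4⟩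
  rw [h3]
  simpa using frontier_connectedComponentIn_subset hF.isOpen_compl w

/-- A homeomorphism fixing `F` pointwise and satisfying the link conditions is isotopic to the
identity relatively to `F`. -/
lemma isotopicToIdRel_of_link (hF : IsClosed F) (hFne : F.Nonempty) (hFc : NoBddClopen F)
    (hfix : ∀ x ∈ F, f x = x) (hl : ∀ p ∈ F, LocalLink f F p) (hinf : LinkAtInfinity f F) :
    IsotopicToIdRel ℂ f F := by
  have key : ∀ U : Set ℂ, ∃ φ : ℂ → ℂ, ∃ G : ℂ ≃ₜ ℂ, (∃ w ∉ F, connectedComponentIn Fᶜ w = U) →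
      ComplementChart F φ ∧ φ '' hp = U ∧ (∀ z ∉ hp, G z = z) ∧ ∀ z ∈ hp, φ (G z) = f (φ z) := by
    intro U
    by_cases hU : ∃ w ∉ F, connectedComponentIn Fᶜ w = U
    · obtain ⟨w, hw, rfl⟩ := hU
      obtain ⟨φ, h1, h2, -⟩ := ComplementChart.exists hF hFne hFc hw
      obtain ⟨G, h3, h4⟩ := h1.exists_lift hFne hfix hl hinf
      exact ⟨φ, G, fun _ => ⟨h1, h2, h3, h4⟩⟩
    · exact ⟨id, Homeomorph.refl ℂ, fun h => absurd h hU⟩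
  choose Φ 𝒢 hΦ using key
  have hchart : ∀ w ∉ F, ComplementChart F (Φ (connectedComponentIn Fᶜ w)) := fun w hw =>
    (hΦ _ ⟨w, hw, rfl⟩).1
  have himg : ∀ w ∉ F, Φ (connectedComponentIn Fᶜ w) '' hp = connectedComponentIn Fᶜ w :=
    fun w hw => (hΦ _ ⟨w, hw, rfl⟩).2.1
  have hG : ∀ w ∉ F, ∀ z ∉ hp, 𝒢 (connectedComponentIn Fᶜ w) z = z := fun w hw =>
    (hΦ _ ⟨w, hw, rfl⟩).2.2.1
  have hφG : ∀ w ∉ F, ∀ z ∈ hp, Φ (connectedComponentIn Fᶜ w) (𝒢 (connectedComponentIn Fᶜ w) z) =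
      f (Φ (connectedComponentIn Fᶜ w) z) := fun w hw => (hΦ _ ⟨w, hw, rfl⟩).2.2.2
  set 𝒢' : Set ℂ → ℂ ≃ₜ ℂ := fun U => (𝒢 U).symm
  have hG' : ∀ w ∉ F, ∀ z ∉ hp, 𝒢' (connectedComponentIn Fᶜ w) z = z := fun w hw =>
    symm_fix_hp (hG w hw)
  have hφG' : ∀ w ∉ F, ∀ z ∈ hp, Φ (connectedComponentIn Fᶜ w)
      (𝒢' (connectedComponentIn Fᶜ w) z) = f.symm (Φ (connectedComponentIn Fᶜ w) z) := by
    intro w hw z hz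
    rw [Homeomorph.eq_symm_apply, ← hφG w hw _ ((map_mem_hp_iff (hG' w hw)).2 hz)]
    simp [𝒢']
  have hc := continuous_glide hF hfix hl hchart himg hG hφG
  have hc' := continuous_glide hF (symm_fix hfix)
    (fun p hpF => (hl p hpF).symm hfix hpF) hchart himg
    hG' hφG'
  have hex : ∀ w ∉ F, ∃ ζ ∈ hp, Φ (connectedComponentIn Fᶜ w) ζ = w := fun w hw =>
    (himg w hw).symm.subset (mem_connectedComponentIn hw)
  have hinv : ∀ 𝒢₁ 𝒢₂ : Set ℂ → ℂ ≃ₜ ℂ, (∀ U, 𝒢₂ U = (𝒢₁ U).symm) →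
      (∀ w ∉ F, ∀ z ∉ hp, 𝒢₁ (connectedComponentIn Fᶜ w) z = z) → ∀ t z,
      glide F Φ 𝒢₂ t (glide F Φ 𝒢₁ t z) = z := by
    intro 𝒢₁ 𝒢₂ h12 h1 t z
    by_cases hz : z ∈ F
    · simp [glide, hz]
    · obtain ⟨ζ, hζ, hζz⟩ := hex z hz
      have e1 := glide_apply (𝒢 := 𝒢₁) hchart himg hz hζ t
      have e2 := glide_apply (𝒢 := 𝒢₂) hchart himg hz (slide_mem_hp (h1 z hz) t hζ) t
      rw [h12, slide_symm_slide, ← e1, hζz] at e2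
      exact e2
  refine ⟨fun t =>
    { toFun := glide F Φ 𝒢 t
      invFun := glide F Φ 𝒢' t
      left_inv := hinv 𝒢 𝒢' (fun _ => rfl) hG t
      right_inv := hinv 𝒢' 𝒢 (fun _ => rfl) hG' t
      continuous_toFun := hc.comp (continuous_id.prodMk continuous_const)
      continuous_invFun := hc'.comp (continuous_id.prodMk continuous_const) }, hc, hc', ?_, ?_, ?_⟩
  · ext z
    change glide F Φ 𝒢 0 z = z
    by_cases hz : z ∈ F
    · simp [glide, hz]
    · obtain ⟨ζ, hζ, hζz⟩ := hex z hz
      have := glide_apply (𝒢 := 𝒢) hchart himg hz hζ 0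
      rwa [slide_zero, hζz] at this
  · ext z
    change glide F Φ 𝒢 1 z = f z
    by_cases hz : z ∈ F
    · simp [glide, hz, hfix z hz]
    · obtain ⟨ζ, hζ, hζz⟩ := hex z hz
      have := glide_apply (𝒢 := 𝒢) hchart himg hz hζ 1
      rwa [slide_one, hφG z hz ζ hζ, hζz] at this
  · intro t x hx
    change glide F Φ 𝒢 t x = x
    simp [glide, hx]

end Slide

section Push

variable {F : Set ℂ} {f : ℂ ≃ₜ ℂ} {φ : ℂ → ℂ}

open Classical in
/-- Transport of a family of self-maps of the upper half-plane of bounded hyperbolic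
displacement. -/
lemma ComplementChart.continuous_extend (h : ComplementChart F φ) {M : unitInterval → ℂ → ℂ}
    (hM : ContinuousOn (fun q : ℂ × unitInterval => M q.2 q.1) (hp ×ˢ univ))
    (hmaps : ∀ t, MapsTo (M t) hp hp) {C : ℝ}
    (hC : ∀ t, ∀ ζ ∈ hp, ∃ ρ > 0, ρ ≤ ζ.im ∧ ρ ≤ (M t ζ).im ∧ ‖M t ζ - ζ‖ ≤ C * ρ) :
    Continuous fun q : ℂ × unitInterval =>
      if q.1 ∈ φ '' hp then φ (M q.2 (Function.invFunOn φ hp q.1)) else q.1 := by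
  rw [continuous_iff_continuousAt]
  rintro ⟨z, t⟩
  by_cases hz : z ∈ φ '' hp
  · have hU := h.isOpen.mem_nhds hz
    have hζ : Function.invFunOn φ hp z ∈ hp := Function.invFunOn_mem hz
    have hψ : ContinuousAt (fun q : ℂ × unitInterval => Function.invFunOn φ hp q.1) (z, t) :=
      ContinuousAt.comp (f := Prod.fst) (h.continuousOn_inv.continuousAt hU) continuousAt_fst
    have h1 : ContinuousAt (fun q : ℂ × unitInterval => M q.2 (Function.invFunOn φ hp q.1))
        (z, t) :=
      ContinuousAt.comp (f := fun q : ℂ × unitInterval => (Function.invFunOn φ hp q.1, q.2))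
        (hM.continuousAt (prod_mem_nhds (isOpen_hp.mem_nhds hζ) univ_mem))
        (hψ.prodMk continuousAt_snd)
    have h2 := ContinuousAt.comp (x := (z, t))
      (f := fun q : ℂ × unitInterval => M q.2 (Function.invFunOn φ hp q.1))
      (h.diff.continuousOn.continuousAt (isOpen_hp.mem_nhds (hmaps t hζ))) h1
    refine h2.congr ?_
    filter_upwards [continuousAt_fst (p := (z, t)) hU] with ⟨w, s⟩ hw
    exact (if_pos hw).symm
  · rw [ContinuousAt, Metric.tendsto_nhds]
    intro ε hε
    have hA := one_le_harnackConst C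
    set A := harnackConst C
    have e1 : ∀ᶠ q : ℂ × unitInterval in 𝓝 (z, t), q.1 ∈ ball z (ε / A) :=
      continuousAt_fst (ball_mem_nhds z (by positivity))
    filter_upwards [e1] with ⟨w, s⟩ hw
    rw [mem_ball, dist_eq_norm, lt_div_iff₀ (by linarith)] at hw
    simp only at hw ⊢
    rw [if_neg hz, dist_eq_norm]
    split_ifs with hwU
    · obtain ⟨ζ, hζ, rfl⟩ := hwU
      rw [h.leftInvOn hζ]
      obtain ⟨ρ, hρ, h1, h2, h3⟩ := hC s ζ hζ
      have := norm_sub_le_harnack_hp h.diff h.inj (fun y hy hyz => hz ⟨y, hy, hyz⟩) hρ h1 h2 h3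
      linarith
    · nlinarith [norm_nonneg (w - z)]

/-- A self-map of the upper half-plane taking `a` to `I`. -/
noncomputable def pushDown (a z : ℂ) : ℂ :=
  ((z.re - a.re * min 1 (z.im / a.im) : ℝ) : ℂ) + (z.im / a.im : ℝ) * Complex.I

/-- The inverse of `pushDown a`. -/
noncomputable def pushUp (a z : ℂ) : ℂ :=
  ((z.re + a.re * min 1 z.im : ℝ) : ℂ) + (z.im * a.im : ℝ) * Complex.I

lemma pushDown_re (a z : ℂ) : (pushDown a z).re = z.re - a.re * min 1 (z.im / a.im) := by
  rw [pushDown, Complex.add_re, Complex.mul_I_re, Complex.ofReal_re, Complex.ofReal_im]; ring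

lemma pushDown_im (a z : ℂ) : (pushDown a z).im = z.im / a.im := by
  rw [pushDown, Complex.add_im, Complex.mul_I_im, Complex.ofReal_re, Complex.ofReal_im]; ring

lemma pushUp_re (a z : ℂ) : (pushUp a z).re = z.re + a.re * min 1 z.im := by
  rw [pushUp, Complex.add_re, Complex.mul_I_re, Complex.ofReal_re, Complex.ofReal_im]; ring

lemma pushUp_im (a z : ℂ) : (pushUp a z).im = z.im * a.im := by
  rw [pushUp, Complex.add_im, Complex.mul_I_im, Complex.ofReal_re, Complex.ofReal_im]; ring

lemma pushUp_pushDown {a : ℂ} (ha : a ∈ hp) (z : ℂ) : pushUp a (pushDown a z) = z := by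
  have : a.im ≠ 0 := ne_of_gt ha
  apply Complex.ext
  · rw [pushUp_re, pushDown_re, pushDown_im]; ring
  · rw [pushUp_im, pushDown_im]; field_simp

lemma pushDown_pushUp {a : ℂ} (ha : a ∈ hp) (z : ℂ) : pushDown a (pushUp a z) = z := by
  have : a.im ≠ 0 := ne_of_gt ha
  apply Complex.ext
  · rw [pushDown_re, pushUp_re, pushUp_im, mul_div_cancel_right₀ _ this]; ring
  · rw [pushDown_im, pushUp_im]; field_simp

lemma pushDown_self {a : ℂ} (ha : a ∈ hp) : pushDown a a = Complex.I := by
  have : a.im ≠ 0 := ne_of_gt ha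
  apply Complex.ext
  · rw [pushDown_re, div_self this]; simp
  · rw [pushDown_im, div_self this]; simp

lemma pushDown_I (z : ℂ) : pushDown Complex.I z = z := by
  apply Complex.ext
  · simp [pushDown_re]
  · simp [pushDown_im]

lemma pushDown_mem {a z : ℂ} (ha : a ∈ hp) (hz : z ∈ hp) : pushDown a z ∈ hp := by
  change 0 < (pushDown a z).im
  rw [pushDown_im]; exact div_pos hz ha

lemma pushUp_mem {a z : ℂ} (ha : a ∈ hp) (hz : z ∈ hp) : pushUp a z ∈ hp := by
  change 0 < (pushUp a z).im
  rw [pushUp_im]; exact mul_pos hz ha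

lemma exists_norm_pushDown_sub_le {a z : ℂ} (ha : a ∈ hp) (hz : z ∈ hp) {B : ℝ} (hB : 1 ≤ B)
    (h1 : |a.re| ≤ B) (h2 : a.im ≤ B) (h3 : 1 / a.im ≤ B) :
    ∃ ρ > 0, ρ ≤ z.im ∧ ρ ≤ (pushDown a z).im ∧ ‖pushDown a z - z‖ ≤ (4 * B ^ 3) * ρ := by
  have ha0 : 0 < a.im := ha
  have hz0 : 0 < z.im := hz
  have hd : z.im / a.im ≤ B * z.im := by
    rw [div_eq_mul_one_div, mul_comm]; exact mul_le_mul_of_nonneg_right h3 hz0.le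
  refine ⟨z.im / B, by positivity, div_le_self hz0.le hB, ?_, ?_⟩
  · rw [pushDown_im]; gcongr
  · have e : 4 * B ^ 3 * (z.im / B) = 4 * B ^ 2 * z.im := by field_simp
    rw [e]
    refine (norm_sub_le_re_im _ _).trans ?_
    rw [pushDown_re, pushDown_im, sub_sub_cancel_left, abs_neg, abs_mul,
      abs_of_pos (a := min 1 (z.im / a.im)) (by positivity)]
    have e1 : |a.re| * min 1 (z.im / a.im) ≤ B * (B * z.im) :=
      mul_le_mul h1 ((min_le_right _ _).trans hd) (by positivity) (by positivity)
    have e2 : |z.im / a.im - z.im| ≤ B * z.im + z.im := by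
      rw [abs_le]; constructor
      · nlinarith [div_pos hz0 ha0]
      · linarith
    nlinarith [mul_le_mul_of_nonneg_right hB hz0.le, mul_nonneg (by linarith : 0 ≤ B) hz0.le]

lemma exists_norm_pushUp_sub_le {a z : ℂ} (ha : a ∈ hp) (hz : z ∈ hp) {B : ℝ} (hB : 1 ≤ B)
    (h1 : |a.re| ≤ B) (h2 : a.im ≤ B) (h3 : 1 / a.im ≤ B) :
    ∃ ρ > 0, ρ ≤ z.im ∧ ρ ≤ (pushUp a z).im ∧ ‖pushUp a z - z‖ ≤ (4 * B ^ 3) * ρ := by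
  have ha0 : 0 < a.im := ha
  have hz0 : 0 < z.im := hz
  refine ⟨z.im / B, by positivity, div_le_self hz0.le hB, ?_, ?_⟩
  · rw [pushUp_im, div_eq_mul_one_div]
    refine mul_le_mul_of_nonneg_left ?_ hz0.le
    rwa [one_div_le (by positivity) ha0]
  · have e : 4 * B ^ 3 * (z.im / B) = 4 * B ^ 2 * z.im := by field_simp
    rw [e]
    refine (norm_sub_le_re_im _ _).trans ?_
    rw [pushUp_re, pushUp_im, add_sub_cancel_left, abs_mul,
      abs_of_pos (a := min 1 z.im) (by positivity)]
    have e1 : |a.re| * min 1 z.im ≤ B * z.im :=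
      mul_le_mul h1 (min_le_right _ _) (by positivity) (by positivity)
    have e2 : |z.im * a.im - z.im| ≤ B * z.im + z.im := by
      have := mul_le_mul_of_nonneg_left h2 hz0.le
      rw [abs_le]; constructor
      · nlinarith [mul_pos hz0 ha0]
      · linarith
    nlinarith [mul_le_mul_of_nonneg_right hB hz0.le, mul_nonneg (by linarith : 0 ≤ B) hz0.le]

lemma exists_bound_of_continuous {α : unitInterval → ℂ} (hα : Continuous α)
    (hαhp : ∀ t, α t ∈ hp) :
    ∃ B ≥ (1 : ℝ), ∀ t, |(α t).re| ≤ B ∧ (α t).im ≤ B ∧ 1 / (α t).im ≤ B := by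
  have hc : Continuous fun t => |(α t).re| + |(α t).im| + |1 / (α t).im| := by
    have h1 : Continuous fun t => (α t).re := Complex.continuous_re.comp hα
    have h2 : Continuous fun t => (α t).im := Complex.continuous_im.comp hα
    exact (h1.abs.add h2.abs).add (continuous_const.div h2 fun t => ne_of_gt (hαhp t)).abs
  obtain ⟨B, hB⟩ := (isCompact_univ.image hc).bddAbove
  refine ⟨max 1 B, le_max_left _ _, fun t => ?_⟩
  have := hB (mem_image_of_mem _ (mem_univ t))
  have h3 := le_max_right 1 B
  refine ⟨?_, ?_, ?_⟩ <;> linarith [abs_nonneg (α t).re, abs_nonneg (α t).im,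
    abs_nonneg (1 / (α t).im), le_abs_self (α t).im, le_abs_self (1 / (α t).im)]

/-- A loop of homeomorphisms supported in the image of a chart pushing a given path to the base
point. -/
lemma ComplementChart.exists_push (h : ComplementChart F φ) {α : unitInterval → ℂ}
    (hα : Continuous α) (hαhp : ∀ t, α t ∈ hp) :
    ∃ K : unitInterval → ℂ ≃ₜ ℂ, (Continuous fun q : ℂ × unitInterval => K q.2 q.1) ∧
      (Continuous fun q : ℂ × unitInterval => (K q.2).symm q.1) ∧
      (∀ t, ∀ z ∉ φ '' hp, K t z = z) ∧ (∀ t, K t (φ (α t)) = φ Complex.I) ∧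
      ∀ t, α t = Complex.I → K t = Homeomorph.refl ℂ := by
  classical
  obtain ⟨B, hB, hb⟩ := exists_bound_of_continuous hα hαhp
  have hα1 : Continuous fun q : ℂ × unitInterval => (α q.2).re :=
    Complex.continuous_re.comp (hα.comp continuous_snd)
  have hα2 : Continuous fun q : ℂ × unitInterval => (α q.2).im :=
    Complex.continuous_im.comp (hα.comp continuous_snd)
  have hz1 : Continuous fun q : ℂ × unitInterval => q.1.re :=
    Complex.continuous_re.comp continuous_fst
  have hz2 : Continuous fun q : ℂ × unitInterval => q.1.im :=
    Complex.continuous_im.comp continuous_fst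
  have hq := hz2.div hα2 fun q => ne_of_gt (hαhp q.2)
  have hc := h.continuous_extend (M := fun t => pushDown (α t))
    (Continuous.continuousOn ((Complex.continuous_ofReal.comp
      (hz1.sub (hα1.mul (continuous_const.min hq)))).add
      ((Complex.continuous_ofReal.comp hq).mul continuous_const)))
    (fun t z hz => pushDown_mem (hαhp t) hz)
    (fun t z hz => exists_norm_pushDown_sub_le (hαhp t) hz hB (hb t).1 (hb t).2.1 (hb t).2.2)
  have hc' := h.continuous_extend (M := fun t => pushUp (α t))
    (Continuous.continuousOn ((Complex.continuous_ofReal.comp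
      (hz1.add (hα1.mul (continuous_const.min hz2)))).add
      ((Complex.continuous_ofReal.comp (hz2.mul hα2)).mul continuous_const)))
    (fun t z hz => pushUp_mem (hαhp t) hz)
    (fun t z hz => exists_norm_pushUp_sub_le (hαhp t) hz hB (hb t).1 (hb t).2.1 (hb t).2.2)
  have hinv : ∀ M N : ℂ → ℂ, MapsTo M hp hp → (∀ z, N (M z) = z) → ∀ z : ℂ,
      (if (if z ∈ φ '' hp then φ (M (Function.invFunOn φ hp z)) else z) ∈ φ '' hp then
        φ (N (Function.invFunOn φ hp
          (if z ∈ φ '' hp then φ (M (Function.invFunOn φ hp z)) else z)))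
      else (if z ∈ φ '' hp then φ (M (Function.invFunOn φ hp z)) else z)) = z := by
    intro M N hM hNM z
    by_cases hz : z ∈ φ '' hp
    · obtain ⟨ζ, hζ, rfl⟩ := hz
      rw [if_pos (mem_image_of_mem _ hζ), h.leftInvOn hζ, if_pos (mem_image_of_mem _ (hM hζ)),
        h.leftInvOn (hM hζ), hNM]
    · rw [if_neg hz, if_neg hz]
  refine ⟨fun t =>
    { toFun := fun z => if z ∈ φ '' hp then φ (pushDown (α t) (Function.invFunOn φ hp z)) else z
      invFun := fun z => if z ∈ φ '' hp then φ (pushUp (α t) (Function.invFunOn φ hp z)) else z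
      left_inv := hinv _ _ (fun z hz => pushDown_mem (hαhp t) hz) (pushUp_pushDown (hαhp t))
      right_inv := hinv _ _ (fun z hz => pushUp_mem (hαhp t) hz) (pushDown_pushUp (hαhp t))
      continuous_toFun := hc.comp (continuous_id.prodMk continuous_const)
      continuous_invFun := hc'.comp (continuous_id.prodMk continuous_const) }, hc, hc',
    fun t z hz => if_neg hz, fun t => ?_, fun t ht => ?_⟩
  · change (if φ (α t) ∈ φ '' hp then _ else _) = _
    rw [if_pos (mem_image_of_mem _ (hαhp t)), h.leftInvOn (hαhp t), pushDown_self (hαhp t)]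
  · ext z
    change (if z ∈ φ '' hp then _ else z) = z
    split_ifs with hz
    · rw [ht, pushDown_I, Function.invFunOn_eq hz]
    · rfl

/-- An isotopy relative to `F` can be made relative to an additional fixed point. -/
lemma IsotopicToIdRel.insert_fixedPoint (hf : IsotopicToIdRel ℂ f F) (hF : IsClosed F)
    (hFne : F.Nonempty) (hFc : NoBddClopen F) {c : ℂ} (hc : f c = c) :
    IsotopicToIdRel ℂ f (insert c F) := by
  by_cases hcF : c ∈ F
  · rwa [insert_eq_of_mem hcF]
  obtain ⟨H, h1, h2, h3, h4, h5⟩ := hf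
  obtain ⟨φ, hφ, himg, hφc⟩ := ComplementChart.exists hF hFne hFc hcF
  have hpath : Continuous fun t => H t c := h1.comp (continuous_const.prodMk continuous_id)
  have hmem : ∀ t, H t c ∈ φ '' hp := by
    intro t
    refine hφ.subset_of_isPreconnected (isPreconnected_range hpath) ?_ (ζ := Complex.I)
      (by simp [hp]) ⟨0, by simp [h3, hφc]⟩ ⟨t, rfl⟩
    rintro _ ⟨s, rfl⟩
    exact not_mem_of_apply_mem (h5 s) hcF
  have hα : Continuous fun t => Function.invFunOn φ hp (H t c) :=
    hφ.continuousOn_inv.comp_continuous hpath hmem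
  obtain ⟨K, k1, k2, k3, k4, k5⟩ := hφ.exists_push hα fun t => Function.invFunOn_mem (hmem t)
  have hαI : ∀ t, H t c = c → K t = Homeomorph.refl ℂ := fun t ht => k5 t (by
    rw [ht, ← hφc, hφ.leftInvOn (by simp [hp])])
  refine ⟨fun t => (H t).trans (K t), k1.comp (h1.prodMk continuous_snd),
    h2.comp (k2.prodMk continuous_snd), ?_, ?_, fun t x hx => ?_⟩
  · simp only [hαI 0 (by simp [h3]), h3]; rfl
  · simp only [hαI 1 (by simp [h4, hc]), h4]; rfl
  · rw [Homeomorph.trans_apply]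
    rcases hx with rfl | hx
    · have := k4 t
      rwa [Function.invFunOn_eq (hmem t), hφc] at this
    · rw [h5 t x hx, k3 t x]
      rintro ⟨ζ, hζ, rfl⟩
      exact hφ.notMem ζ hζ hx

end Push

section BoundaryExtension

variable {φ g : ℂ → ℂ} {f : ℂ ≃ₜ ℂ}

/-- The image by a Riemann map normalised at a boundary point. -/
lemma univalent_comp_cayley (hd : DifferentiableOn ℂ φ (ball 0 1)) (hi : InjOn φ (ball 0 1))
    {u : ℂ} (hu : ‖u‖ = 1) :
    DifferentiableOn ℂ (fun z => φ (cayley u z)) hp ∧ InjOn (fun z => φ (cayley u z)) hp := by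
  have hu0 : u ≠ 0 := by rintro rfl; simp at hu
  have hm : MapsTo (cayley u) hp (ball 0 1) := by
    rw [← image_cayley_hp hu]; exact mapsTo_image _ _
  exact ⟨hd.comp (differentiableOn_cayley_hp u) hm, hi.comp (injOn_cayley_hp hu0) hm⟩

lemma continuousAt_cayleyInv_self {v : ℂ} (hv : ‖v‖ = 1) : ContinuousAt (cayleyInv v) v := by
  have hv0 : v ≠ 0 := by rintro rfl; simp at hv
  unfold cayleyInv
  exact ContinuousAt.div (by fun_prop) (by fun_prop) (by
    intro h
    exact hv0 (by linear_combination (1/2 : ℂ) * h))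

lemma cayleyInv_self (v : ℂ) : cayleyInv v v = 0 := by simp [cayleyInv]

lemma continuousOn_cayleyInv {v : ℂ} (hv : ‖v‖ = 1) : ContinuousOn (cayleyInv v) (ball 0 1) := by
  unfold cayleyInv
  exact ContinuousOn.div (by fun_prop) (by fun_prop) fun w hw =>
    ne_zero_of_norm_eq_one_of_norm_lt hv (mem_ball_zero_iff.1 hw)

lemma cayley_zero (v : ℂ) : cayley v 0 = v := by
  simp [cayley]

lemma continuousAt_cayley_zero (v : ℂ) : ContinuousAt (cayley v) 0 := by
  unfold cayley
  exact ContinuousAt.div (by fun_prop) (by fun_prop) (by simp)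

/-- A homeomorphism of the unit disc obtained by composing a Riemann map with a homeomorphism of
the plane has a limit at each boundary point. -/
lemma exists_tendsto_boundary (hd : DifferentiableOn ℂ φ (ball 0 1)) (hi : InjOn φ (ball 0 1))
    (hgc : ContinuousOn g (ball 0 1)) (hgm : MapsTo g (ball 0 1) (ball 0 1))
    (hφg : ∀ z ∈ ball 0 1, φ (g z) = f z) (himg : φ '' ball 0 1 = f '' ball 0 1)
    {u : ℂ} (hu : ‖u‖ = 1) : ∃ v, ‖v‖ = 1 ∧ Tendsto g (𝓝[ball 0 1] u) (𝓝 v) := by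
  have hucl : u ∈ closure (ball (0 : ℂ) 1) := by
    rw [closure_ball _ one_ne_zero, mem_closedBall_zero_iff, hu]
  have : (𝓝[ball 0 1] u).NeBot := mem_closure_iff_nhdsWithin_neBot.1 hucl
  have hmem : ∀ᶠ z in 𝓝[ball 0 1] u, z ∈ ball (0 : ℂ) 1 := self_mem_nhdsWithin
  obtain ⟨v, hvb, hv⟩ := (isCompact_closedBall (0 : ℂ) 1).exists_mapClusterPt_of_frequently
    (f := g) (l := 𝓝[ball 0 1] u)
    (hmem.mono fun z hz => ball_subset_closedBall (hgm hz)).frequently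
  have hfu : f u ∉ f '' ball 0 1 := by
    rintro ⟨z, hz, hzu⟩
    rw [f.injective hzu, mem_ball_zero_iff, hu] at hz
    exact hz.ne rfl
  have hft : Tendsto f (𝓝[ball 0 1] u) (𝓝 (f u)) :=
    (f.continuous.tendsto u).mono_left nhdsWithin_le_nhds
  have hv1 : ‖v‖ = 1 := by
    refine le_antisymm (mem_closedBall_zero_iff.1 hvb) (not_lt.1 fun hlt => hfu ?_)
    have hvD : v ∈ ball (0 : ℂ) 1 := mem_ball_zero_iff.2 hlt
    have h1 : MapClusterPt (φ v) (𝓝[ball 0 1] u) (φ ∘ g) :=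
      hv.continuousAt_comp ((hd v hvD).differentiableAt (isOpen_ball.mem_nhds hvD)).continuousAt
    have h2 : Tendsto (φ ∘ g) (𝓝[ball 0 1] u) (𝓝 (f u)) :=
      hft.congr' (hmem.mono fun z hz => (hφg z hz).symm)
    have h3 : φ v = f u := by
      have hne : (𝓝 (φ v) ⊓ map (φ ∘ g) (𝓝[ball 0 1] u)).NeBot := h1
      have : (𝓝 (φ v) ⊓ 𝓝 (f u)).NeBot := hne.mono (inf_le_inf_left _ h2)
      exact eq_of_nhds_neBot this
    rw [← h3, ← himg]
    exact mem_image_of_mem _ hvD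
  refine ⟨v, hv1, ?_⟩
  have hv0 : v ≠ 0 := by rintro rfl; simp at hv1
  obtain ⟨hd', hi'⟩ := univalent_comp_cayley hd hi hv1
  have hinv : ∀ w ∈ ball (0 : ℂ) 1, cayley v (cayleyInv v w) = w := fun w hw =>
    cayley_cayleyInv hv0 (ne_zero_of_norm_eq_one_of_norm_lt hv1 (mem_ball_zero_iff.1 hw))
  have hφp : ∀ z ∈ hp, φ (cayley v z) ≠ f u := fun z hz h => hfu (by
    rw [← h, ← himg]
    refine mem_image_of_mem _ ?_
    rw [← image_cayley_hp hv1]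
    exact mem_image_of_mem _ hz)
  have key : Tendsto (fun z => cayleyInv v (g z)) (𝓝[ball 0 1] u) (𝓝 0) := by
    refine Metric.tendsto_nhds.2 fun ε hε => ?_
    set a := ε / Real.exp 80 with ha
    have ha0 : 0 < a := by positivity
    obtain ⟨s, hs, hcross⟩ := exists_lt_norm_of_crossing hd' hi' hφp 0 ha0
    have h1 : ∀ᶠ z in 𝓝 u, f z ∈ ball (f u) s := f.continuous.continuousAt (ball_mem_nhds _ hs)
    obtain ⟨δ, hδ, hball⟩ := Metric.eventually_nhds_iff_ball.1 h1
    have hN : ball (0 : ℂ) 1 ∩ ball u δ ∈ 𝓝[ball 0 1] u :=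
      inter_mem_nhdsWithin _ (ball_mem_nhds _ hδ)
    have hnh : cayleyInv v ⁻¹' ball 0 a ∈ 𝓝 v :=
      (continuousAt_cayleyInv_self hv1).preimage_mem_nhds (by
        rw [cayleyInv_self]; exact ball_mem_nhds _ ha0)
    have hfr : ∃ᶠ z in 𝓝[ball 0 1] u, cayleyInv v (g z) ∈ ball (0 : ℂ) a :=
      (mapClusterPt_iff_frequently.1 hv) _ hnh
    obtain ⟨z₀, hz₀, hz₀N⟩ := (hfr.and_eventually hN).exists
    filter_upwards [hN] with w hw
    rw [dist_zero_right]
    by_contra! hcon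
    obtain ⟨y, ⟨z, hz, rfl⟩, hy⟩ := hcross
      ((fun z => cayleyInv v (g z)) '' (ball (0 : ℂ) 1 ∩ ball u δ))
      (((convex_ball _ _).inter (convex_ball _ _)).isPreconnected.image _
        (((continuousOn_cayleyInv hv1).comp hgc hgm).mono inter_subset_left))
      (by
        rintro _ ⟨z, hz, rfl⟩
        exact cayleyInv_mem_hp hv1 (mem_ball_zero_iff.1 (hgm hz.1)))
      _ (mem_image_of_mem _ hz₀N) _ (mem_image_of_mem _ hw)
      (by simpa using (mem_ball_zero_iff.1 hz₀).le)
      (by rw [ha, mul_div_cancel₀ _ (Real.exp_ne_zero _)]; simpa using hcon)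
    simp only [hinv _ (hgm hz.1), hφg z hz.1] at hy
    have := hball z hz.2
    rw [mem_ball, dist_eq_norm] at this
    exact this.not_gt hy
  have h4 : Tendsto (fun z => cayley v (cayleyInv v (g z))) (𝓝[ball 0 1] u) (𝓝 v) := by
    have := (continuousAt_cayley_zero v).tendsto.comp key
    rwa [cayley_zero] at this
  exact h4.congr' (hmem.mono fun z hz => hinv _ (hgm hz))

lemma exists_halfCircle_of_tendsto (hd : DifferentiableOn ℂ φ (ball 0 1))
    (hi : InjOn φ (ball 0 1))
    (hgc : ContinuousOn g (ball 0 1)) (hgm : MapsTo g (ball 0 1) (ball 0 1))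
    (hφg : ∀ z ∈ ball 0 1, φ (g z) = f z) {u v : ℂ} (hu : ‖u‖ = 1) (hv1 : ‖v‖ = 1)
    (hv : Tendsto g (𝓝[ball 0 1] u) (𝓝 v)) {s : ℝ} (hs : 0 < s) :
    ∃ a₀ > 0, ∀ a, 0 < a → a ≤ a₀ → ∃ r ∈ Icc a (Real.exp 80 * a),
      ‖φ (cayley v (r * Complex.I)) - f u‖ ≤ 2 * s := by
  have hucl : u ∈ closure (ball (0 : ℂ) 1) := by
    rw [closure_ball _ one_ne_zero, mem_closedBall_zero_iff, hu]
  have : (𝓝[ball 0 1] u).NeBot := mem_closure_iff_nhdsWithin_neBot.1 hucl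
  have hv0 : v ≠ 0 := by rintro rfl; simp at hv1
  obtain ⟨hd', hi'⟩ := univalent_comp_cayley hd hi hv1
  have h1 : ∀ᶠ z in 𝓝 u, f z ∈ ball (f u) s := f.continuous.continuousAt (ball_mem_nhds _ hs)
  obtain ⟨δ, hδ, hball⟩ := Metric.eventually_nhds_iff_ball.1 h1
  have hN : ball (0 : ℂ) 1 ∩ ball u δ ∈ 𝓝[ball 0 1] u :=
    inter_mem_nhdsWithin _ (ball_mem_nhds _ hδ)
  obtain ⟨w, hw⟩ := Filter.nonempty_of_mem hN
  have hmem : ∀ z ∈ ball (0 : ℂ) 1, cayleyInv v (g z) ∈ hp := fun z hz =>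
    cayleyInv_mem_hp hv1 (mem_ball_zero_iff.1 (hgm hz))
  have hw0 : 0 < ‖cayleyInv v (g w)‖ := by
    rw [norm_pos_iff]
    intro h
    have := hmem w hw.1
    rw [h] at this
    simp [hp] at this
  refine ⟨‖cayleyInv v (g w)‖ / Real.exp 80, by positivity, fun a ha haw => ?_⟩
  have hlim : Tendsto (fun z => cayleyInv v (g z)) (𝓝[ball 0 1] u) (𝓝 0) := by
    have := (continuousAt_cayleyInv_self hv1).tendsto.comp hv
    rwa [cayleyInv_self] at this
  obtain ⟨z₀, hz₀, hz₀N⟩ := ((hlim.eventually (ball_mem_nhds _ ha)).and hN).exists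
  obtain ⟨r, hr, h⟩ := exists_halfCircle_of_crossing hd' hi' (p := f u) (x := 0) ha hs
    (Γ := (fun z => cayleyInv v (g z)) '' (ball (0 : ℂ) 1 ∩ ball u δ))
    (((convex_ball _ _).inter (convex_ball _ _)).isPreconnected.image _
      (((continuousOn_cayleyInv hv1).comp hgc hgm).mono inter_subset_left))
    (by
      rintro _ ⟨z, hz, rfl⟩
      exact hmem z hz.1)
    (mem_image_of_mem _ hz₀N) (mem_image_of_mem _ hw)
    (by simpa using (mem_ball_zero_iff.1 hz₀).le)
    (by rw [le_div_iff₀ (Real.exp_pos _)] at haw; simpa [mul_comm] using haw)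
    (by
      rintro _ ⟨z, hz, rfl⟩
      simp only
      rw [cayley_cayleyInv hv0
        (ne_zero_of_norm_eq_one_of_norm_lt hv1 (mem_ball_zero_iff.1 (hgm hz.1))),
        hφg z hz.1, ← dist_eq_norm]
      exact (mem_ball.1 (hball z hz.2)).le)
  have hr0 : 0 < r := ha.trans_le hr.1
  exact ⟨r, hr, h _ (by simp [hp, hr0]) (by simp [abs_of_pos hr0])⟩

/-- The boundary values of a homeomorphism of the disc as above are pairwise distinct. -/
lemma eq_of_tendsto_boundary (hd : DifferentiableOn ℂ φ (ball 0 1)) (hi : InjOn φ (ball 0 1))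
    (hgc : ContinuousOn g (ball 0 1)) (hgm : MapsTo g (ball 0 1) (ball 0 1))
    (hφg : ∀ z ∈ ball 0 1, φ (g z) = f z) (himg : φ '' ball 0 1 = f '' ball 0 1)
    {u u' v : ℂ} (hu : ‖u‖ = 1) (hu' : ‖u'‖ = 1) (hv1 : ‖v‖ = 1)
    (hv : Tendsto g (𝓝[ball 0 1] u) (𝓝 v)) (hv' : Tendsto g (𝓝[ball 0 1] u') (𝓝 v)) :
    u = u' := by
  by_contra hne
  set A := harnackConst (Real.exp 80)
  have hA : 1 ≤ A := one_le_harnackConst _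
  have hd0 : 0 < ‖f u - f u'‖ := norm_pos_iff.2 (sub_ne_zero.2 (f.injective.ne hne))
  set s := ‖f u - f u'‖ / (8 * A) with hs
  have hs0 : 0 < s := by positivity
  obtain ⟨a₁, ha₁, h₁⟩ := exists_halfCircle_of_tendsto hd hi hgc hgm hφg hu hv1 hv hs0
  obtain ⟨a₂, ha₂, h₂⟩ := exists_halfCircle_of_tendsto hd hi hgc hgm hφg hu' hv1 hv' hs0
  have ha : 0 < min a₁ a₂ := lt_min ha₁ ha₂
  obtain ⟨r₁, hr₁, b₁⟩ := h₁ _ ha (min_le_left _ _)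
  obtain ⟨r₂, hr₂, b₂⟩ := h₂ _ ha (min_le_right _ _)
  obtain ⟨hd', hi'⟩ := univalent_comp_cayley hd hi hv1
  have hφp : ∀ z ∈ hp, φ (cayley v z) ≠ f u := fun z hz h => by
    have : f u ∈ f '' ball 0 1 := by
      rw [← h, ← himg, ← image_cayley_hp hv1]
      exact mem_image_of_mem _ (mem_image_of_mem _ hz)
    obtain ⟨z, hz, hzu⟩ := this
    rw [f.injective hzu, mem_ball_zero_iff, hu] at hz
    exact hz.ne rfl
  have h3 := norm_sub_le_harnack_hp hd' hi' hφp (ζ := r₁ * Complex.I) (η := r₂ * Complex.I)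
    (M := Real.exp 80) ha (by simpa using hr₁.1) (by simpa using hr₂.1) (by
      rw [← sub_mul, norm_mul, Complex.norm_I, mul_one, ← Complex.ofReal_sub, Complex.norm_real,
        Real.norm_eq_abs, abs_le]
      constructor <;> linarith [hr₁.1, hr₁.2, hr₂.1, hr₂.2])
  have h4 : ‖φ (cayley v (r₂ * Complex.I)) - f u‖ ≤ A * (2 * s) :=
    h3.trans (mul_le_mul_of_nonneg_left b₁ (by positivity))
  have h5 : ‖f u - f u'‖ = 8 * A * s := by rw [hs]; field_simp
  have h6 : ‖f u - f u'‖ ≤ A * (2 * s) + 2 * s := by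
    calc ‖f u - f u'‖ = ‖(φ (cayley v (r₂ * Complex.I)) - f u') -
          (φ (cayley v (r₂ * Complex.I)) - f u)‖ := by congr 1; ring
      _ ≤ _ := (norm_sub_le _ _).trans (by linarith)
  nlinarith [mul_le_mul_of_nonneg_right hA hs0.le]

end BoundaryExtension

section ConeExtension

/-- A proper continuous bijection of the plane is a homeomorphism. -/
lemma exists_homeomorph_of_norm_le {G : ℂ → ℂ} (hc : Continuous G) (hb : Function.Bijective G)
    (hn : ∀ z, ‖z‖ ≤ max 1 ‖G z‖) : ∃ e : ℂ ≃ₜ ℂ, ∀ z, e z = G z := by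
  have ht : Tendsto G (cocompact ℂ) (cocompact ℂ) := by
    rw [← Metric.cobounded_eq_cocompact, ← tendsto_norm_atTop_iff_cobounded]
    refine tendsto_atTop.2 fun b => ?_
    filter_upwards [tendsto_norm_cobounded_atTop.eventually_gt_atTop (max 1 b)] with z hz
    rcases le_max_iff.1 (hn z) with h | h
    · exact absurd (hz.trans_le h) (not_lt.2 (le_max_left _ _))
    · exact (le_max_right 1 b).trans (hz.le.trans h)
  have hp : IsProperMap G := isProperMap_iff_tendsto_cocompact.2 ⟨hc, ht⟩
  exact ⟨(Equiv.ofBijective G hb).toHomeomorphOfContinuousClosed hc hp.isClosedMap, fun _ => rfl⟩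

/-- The cone over a map of the unit circle. -/
noncomputable def cone (β : ℂ → ℂ) (z : ℂ) : ℂ := ‖z‖ * β (z / ‖z‖)

variable {β : ℂ → ℂ}

lemma norm_div_norm_self {z : ℂ} (hz : z ≠ 0) : ‖z / (‖z‖ : ℂ)‖ = 1 := by
  rw [norm_div, Complex.norm_real, norm_norm, div_self (norm_ne_zero_iff.2 hz)]

lemma norm_cone (hβ : ∀ u, ‖u‖ = 1 → ‖β u‖ = 1) (z : ℂ) : ‖cone β z‖ = ‖z‖ := by
  rcases eq_or_ne z 0 with rfl | hz
  · simp [cone]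
  · rw [cone, norm_mul, hβ _ (norm_div_norm_self hz), mul_one, Complex.norm_real, norm_norm]

lemma continuousOn_div_norm {X : Type*} [TopologicalSpace X] {k : X → ℂ} {s : Set X}
    (hk : ContinuousOn k s) (h0 : ∀ x ∈ s, k x ≠ 0) :
    ContinuousOn (fun x => k x / (‖k x‖ : ℂ)) s :=
  hk.div (Complex.continuous_ofReal.comp_continuousOn hk.norm) fun x hx => by
    simpa using h0 x hx

lemma continuous_of_continuousOn_of_norm_le {G : ℂ → ℂ} (hG : ContinuousOn G {0}ᶜ)
    (hn : ∀ z, ‖G z‖ ≤ ‖z‖) : Continuous G := by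
  rw [continuous_iff_continuousAt]
  intro z
  rcases eq_or_ne z 0 with rfl | hz
  · have h0 : G 0 = 0 := by simpa using hn 0
    rw [ContinuousAt, h0]
    exact squeeze_zero_norm hn (by simpa using (continuous_norm (E := ℂ)).tendsto 0)
  · exact hG.continuousAt (isOpen_compl_singleton.mem_nhds hz)

lemma continuous_cone (hc : ContinuousOn β (sphere 0 1)) (hβ : ∀ u, ‖u‖ = 1 → ‖β u‖ = 1) :
    Continuous (cone β) := by
  refine continuous_of_continuousOn_of_norm_le ?_ fun z => (norm_cone hβ z).le
  refine ContinuousOn.mul (by fun_prop) (hc.comp (continuousOn_div_norm continuousOn_id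
    fun x hx => hx) fun z hz => ?_)
  exact mem_sphere_zero_iff_norm.2 (norm_div_norm_self hz)

lemma cone_ofReal_mul {t : ℝ} (ht : 0 < t) (z : ℂ) : cone β (t * z) = t * cone β z := by
  rw [cone, cone, norm_mul, Complex.norm_real, Real.norm_of_nonneg ht.le, Complex.ofReal_mul,
    mul_div_mul_left _ _ (by exact_mod_cast ht.ne' : (t : ℂ) ≠ 0), mul_assoc]

lemma cone_of_norm_eq_one {z : ℂ} (hz : ‖z‖ = 1) : cone β z = β z := by simp [cone, hz]

lemma bijective_cone (hβ : BijOn β (sphere 0 1) (sphere 0 1)) : Function.Bijective (cone β) := by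
  have hβ1 : ∀ u, ‖u‖ = 1 → ‖β u‖ = 1 := fun u hu =>
    mem_sphere_zero_iff_norm.1 (hβ.mapsTo (mem_sphere_zero_iff_norm.2 hu))
  constructor
  · intro z w h
    have hn : ‖z‖ = ‖w‖ := by rw [← norm_cone hβ1 z, h, norm_cone hβ1]
    rcases eq_or_ne z 0 with rfl | hz
    · rw [norm_zero] at hn; exact (norm_eq_zero.1 hn.symm).symm
    have hw : w ≠ 0 := by rintro rfl; exact hz (by simpa using hn)
    have hw' : (‖w‖ : ℂ) ≠ 0 := by simpa using hw
    rw [cone, cone, hn] at h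
    have := hβ.injOn (by rw [← hn]; exact mem_sphere_zero_iff_norm.2 (norm_div_norm_self hz))
      (mem_sphere_zero_iff_norm.2 (norm_div_norm_self hw)) (mul_left_cancel₀ hw' h)
    exact (div_left_inj' hw').1 this
  · intro w
    rcases eq_or_ne w 0 with rfl | hw
    · exact ⟨0, by simp [cone]⟩
    obtain ⟨u, hu, huw⟩ := hβ.surjOn (mem_sphere_zero_iff_norm.2 (norm_div_norm_self hw))
    refine ⟨‖w‖ * u, ?_⟩
    rw [cone_ofReal_mul (norm_pos_iff.2 hw), cone_of_norm_eq_one (mem_sphere_zero_iff_norm.1 hu),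
      huw, mul_div_cancel₀ _ (by simpa using hw)]

/-- A homeomorphism of the closed unit disc extends radially to the plane. -/
lemma exists_homeomorph_cone_extension {g : ℂ → ℂ} (hc : ContinuousOn g (closedBall 0 1))
    (hb : BijOn g (ball 0 1) (ball 0 1)) (hs : BijOn g (sphere 0 1) (sphere 0 1)) :
    ∃ G : ℂ ≃ₜ ℂ, (∀ z, ‖z‖ ≤ 1 → G z = g z) ∧ ∀ z, 1 ≤ ‖z‖ → G z = cone g z := by
  have hg1 : ∀ u, ‖u‖ = 1 → ‖g u‖ = 1 := fun u hu =>
    mem_sphere_zero_iff_norm.1 (hs.mapsTo (mem_sphere_zero_iff_norm.2 hu))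
  have hcone := bijective_cone hs
  set G : ℂ → ℂ := fun z => if ‖z‖ ≤ 1 then g z else cone g z with hG
  have hGc : Continuous G := by
    refine continuous_if_le continuous_norm continuous_const ?_ ?_ ?_
    · exact hc.mono fun z hz => mem_closedBall_zero_iff.2 hz
    · exact (continuous_cone (hc.mono sphere_subset_closedBall) hg1).continuousOn
    · intro z hz
      exact (cone_of_norm_eq_one hz).symm
  have hlt : ∀ z, ‖z‖ < 1 → G z = g z := fun z hz => if_pos hz.le
  have hle : ∀ z, ‖z‖ ≤ 1 → G z = g z := fun z hz => if_pos hz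
  have hge : ∀ z, 1 ≤ ‖z‖ → G z = cone g z := fun z hz => by
    rcases hz.eq_or_lt with h | h
    · rw [hle z h.ge, cone_of_norm_eq_one h.symm]
    · exact if_neg h.not_ge
  have hball : ∀ z, ‖z‖ < 1 → ‖G z‖ < 1 := fun z hz => by
    rw [hlt z hz]; exact mem_ball_zero_iff.1 (hb.mapsTo (mem_ball_zero_iff.2 hz))
  have hout : ∀ z, 1 ≤ ‖z‖ → ‖G z‖ = ‖z‖ := fun z hz => by rw [hge z hz, norm_cone hg1]
  have hbij : Function.Bijective G := by
    constructor
    · intro z w h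
      rcases lt_or_ge ‖z‖ 1 with hz | hz <;> rcases lt_or_ge ‖w‖ 1 with hw | hw
      · rw [hlt z hz, hlt w hw] at h
        exact hb.injOn (mem_ball_zero_iff.2 hz) (mem_ball_zero_iff.2 hw) h
      · have := hball z hz
        rw [h, hout w hw] at this
        linarith
      · have := hball w hw
        rw [← h, hout z hz] at this
        linarith
      · rw [hge z hz, hge w hw] at h
        exact hcone.1 h
    · intro w
      rcases lt_or_ge ‖w‖ 1 with hw | hw
      · obtain ⟨z, hz, hzw⟩ := hb.surjOn (mem_ball_zero_iff.2 hw)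
        exact ⟨z, by rw [hlt z (mem_ball_zero_iff.1 hz), hzw]⟩
      · obtain ⟨z, hz⟩ := hcone.2 w
        refine ⟨z, ?_⟩
        rw [hge z (by rwa [← norm_cone hg1 z, hz]), hz]
  obtain ⟨e, he⟩ := exists_homeomorph_of_norm_le hGc hbij fun z => by
    rcases le_total ‖z‖ 1 with hz | hz
    · exact hz.trans (le_max_left _ _)
    · rw [hout z hz]; exact le_max_right _ _
  exact ⟨e, fun z hz => by rw [he, hle z hz], fun z hz => by rw [he, hge z hz]⟩

/-- A homeomorphism of the plane fixing `0` factors through one that is holomorphic near `0` and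
one that is conical at infinity. -/
lemma exists_conformal_factorization (f : ℂ ≃ₜ ℂ) (hf0 : f 0 = 0) :
    ∃ (G f₂ : ℂ ≃ₜ ℂ) (β : ℂ → ℂ), (∀ z, f z = f₂ (G z)) ∧ G 0 = 0 ∧ f₂ 0 = 0 ∧
      DifferentiableOn ℂ f₂ (ball 0 1) ∧ ContinuousOn β (sphere 0 1) ∧
      BijOn β (sphere 0 1) (sphere 0 1) ∧ (∀ z, 1 ≤ ‖z‖ → G z = cone β z) := by
  have hVo : IsOpen (f '' ball 0 1) := f.isOpenMap _ isOpen_ball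
  have hVp : IsPreconnected (f '' ball 0 1) :=
    (convex_ball 0 1).isPreconnected.image _ f.continuous.continuousOn
  have hVne : f '' ball 0 1 ≠ univ := by
    intro h
    obtain ⟨z, hz, hz1⟩ : f 1 ∈ f '' ball 0 1 := h ▸ mem_univ _
    rw [f.injective hz1] at hz
    simp at hz
  obtain ⟨φ, hd, hi, himg, hφ0⟩ := exists_riemannMap hVo hVp
    ⟨0, mem_ball_self one_pos, hf0⟩ hVne (hasUnivalentSqrt_image_ball f 0 one_pos)
  set ψ := Function.invFunOn φ (ball 0 1) with hψ
  have hψl : LeftInvOn ψ φ (ball 0 1) := hi.leftInvOn_invFunOn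
  have hψc : ContinuousOn ψ (f '' ball 0 1) := by
    rw [← himg]
    exact (differentiableOn_leftInvOn isOpen_ball hd hψl).continuousOn
  have hmem : ∀ z ∈ ball (0 : ℂ) 1, f z ∈ φ '' ball 0 1 := fun z hz => by
    rw [himg]; exact mem_image_of_mem _ hz
  set g := fun z => ψ (f z) with hg
  have hgc : ContinuousOn g (ball 0 1) :=
    hψc.comp f.continuous.continuousOn (mapsTo_image _ _)
  have hgm : MapsTo g (ball 0 1) (ball 0 1) := fun z hz => Function.invFunOn_mem (hmem z hz)
  have hφg : ∀ z ∈ ball 0 1, φ (g z) = f z := fun z hz => Function.invFunOn_eq (hmem z hz)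
  have hgb : BijOn g (ball 0 1) (ball 0 1) := by
    refine ⟨hgm, fun z hz w hw h => ?_, fun w hw => ?_⟩
    · refine f.injective ?_
      rw [← hφg z hz, ← hφg w hw, h]
    · obtain ⟨z, hz, hzw⟩ : φ w ∈ f '' ball 0 1 := himg ▸ mem_image_of_mem _ hw
      refine ⟨z, hz, hi (hgm hz) hw ?_⟩
      rw [hφg z hz, hzw]
  have hbd : ∀ u : ℂ, ‖u‖ = 1 → ∃ v, ‖v‖ = 1 ∧ Tendsto g (𝓝[ball 0 1] u) (𝓝 v) := fun u hu =>
    exists_tendsto_boundary hd hi hgc hgm hφg himg hu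
  have hcl : closure (ball (0 : ℂ) 1) = closedBall 0 1 := closure_ball _ one_ne_zero
  have hextc : ContinuousOn (extendFrom (ball 0 1) g) (closedBall 0 1) := by
    refine continuousOn_extendFrom hcl.ge fun z hz => ?_
    rcases (mem_closedBall_zero_iff.1 hz).lt_or_eq with h | h
    · exact ⟨g z, hgc z (mem_ball_zero_iff.2 h)⟩
    · obtain ⟨v, -, hv⟩ := hbd z h
      exact ⟨v, hv⟩
  have hext : EqOn (extendFrom (ball 0 1) g) g (ball 0 1) := fun z hz =>
    extendFrom_eq (subset_closure hz) (hgc z hz)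
  have hexts : ∀ u : ℂ, ‖u‖ = 1 → ‖extendFrom (ball 0 1) g u‖ = 1 ∧
      Tendsto g (𝓝[ball 0 1] u) (𝓝 (extendFrom (ball 0 1) g u)) := by
    intro u hu
    obtain ⟨v, hv1, hv⟩ := hbd u hu
    have hucl : u ∈ closure (ball (0 : ℂ) 1) := by rw [hcl, mem_closedBall_zero_iff, hu]
    rw [extendFrom_eq hucl hv]
    exact ⟨hv1, hv⟩
  set ĝ := extendFrom (ball 0 1) g with hĝ
  have hĝb : BijOn ĝ (ball 0 1) (ball 0 1) := hgb.congr hext.symm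
  have hĝs : BijOn ĝ (sphere 0 1) (sphere 0 1) := by
    refine ⟨fun u hu => ?_, fun u hu u' hu' h => ?_, fun v hv => ?_⟩
    · rw [mem_sphere_zero_iff_norm] at hu ⊢
      exact (hexts u hu).1
    · rw [mem_sphere_zero_iff_norm] at hu hu'
      exact eq_of_tendsto_boundary hd hi hgc hgm hφg himg hu hu' (hexts u hu).1 (hexts u hu).2
        (h ▸ (hexts u' hu').2)
    · have h1 : IsClosed (ĝ '' closedBall 0 1) :=
        ((isCompact_closedBall _ _).image_of_continuousOn hextc).isClosed
      have h2 : closure (ball 0 1) ⊆ ĝ '' closedBall 0 1 :=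
        closure_minimal (hĝb.image_eq.ge.trans (image_mono ball_subset_closedBall)) h1
      rw [hcl] at h2
      obtain ⟨u, hu, huv⟩ := h2 (sphere_subset_closedBall hv)
      refine ⟨u, ?_, huv⟩
      rw [mem_sphere_zero_iff_norm] at hv ⊢
      refine le_antisymm (mem_closedBall_zero_iff.1 hu) (not_lt.1 fun hlt => ?_)
      have := mem_ball_zero_iff.1 (hĝb.mapsTo (mem_ball_zero_iff.2 hlt))
      rw [huv, hv] at this
      exact this.ne rfl
  obtain ⟨G, hG1, hG2⟩ := exists_homeomorph_cone_extension hextc hĝb hĝs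
  have hφf : ∀ w ∈ ball (0 : ℂ) 1, (G.symm.trans f) w = φ w := by
    intro w hw
    obtain ⟨z, hz, rfl⟩ := hĝb.surjOn hw
    have hz1 := mem_ball_zero_iff.1 hz
    rw [← hG1 z hz1.le, Homeomorph.trans_apply, G.symm_apply_apply, hG1 z hz1.le, hext hz, hφg z hz]
  have hf₂0 : (G.symm.trans f) 0 = 0 := by rw [hφf 0 (mem_ball_self one_pos), hφ0]
  refine ⟨G, G.symm.trans f, ĝ, fun z => by simp, ?_, hf₂0, hd.congr hφf,
    hextc.mono sphere_subset_closedBall, hĝs, hG2⟩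
  have : G.symm 0 = 0 := f.injective (by rw [hf0]; exact hf₂0)
  rw [← this, G.apply_symm_apply]
  exact this.symm

end ConeExtension

section Kneser

variable {f : ℂ ≃ₜ ℂ}

/-- Multiplication by a nonzero complex number is isotopic to the identity. -/
lemma isotopicToIdRel_mul_const {μ : ℂ} (h : ∀ z, f z = μ * z) :
    IsotopicToIdRel ℂ f {0} := by
  have hμ : μ ≠ 0 := by
    rintro rfl
    have := f.injective ((h 1).trans ((by simp : (0:ℂ) * 1 = 0 * 0).trans (h 0).symm))
    exact one_ne_zero this
  have hH : Continuous fun q : ℂ × unitInterval =>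
      Homeomorph.mulLeft₀ (Complex.exp ((q.2 : ℝ) * Complex.log μ))
        (Complex.exp_ne_zero _) q.1 := by
    simp only [Homeomorph.coe_mulLeft₀]
    fun_prop
  have hH' := continuous_symm_of_continuous (H := fun t : unitInterval =>
    Homeomorph.mulLeft₀ (Complex.exp ((t : ℝ) * Complex.log μ)) (Complex.exp_ne_zero _)) hH
  refine ⟨fun t => Homeomorph.mulLeft₀ (Complex.exp ((t : ℝ) * Complex.log μ))
    (Complex.exp_ne_zero _), hH, hH', ?_, ?_, ?_⟩
  · ext z; simp
  · ext z; simp [Complex.exp_log hμ, h]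
  · intro t x hx
    rw [mem_singleton_iff] at hx
    simp [hx]

/-- A homeomorphism which is holomorphic near its fixed point `0` is isotopic to the identity
relative to `0`. -/
lemma isotopicToIdRel_of_differentiableOn (hf0 : f 0 = 0)
    (hd : DifferentiableOn ℂ f (ball 0 1)) :
    IsotopicToIdRel ℂ f {0} ∧ ∃ k : ℂ → ℂ, Continuous k ∧ (∀ z, k z ≠ 0) ∧ ∀ z, f z = z * k z := by
  have h0 : ball (0 : ℂ) 1 ∈ 𝓝 0 := ball_mem_nhds _ one_pos
  have hk : Continuous (dslope f 0) := by
    rw [← continuousOn_univ, continuousOn_dslope univ_mem]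
    exact ⟨f.continuous.continuousOn, hd.differentiableAt h0⟩
  have hkf : ∀ z, f z = z * dslope f 0 z := fun z => by
    have := sub_smul_dslope f 0 z
    simpa [hf0] using this.symm
  have hk0 : ∀ z, dslope f 0 z ≠ 0 := by
    intro z
    rcases eq_or_ne z 0 with rfl | hz
    · rw [dslope_same]
      exact deriv_ne_zero_of_injOn isOpen_ball hd f.injective.injOn (mem_ball_self one_pos)
    · intro h
      have := hkf z
      rw [h, mul_zero, ← hf0] at this
      exact hz (f.injective this)
  refine ⟨?_, dslope f 0, hk, hk0, hkf⟩
  have hμ : dslope f 0 0 ≠ 0 := hk0 0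
  set H : unitInterval → ℂ ≃ₜ ℂ := fun t =>
    if ht : (t : ℝ) = 0 then Homeomorph.mulLeft₀ _ hμ else
      ((Homeomorph.mulLeft₀ ((t : ℝ) : ℂ) (by exact_mod_cast ht)).trans f).trans
        (Homeomorph.mulLeft₀ ((t : ℝ) : ℂ) (by exact_mod_cast ht)).symm with hH
  have hHk : ∀ t : unitInterval, ∀ z, H t z = z * dslope f 0 ((t : ℝ) * z) := by
    intro t z
    by_cases ht : (t : ℝ) = 0
    · simp only [hH, dif_pos ht]
      simp [ht, mul_comm]
    · have ht' : ((t : ℝ) : ℂ) ≠ 0 := by exact_mod_cast ht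
      simp only [hH, dif_neg ht]
      simp only [Homeomorph.trans_apply, Homeomorph.symm_apply_eq, Homeomorph.coe_mulLeft₀]
      rw [hkf]; ring
  have hHc : Continuous fun q : ℂ × unitInterval => H q.2 q.1 := by
    simp only [hHk]
    exact continuous_fst.mul (hk.comp (by fun_prop))
  have h1 : H 1 = f := by
    ext z
    rw [hHk, hkf z]; simp
  rw [← h1]
  refine IsotopicToIdRel.of_path hHc (continuous_symm_of_continuous hHc) ?_
    (isotopicToIdRel_mul_const (μ := dslope f 0 0) fun z => ?_)
  · intro t x hx
    rw [mem_singleton_iff] at hx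
    rw [hHk, hx, zero_mul]
  · rw [hHk]; simp [mul_comm]

variable {β : ℂ → ℂ}

lemma exists_homeomorph_cone (hc : ContinuousOn β (sphere 0 1))
    (hβ : BijOn β (sphere 0 1) (sphere 0 1)) : ∃ B : ℂ ≃ₜ ℂ, ∀ z, B z = cone β z := by
  have hβ1 : ∀ u, ‖u‖ = 1 → ‖β u‖ = 1 := fun u hu =>
    mem_sphere_zero_iff_norm.1 (hβ.mapsTo (mem_sphere_zero_iff_norm.2 hu))
  exact exists_homeomorph_of_norm_le (continuous_cone hc hβ1) (bijective_cone hβ) fun z => by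
    rw [norm_cone hβ1]; exact le_max_right _ _

/-- The Alexander trick for a homeomorphism conical near infinity. -/
lemma isotopicToIdRel_of_cone (hβ : BijOn β (sphere 0 1) (sphere 0 1))
    {B : ℂ ≃ₜ ℂ} (hB : ∀ z, B z = cone β z) (hf0 : f 0 = 0)
    (hf : ∀ z, 1 ≤ ‖z‖ → f z = cone β z) (h : IsotopicToIdRel ℂ B {0}) :
    IsotopicToIdRel ℂ f {0} := by
  have hβ1 : ∀ u, ‖u‖ = 1 → ‖β u‖ = 1 := fun u hu =>
    mem_sphere_zero_iff_norm.1 (hβ.mapsTo (mem_sphere_zero_iff_norm.2 hu))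
  set H : unitInterval → ℂ ≃ₜ ℂ := fun t =>
    if ht : (t : ℝ) = 0 then B else
      ((Homeomorph.mulLeft₀ ((t : ℝ) : ℂ) (by exact_mod_cast ht)).symm.trans f).trans
        (Homeomorph.mulLeft₀ ((t : ℝ) : ℂ) (by exact_mod_cast ht)) with hH
  have hH0 : H 0 = B := dif_pos rfl
  have hHt : ∀ t : unitInterval, 0 < (t : ℝ) → ∀ z, H t z = (t : ℝ) * f (z / (t : ℝ)) := by
    intro t ht z
    simp only [hH, dif_neg ht.ne']
    simp [div_eq_inv_mul]
  have hHB : ∀ t : unitInterval, ∀ z, (t : ℝ) ≤ ‖z‖ → H t z = B z := by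
    intro t z htz
    rcases t.2.1.eq_or_lt with ht | ht
    · have : t = 0 := Subtype.ext ht.symm
      rw [this, hH0]
    · have ht' : ((t : ℝ) : ℂ) ≠ 0 := by exact_mod_cast ht.ne'
      rw [hHt t ht, hf, hB, ← cone_ofReal_mul ht, mul_div_cancel₀ _ ht']
      rwa [norm_div, Complex.norm_real, Real.norm_of_nonneg ht.le, one_le_div ht]
  have hf1 : ∀ z, ‖z‖ < 1 → ‖f z‖ < 1 := by
    intro z hz
    by_contra! hcon
    obtain ⟨w, hw⟩ := (bijective_cone hβ).2 (f z)
    have hw1 : 1 ≤ ‖w‖ := by rwa [← norm_cone hβ1 w, hw]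
    rw [← hf w hw1] at hw
    rw [f.injective hw] at hw1
    exact hz.not_ge hw1
  have hHn : ∀ t : unitInterval, ∀ z, ‖H t z‖ ≤ max ‖z‖ t := by
    intro t z
    rcases le_or_gt (t : ℝ) ‖z‖ with h1 | h1
    · rw [hHB t z h1, hB, norm_cone hβ1]; exact le_max_left _ _
    · have ht : 0 < (t : ℝ) := (norm_nonneg _).trans_lt h1
      refine le_trans ?_ (le_max_right _ _)
      rw [hHt t ht, norm_mul, Complex.norm_real, Real.norm_of_nonneg ht.le]
      refine mul_le_of_le_one_right ht.le (hf1 _ ?_).le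
      rwa [norm_div, Complex.norm_real, Real.norm_of_nonneg ht.le, div_lt_one ht]
  have hHc : Continuous fun q : ℂ × unitInterval => H q.2 q.1 := by
    rw [continuous_iff_continuousAt]
    rintro ⟨z, t⟩
    rcases t.2.1.eq_or_lt with ht | ht
    · rcases eq_or_ne z 0 with rfl | hz
      · have h0 : H t 0 = 0 := by
          have := hHn t 0
          rw [← ht, norm_zero, max_self] at this
          exact norm_le_zero_iff.1 this
        have hlim : Tendsto (fun q : ℂ × unitInterval => max ‖q.1‖ (q.2 : ℝ)) (𝓝 (0, t)) (𝓝 0) := by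
          have : Continuous fun q : ℂ × unitInterval => max ‖q.1‖ (q.2 : ℝ) := by fun_prop
          have := this.tendsto (0, t)
          simpa [← ht] using this
        rw [ContinuousAt]
        simp only [h0]
        exact squeeze_zero_norm (fun q => hHn q.2 q.1) hlim
      · have hev : ∀ᶠ q : ℂ × unitInterval in 𝓝 (z, t), (q.2 : ℝ) < ‖q.1‖ := by
          refine ContinuousAt.eventually_lt (by fun_prop) (by fun_prop) ?_
          simpa [← ht] using hz
        exact (B.continuous.comp continuous_fst).continuousAt.congr
          (hev.mono fun q hq => (hHB q.2 q.1 hq.le).symm)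
    · have hev : ∀ᶠ q : ℂ × unitInterval in 𝓝 (z, t), 0 < (q.2 : ℝ) :=
        ContinuousAt.eventually_lt (by fun_prop) (by fun_prop) ht
      have ht' : ((t : ℝ) : ℂ) ≠ 0 := by exact_mod_cast ht.ne'
      have : ContinuousAt (fun q : ℂ × unitInterval => ((q.2 : ℝ) : ℂ) * f (q.1 / (q.2 : ℝ)))
          (z, t) :=
        ContinuousAt.mul (by fun_prop) (f.continuous.continuousAt.comp
          (ContinuousAt.div (by fun_prop) (by fun_prop) ht'))
      exact this.congr (hev.mono fun q hq => (hHt q.2 hq q.1).symm)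
  have h1 : H 1 = f := by
    ext z
    rw [hHt 1 (by simp)]; simp
  rw [← h1]
  refine IsotopicToIdRel.of_path hHc (continuous_symm_of_continuous hHc) ?_ (hH0 ▸ h)
  intro t x hx
  rw [mem_singleton_iff] at hx
  subst hx
  rcases t.2.1.eq_or_lt with ht | ht
  · rw [hHB t 0 (by simp [← ht]), hB]; simp [cone]
  · rw [hHt t ht]; simp [hf0]

end Kneser

section Rotation

variable {β : ℂ → ℂ}

lemma bijOn_sphere_of_strictMono {β : ℂ → ℂ} {h : ℝ → ℝ} (hh : StrictMono h) (hc : Continuous h)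
    (hper : ∀ t, ∀ m : ℤ, h (t + m * (2 * Real.pi)) = h t + m * (2 * Real.pi))
    (hβ : ∀ t, β (Circle.exp t) = Circle.exp (h t)) : BijOn β (sphere 0 1) (sphere 0 1) := by
  have hex : ∀ u ∈ sphere (0 : ℂ) 1, ∃ t, u = Circle.exp t := fun u hu => by
    refine ⟨u.arg, ?_⟩
    have := Complex.norm_mul_exp_arg_mul_I u
    rw [mem_sphere_zero_iff_norm.1 hu] at this
    rw [Circle.coe_exp]
    simpa using this.symm
  have hpi := Real.pi_pos
  refine ⟨fun u hu => ?_, fun u hu v hv huv => ?_, fun v hv => ?_⟩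
  · obtain ⟨t, rfl⟩ := hex u hu
    rw [hβ, mem_sphere_zero_iff_norm, Circle.norm_coe]
  · obtain ⟨t, rfl⟩ := hex u hu
    obtain ⟨r, rfl⟩ := hex v hv
    rw [hβ, hβ, Circle.coe_inj, Circle.exp_eq_exp] at huv
    obtain ⟨m, hm⟩ := huv
    rw [← hper] at hm
    rw [Circle.coe_inj, Circle.exp_eq_exp]
    exact ⟨m, hh.injective hm⟩
  · obtain ⟨r, rfl⟩ := hex v hv
    obtain ⟨n, hn⟩ := exists_nat_ge (|r - h 0| / (2 * Real.pi))
    rw [div_le_iff₀ (by positivity)] at hn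
    have h1 : h (0 + ((n : ℤ) : ℝ) * (2 * Real.pi)) = h 0 + n * (2 * Real.pi) := by
      rw [hper]; push_cast; ring
    have h2 : h (0 + ((-n : ℤ) : ℝ) * (2 * Real.pi)) = h 0 - n * (2 * Real.pi) := by
      rw [hper]; push_cast; ring
    obtain ⟨t, ht⟩ := mem_range_of_exists_le_of_exists_ge hc (c := r)
      ⟨_, h2.le.trans (by linarith [neg_le_abs (r - h 0)])⟩
      ⟨_, le_trans (by linarith [le_abs_self (r - h 0)]) h1.ge⟩
    exact ⟨Circle.exp t, by simp, by rw [hβ, ht]⟩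

/-- The cone over a degree one homeomorphism of the circle is isotopic to the identity. -/
lemma isotopicToIdRel_cone (hβ : BijOn β (sphere 0 1) (sphere 0 1))
    (hl : HasLog fun u : Circle => β u / u) {B : ℂ ≃ₜ ℂ} (hB : ∀ z, B z = cone β z) :
    IsotopicToIdRel ℂ B {0} := by
  classical
  obtain ⟨l, hlc, hl⟩ := hl
  have hpi := Real.pi_pos
  set θ : Circle → ℝ := fun u => (l u).im with hθ
  have hθc : Continuous θ := Complex.continuous_im.comp hlc
  have hβθ : ∀ u : Circle, β u = u * Complex.exp (θ u * Complex.I) := by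
    intro u
    have h1 : ‖β u‖ = 1 := mem_sphere_zero_iff_norm.1 (hβ.mapsTo (by
      rw [mem_sphere_zero_iff_norm, Circle.norm_coe]))
    have h2 : ‖Complex.exp (l u)‖ = 1 := by rw [hl, norm_div, h1, Circle.norm_coe, div_one]
    rw [Complex.norm_exp, Real.exp_eq_one_iff] at h2
    have h3 : l u = θ u * Complex.I := Complex.ext (by simp [h2]) (by simp [hθ])
    rw [← h3, hl, mul_div_cancel₀ _ (Circle.coe_ne_zero u)]
  set T : ℝ → ℝ := fun t => θ (Circle.exp t) with hT
  have hTc : Continuous T := hθc.comp Circle.exp.continuous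
  have hTp : ∀ t, ∀ m : ℤ, T (t + m * (2 * Real.pi)) = T t := fun t m => by
    simp only [hT]
    rw [Circle.exp_eq_exp.2 ⟨m, rfl⟩]
  have hβT : ∀ t, β (Circle.exp t) = Circle.exp (t + T t) := fun t => by
    rw [hβθ, Circle.exp_add, Circle.coe_mul, Circle.coe_exp (T t)]
  have hmono : StrictMono fun t => t + T t := by
    have hinj : Function.Injective fun t => t + T t := by
      intro t r htr
      have h1 : β (Circle.exp t) = β (Circle.exp r) := by
        rw [hβT, hβT]; exact congrArg (fun x => (Circle.exp x : ℂ)) htr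
      have h2 := hβ.injOn (by simp) (by simp) h1
      rw [Circle.coe_inj, Circle.exp_eq_exp] at h2
      obtain ⟨m, hm⟩ := h2
      simp only [hm, hTp] at htr
      linarith
    rcases (continuous_id.add hTc).strictMono_of_inj hinj with h | h
    · exact h
    · have h1 := h (show (0 : ℝ) < 0 + (1 : ℤ) * (2 * Real.pi) by push_cast; linarith)
      simp only [hTp, id, Pi.add_apply] at h1
      push_cast at h1
      linarith
  set Θ : ℂ → ℝ := fun z => if h : z ∈ Submonoid.unitSphere ℂ then θ ⟨z, h⟩ else 0 with hΘ
  have hΘθ : ∀ u : Circle, Θ u = θ u := fun u => dif_pos u.2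
  have hΘc : ContinuousOn Θ (sphere 0 1) := by
    rw [continuousOn_iff_continuous_domRestrict]
    have : (sphere (0 : ℂ) 1).domRestrict Θ = fun x => θ ⟨x.1, x.2⟩ := by
      ext x
      exact dif_pos x.2
    rw [this]
    exact hθc.comp (Continuous.subtype_mk continuous_subtype_val _)
  set b : unitInterval → ℂ → ℂ := fun s u => u * Complex.exp (((s : ℝ) * Θ u : ℝ) * Complex.I)
    with hb
  have hbb : ∀ s, BijOn (b s) (sphere 0 1) (sphere 0 1) := by
    intro s
    refine bijOn_sphere_of_strictMono (h := fun t => t + s * T t) ?_ (by fun_prop) ?_ ?_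
    · intro t r htr
      have h1 := hmono htr
      simp only at h1 ⊢
      rcases s.2.1.eq_or_lt with h | h
      · rw [← h]; linarith
      · nlinarith [mul_pos h (sub_pos.2 h1), mul_nonneg (sub_nonneg.2 s.2.2) (sub_pos.2 htr).le]
    · intro t m
      simp only [hTp]; ring
    · intro t
      simp only [hb]
      rw [hΘθ, Circle.exp_add, Circle.coe_mul, Circle.coe_exp (s * T t)]
  have hbc : ∀ s, ContinuousOn (b s) (sphere 0 1) := fun s => by
    simp only [hb]
    exact continuousOn_id.mul (Complex.continuous_exp.comp_continuousOn
      ((Complex.continuous_ofReal.comp_continuousOn (continuousOn_const.mul hΘc)).mul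
        continuousOn_const))
  choose H hH using fun s => exists_homeomorph_cone (hbc s) (hbb s)
  have hHf : ∀ s z, H s z =
      z * Complex.exp (((s : ℝ) * Θ (z / (‖z‖ : ℂ)) : ℝ) * Complex.I) := by
    intro s z
    rw [hH, cone]
    rcases eq_or_ne z 0 with rfl | hz
    · simp
    · simp only [hb]
      rw [← mul_assoc, mul_div_cancel₀ _ (by simpa using hz)]
  have hHn : ∀ s z, ‖H s z‖ = ‖z‖ := fun s z => by
    rw [hHf, norm_mul, Complex.norm_exp_ofReal_mul_I, mul_one]
  have hHc : Continuous fun q : ℂ × unitInterval => H q.2 q.1 := by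
    have h1 : ContinuousOn (fun q : ℂ × unitInterval => H q.2 q.1) {q | q.1 ≠ 0} := by
      simp only [hHf]
      refine continuous_fst.continuousOn.mul (Complex.continuous_exp.comp_continuousOn
        ((Complex.continuous_ofReal.comp_continuousOn (ContinuousOn.mul (by fun_prop)
          (hΘc.comp (continuousOn_div_norm continuous_fst.continuousOn fun q hq => hq) ?_))).mul
          continuousOn_const))
      intro q hq
      exact mem_sphere_zero_iff_norm.2 (norm_div_norm_self hq)
    rw [continuous_iff_continuousAt]
    rintro ⟨z, s⟩
    rcases eq_or_ne z 0 with rfl | hz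
    · rw [ContinuousAt]
      simp only [hHf s 0, zero_mul]
      refine squeeze_zero_norm (fun q => (hHn q.2 q.1).le) ?_
      have : Continuous fun q : ℂ × unitInterval => ‖q.1‖ := by fun_prop
      simpa using this.tendsto (0, s)
    · exact h1.continuousAt ((isOpen_ne_fun continuous_fst continuous_const).mem_nhds hz)
  refine ⟨H, hHc, continuous_symm_of_continuous hHc, ?_, ?_, ?_⟩
  · ext z
    rw [hHf]; simp
  · ext z
    rw [hH, hB, cone, cone]
    rcases eq_or_ne z 0 with rfl | hz
    · simp
    · congr 1
      obtain ⟨u, hu⟩ : ∃ u : Circle, (u : ℂ) = z / (‖z‖ : ℂ) :=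
        ⟨⟨_, mem_sphere_zero_iff_norm.2 (norm_div_norm_self hz)⟩, rfl⟩
      rw [← hu, hβθ, ← hΘθ]
      simp [hb]
  · intro s x hx
    rw [mem_singleton_iff] at hx
    rw [hHf, hx, zero_mul]

/-- **Kneser's theorem**: an orientation-preserving homeomorphism of the plane fixing `0` is
isotopic to the identity relative to `0`. -/
theorem OrientationPreserving.isotopicToIdRel_zero {f : ℂ ≃ₜ ℂ} (hf : OrientationPreserving f)
    (hf0 : f 0 = 0) : IsotopicToIdRel ℂ f {0} := by
  obtain ⟨G, f₂, β, hfG, hG0, hf₂0, hd, hβc, hβ, hG⟩ := exists_conformal_factorization f hf0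
  obtain ⟨h1, k, hk, hk0, hfk⟩ := isotopicToIdRel_of_differentiableOn hf₂0 hd
  obtain ⟨B, hB⟩ := exists_homeomorph_cone hβc hβ
  have hβcirc : Continuous fun u : Circle => β u :=
    hβc.comp_continuous continuous_induced_dom fun u =>
      mem_sphere_zero_iff_norm.2 (Circle.norm_coe u)
  have hl : HasLog fun u : Circle => β u / u := by
    have h2 := (hasLog_slope_circle hf 0).mul (((hasLog_of_simplyConnected hk hk0).comp hβcirc).inv)
    have h3 : (fun u : Circle => β u / u) =
        fun u : Circle => (f (0 + u) - f 0) / u * (k (β u))⁻¹ := by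
      ext u
      have hu := Circle.norm_coe u
      have h4 : f u = β u * k (β u) := by
        rw [hfG, hfk, hG _ hu.ge, cone_of_norm_eq_one hu]
      have := hk0 (β u)
      have := Circle.coe_ne_zero u
      rw [hf0, zero_add, h4]
      field_simp
      simp
    rwa [h3]
  have h4 := (isotopicToIdRel_of_cone hβ hB hG0 hG (isotopicToIdRel_cone hβ hl hB)).trans h1
  convert! h4 using 1
  ext z
  exact hfG z

end Rotation

section Inversion

variable {f : ℂ ≃ₜ ℂ} {F : Set ℂ}

lemma continuous_inv_conj {H : unitInterval → ℂ ≃ₜ ℂ}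
    (h1 : Continuous fun q : ℂ × unitInterval => H q.2 q.1)
    (h2 : Continuous fun q : ℂ × unitInterval => (H q.2).symm q.1) (h0 : ∀ t, H t 0 = 0) :
    Continuous fun q : ℂ × unitInterval => (H q.2 q.1⁻¹)⁻¹ := by
  rw [continuous_iff_continuousAt]
  rintro ⟨z, t⟩
  rcases eq_or_ne z 0 with rfl | hz
  · refine Metric.tendsto_nhds.2 fun ε hε => ?_
    obtain ⟨M, hM⟩ := (((isCompact_closedBall (0 : ℂ) (1 / ε)).prod
      (isCompact_univ (X := unitInterval))).image h2).isBounded.exists_norm_le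
    have hev : ∀ᶠ q : ℂ × unitInterval in 𝓝 (0, t), ‖q.1‖ * (|M| + 1) < 1 := by
      refine ContinuousAt.eventually_lt (by fun_prop) continuousAt_const ?_
      simp
    filter_upwards [hev] with q hq
    simp only [inv_zero, h0, dist_zero_right]
    rcases eq_or_ne q.1 0 with hq0 | hq0
    · simpa [hq0, h0] using hε
    by_contra! hcon
    rw [norm_inv] at hcon
    have hy : ‖H q.2 q.1⁻¹‖ ≤ 1 / ε := by
      rw [one_div]
      exact le_inv_of_le_inv₀ hε hcon
    have h3 := hM _ (mem_image_of_mem _ (x := (H q.2 q.1⁻¹, q.2))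
      ⟨mem_closedBall_zero_iff.2 hy, mem_univ _⟩)
    simp only [Homeomorph.symm_apply_apply, norm_inv] at h3
    have h4 : 0 < ‖q.1‖ := norm_pos_iff.2 hq0
    rw [inv_le_iff_one_le_mul₀ h4] at h3
    nlinarith [le_abs_self M]
  · have hne : H t z⁻¹ ≠ 0 := fun h => inv_ne_zero hz ((H t).injective (h.trans (h0 t).symm))
    have hc : ContinuousAt (fun q : ℂ × unitInterval => (q.1⁻¹, q.2)) (z, t) :=
      (continuousAt_fst.inv₀ hz).prodMk continuousAt_snd
    exact ContinuousAt.inv₀ (ContinuousAt.comp (g := fun q : ℂ × unitInterval => H q.2 q.1)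
      h1.continuousAt hc) hne

lemma continuous_inv_conj_self (h0 : f 0 = 0) : Continuous fun z => (f z⁻¹)⁻¹ :=
  (continuous_inv_conj (H := fun _ => f) (f.continuous.comp continuous_fst)
    (f.symm.continuous.comp continuous_fst) fun _ => h0).comp
      (continuous_id.prodMk (continuous_const (y := (0 : unitInterval))))

/-- The conjugate by the inversion of a homeomorphism fixing `0`. -/
noncomputable def invConj (f : ℂ ≃ₜ ℂ) (h0 : f 0 = 0) : ℂ ≃ₜ ℂ where
  toFun z := (f z⁻¹)⁻¹
  invFun z := (f.symm z⁻¹)⁻¹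
  left_inv z := by simp
  right_inv z := by simp
  continuous_toFun := continuous_inv_conj_self h0
  continuous_invFun := continuous_inv_conj_self (f := f.symm) (by rw [f.symm_apply_eq, h0])

@[simp] lemma invConj_apply (h0 : f 0 = 0) (z : ℂ) : invConj f h0 z = (f z⁻¹)⁻¹ := rfl

lemma IsotopicToIdRel.invConj (h : IsotopicToIdRel ℂ f F) (hF : 0 ∈ F) (h0 : f 0 = 0) :
    IsotopicToIdRel ℂ (invConj f h0) {z | z⁻¹ ∈ F} := by
  obtain ⟨H, h1, h2, h3, h4, h5⟩ := h
  have hc := continuous_inv_conj h1 h2 fun t => h5 t 0 hF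
  have hc' := continuous_symm_of_continuous
    (H := fun t : unitInterval => _root_.invConj (H t) (h5 t 0 hF)) hc
  refine ⟨fun t => _root_.invConj (H t) (h5 t 0 hF), hc, hc', ?_, ?_, fun t x hx => ?_⟩
  · ext z; simp [h3]
  · ext z; simp [h4]
  · rw [invConj_apply, h5 t _ hx, inv_inv]

/-- The image of a set by the inversion. -/
def invSet (F : Set ℂ) : Set ℂ := {z | z ≠ 0 ∧ z⁻¹ ∈ F}

lemma isClosed_invSet (hF : IsClosed F) (hb : IsBounded F) : IsClosed (invSet F) := by
  obtain ⟨M, hM0, hM⟩ := hb.exists_pos_norm_le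
  have hs : IsClosed {z : ℂ | 1 / M ≤ ‖z‖} := isClosed_le continuous_const continuous_norm
  have h0 : ∀ z : ℂ, 1 / M ≤ ‖z‖ → z ≠ 0 := fun z hz =>
    norm_pos_iff.1 ((one_div_pos.2 hM0).trans_le hz)
  have h : invSet F = {z : ℂ | 1 / M ≤ ‖z‖} ∩ (fun z => z⁻¹) ⁻¹' F := by
    ext z
    refine ⟨fun hz => ⟨?_, hz.2⟩, fun hz => ⟨h0 z hz.1, hz.2⟩⟩
    have := hM _ hz.2
    rw [norm_inv] at this
    rw [mem_ofPred_eq, one_div]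
    exact inv_le_of_inv_le₀ (norm_pos_iff.2 hz.1) this
  rw [h]
  exact (continuousOn_id.inv₀ h0).preimage_isClosed_of_isClosed hs hF

lemma isClosed_insert_invSet (hF : IsClosed F) : IsClosed (insert 0 (invSet F)) := by
  rw [← isOpen_compl_iff]
  have h : (insert 0 (invSet F))ᶜ = {0}ᶜ ∩ (fun z => z⁻¹) ⁻¹' Fᶜ := by
    ext z
    simp only [invSet, mem_compl_iff, mem_insert_iff, mem_ofPred_eq, mem_inter_iff,
      mem_singleton_iff, mem_preimage]
    tauto
  rw [h]
  exact (continuousOn_id.inv₀ fun z hz => hz).isOpen_inter_preimage isOpen_compl_singleton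
    hF.isOpen_compl

lemma noBddClopen_invSet (hFc : IsPreconnected F) (h0 : 0 ∈ F) : NoBddClopen (invSet F) := by
  intro B hB hBb hBc hBd
  by_contra hne
  obtain ⟨b, hb⟩ := nonempty_iff_ne_empty.2 hne
  obtain ⟨z, -, hz1, hz2⟩ := isPreconnected_closed_iff.1 hFc _ _ (isClosed_invSet hBc hBb)
    (isClosed_insert_invSet hBd) (fun z hz => by
      rcases eq_or_ne z 0 with rfl | hz0
      · exact Or.inr (mem_insert _ _)
      · by_cases hzB : z⁻¹ ∈ B
        · exact Or.inl ⟨hz0, hzB⟩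
        · exact Or.inr (Or.inr ⟨hz0, ⟨inv_ne_zero hz0, by rwa [inv_inv]⟩, hzB⟩))
    ⟨b⁻¹, (hB hb).2, inv_ne_zero (hB hb).1, by rwa [inv_inv]⟩ ⟨0, h0, mem_insert _ _⟩
  rcases hz2 with rfl | hz2
  · exact hz1.1 rfl
  · exact hz2.2.2 hz1.2

lemma isPreconnected_image_inv {Γ : Set ℂ} (hΓ : IsPreconnected Γ) (h0 : ∀ w ∈ Γ, w ≠ 0) :
    IsPreconnected ((fun z => z⁻¹) '' Γ) :=
  hΓ.image _ (continuousOn_id.inv₀ h0)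

lemma LocalLink.invConj (h0 : f 0 = 0) {p : ℂ} (hp : p ≠ 0) (h : LocalLink f F p⁻¹) :
    LocalLink (invConj f h0) (invSet F) p := by
  intro ε hε
  have h1 : ∀ᶠ w in 𝓝 p⁻¹, w ≠ 0 ∧ ‖w⁻¹ - p‖ < ε := by
    refine (eventually_ne_nhds (inv_ne_zero hp)).and ?_
    have := Metric.tendsto_nhds.1 (continuousAt_inv₀ (inv_ne_zero hp)) ε hε
    simpa [dist_eq_norm] using this
  obtain ⟨ε', hε', h1⟩ := Metric.eventually_nhds_iff.1 h1
  obtain ⟨δ', hδ', hl⟩ := h ε' hε'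
  have h2 : ∀ᶠ z in 𝓝 p, z ≠ 0 ∧ ‖z⁻¹ - p⁻¹‖ < δ' := by
    refine (eventually_ne_nhds hp).and ?_
    have := Metric.tendsto_nhds.1 (continuousAt_inv₀ hp) δ' hδ'
    simpa [dist_eq_norm] using this
  obtain ⟨δ, hδ, h2⟩ := Metric.eventually_nhds_iff.1 h2
  refine ⟨δ, hδ, fun z hz hzp => ?_⟩
  obtain ⟨hz0, hz'⟩ := h2 (by rwa [dist_eq_norm])
  obtain ⟨Γ, g1, g2, g3, g4⟩ := hl z⁻¹ (fun h => hz ⟨hz0, h⟩) hz'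
  have g5 : ∀ w ∈ Γ, w ≠ 0 ∧ ‖w⁻¹ - p‖ < ε := fun w hw => h1 (by
    rw [dist_eq_norm]; exact (g2 w hw).1)
  refine ⟨(fun z => z⁻¹) '' Γ, isPreconnected_image_inv g1 fun w hw => (g5 w hw).1, ?_,
    ⟨_, g3, inv_inv z⟩, ⟨_, g4, rfl⟩⟩
  rintro _ ⟨w, hw, rfl⟩
  refine ⟨(g5 w hw).2, fun h => (g2 w hw).2 ?_⟩
  simpa using h.2

lemma LocalLink.linkAtInfinity (h0 : f 0 = 0) (hF : 0 ∈ F) (h : LocalLink f F 0) :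
    LinkAtInfinity (_root_.invConj f h0) (invSet F) := by
  intro R
  obtain ⟨δ, hδ, hl⟩ := h (1 / max R 1) (by positivity)
  refine ⟨1 / δ, fun z hz hzR => ?_⟩
  have hz1 : 0 < ‖z‖ := (one_div_pos.2 hδ).trans hzR
  have hz0 : z ≠ 0 := norm_pos_iff.1 hz1
  obtain ⟨Γ, g1, g2, g3, g4⟩ := hl z⁻¹ (fun h => hz ⟨hz0, h⟩) (by
    rw [sub_zero, norm_inv]
    exact inv_lt_of_inv_lt₀ hδ (by rwa [← one_div]))
  have g5 : ∀ w ∈ Γ, w ≠ 0 := fun w hw hw0 => (g2 w hw).2 (hw0 ▸ hF)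
  refine ⟨(fun z => z⁻¹) '' Γ, isPreconnected_image_inv g1 g5, ?_,
    ⟨_, g3, inv_inv z⟩, ⟨_, g4, rfl⟩⟩
  rintro _ ⟨w, hw, rfl⟩
  refine ⟨?_, fun h => (g2 w hw).2 (by simpa using h.2)⟩
  have h5 := (g2 w hw).1
  rw [sub_zero, one_div] at h5
  rw [norm_inv]
  exact (le_max_left R 1).trans_lt (lt_inv_of_lt_inv₀ (norm_pos_iff.2 (g5 w hw)) h5)

lemma isotopicToIdRel_of_isBounded (hF : IsClosed F) (hFc : IsConnected F) (hFb : IsBounded F)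
    (h0 : 0 ∈ F) (hne : F ≠ {0}) (hfix : ∀ x ∈ F, f x = x) (hl : ∀ p ∈ F, LocalLink f F p) :
    IsotopicToIdRel ℂ f F := by
  have hf0 : f 0 = 0 := hfix 0 h0
  have hne' : (invSet F).Nonempty := by
    obtain ⟨p, hp, hp0⟩ : ∃ p ∈ F, p ≠ 0 := by
      by_contra! hcon
      exact hne (Subset.antisymm hcon (singleton_subset_iff.2 h0))
    exact ⟨p⁻¹, inv_ne_zero hp0, by rwa [inv_inv]⟩
  have hfix' : ∀ x ∈ invSet F, invConj f hf0 x = x := fun x hx => by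
    rw [invConj_apply, hfix _ hx.2, inv_inv]
  have hFi := isClosed_invSet hF hFb
  have hnb := noBddClopen_invSet hFc.isPreconnected h0
  have h1 := isotopicToIdRel_of_link hFi hne' hnb hfix'
    (fun p hp => (hl _ hp.2).invConj hf0 hp.1) ((hl 0 h0).linkAtInfinity hf0 h0)
  have hc : invConj f hf0 0 = 0 := by simp [hf0]
  have h2 := ((h1.insert_fixedPoint hFi hne' hnb hc).invConj (mem_insert _ _) hc).mono
    (F' := F) (fun z hz => by
      rcases eq_or_ne z 0 with rfl | hz0
      · simp
      · exact Or.inr ⟨inv_ne_zero hz0, by rwa [inv_inv]⟩)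
  convert! h2 using 1
  ext z
  simp

lemma noBddClopen_of_not_isBounded (hFc : IsPreconnected F) (hb : ¬ IsBounded F) :
    NoBddClopen F := by
  intro B hB hBb hBc hBd
  by_contra hne
  obtain ⟨b, hb'⟩ := nonempty_iff_ne_empty.2 hne
  obtain ⟨c, hc⟩ : (F \ B).Nonempty := by
    rw [sdiff_nonempty]
    exact fun h => hb (hBb.subset h)
  obtain ⟨z, -, hz1, hz2⟩ := isPreconnected_closed_iff.1 hFc _ _ hBc hBd
    (fun z hz => by by_cases hzB : z ∈ B <;> simp [hz, hzB])
    ⟨b, hB hb', hb'⟩ ⟨c, hc.1, hc⟩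
  exact hz2.2 hz1

lemma OrientationPreserving.conj_addRight (hf : OrientationPreserving f) (p : ℂ) :
    OrientationPreserving
      (((Homeomorph.addRight p).trans f).trans (Homeomorph.addRight p).symm) := by
  have hs : ∀ z, (Homeomorph.addRight p).symm z = z - p := fun z => by
    rw [Homeomorph.symm_apply_eq]; simp
  intro x
  obtain ⟨H, hH, h0, h1, hne⟩ := hf (x + p)
  refine ⟨fun q => H q - p, hH.sub continuous_const, fun u => ?_, fun u => ?_, fun q h => ?_⟩
  · simp [h0, hs, add_right_comm]
  · simp [h1, hs, sub_add_eq_add_sub]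
  · refine hne q ?_
    rw [mem_singleton_iff, sub_eq_iff_eq_add] at h
    simp [h, hs]

end Inversion

theorem unlinked_of_closed_connected_plane
    (F : Set ℂ) (hFclosed : IsClosed F) (hFconn : IsConnected F)
    (f : ℂ ≃ₜ ℂ) (hf : OrientationPreserving f) (hfix : ∀ x ∈ F, f x = x) :
    IsotopicToIdRel ℂ f F := by
  by_cases hb : IsBounded F
  · obtain ⟨p, hp⟩ := hFconn.nonempty
    set e : ℂ ≃ₜ ℂ := Homeomorph.addRight p
    set g : ℂ ≃ₜ ℂ := (e.trans f).trans e.symm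
    have he0 : e 0 = p := zero_add p
    have hg : OrientationPreserving g := hf.conj_addRight p
    have himg : e '' (e ⁻¹' F) = F := image_preimage_eq _ e.surjective
    have hgfix : ∀ x ∈ e ⁻¹' F, g x = x := fun x hx => by
      change e.symm (f (e x)) = x
      rw [hfix _ hx, e.symm_apply_apply]
    have h0 : (0 : ℂ) ∈ e ⁻¹' F := by rwa [mem_preimage, he0]
    have hpre : e ⁻¹' F = e.symm '' F := (e.toEquiv.image_symm_eq_preimage F).symm
    have hcl : IsClosed (e ⁻¹' F) := hFclosed.preimage e.continuous
    have hcon : IsConnected (e ⁻¹' F) := by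
      rw [hpre]; exact hFconn.image _ e.symm.continuous.continuousOn
    have hbd : IsBounded (e ⁻¹' F) := by
      rw [hpre]
      exact ((isCompact_of_isClosed_isBounded hFclosed hb).image e.symm.continuous).isBounded
    have hiso : IsotopicToIdRel ℂ g (e ⁻¹' F) := by
      by_cases hs : e ⁻¹' F = {0}
      · rw [hs]
        exact hg.isotopicToIdRel_zero (hgfix 0 h0)
      · exact isotopicToIdRel_of_isBounded hcl hcon hbd h0 hs hgfix
          (link_of_orientationPreserving hg hcl hcon hgfix).1
    have h := hiso.conj e
    rw [himg] at h
    convert! h using 1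
    ext z
    simp [g]
  · obtain ⟨h1, h2⟩ := link_of_orientationPreserving hf hFclosed hFconn hfix
    exact isotopicToIdRel_of_link hFclosed hFconn.nonempty
      (noBddClopen_of_not_isBounded hFconn.isPreconnected hb) hfix h1 h2
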